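/- Let K ⊆ ℂ be a compact set whose complement Ω := ℂ∞ ∖ K is a finitely connected domain with C^∞ boundary. Then γ(K) = max{ 2 Re h′(∞) − (1/2π) ∫_{∂Ω} |h(z)|² |dz| : h ∈ A(Ω), h(∞) = 0 }, and the maximum is attained. -/

import Mathlib

open Complex Filter Metric Set Topology Bornology MeasureTheory

noncomputable section

/-- `f` has value `l` at infinity and derivative `w` at infinity (within the set `s`), i.e.
`f(z) → l` and `z (f(z) - l) → w` as `z → ∞` within `s`. -/
def HasDerivAtInftyOn (f : ℂ → ℂ) (s : Set ℂ) (l w : ℂ) : Prop :=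
  Tendsto f (cobounded ℂ ⊓ 𝓟 s) (𝓝 l) ∧
    Tendsto (fun z => z * (f z - l)) (cobounded ℂ ⊓ 𝓟 s) (𝓝 w)

/-- The analytic capacity of a plane set `K`:
`γ(K) = sup { |f′(∞)| : f` holomorphic on `ℂ∞ ∖ K`, `‖f‖ ≤ 1 }`. -/
def analyticCapacity (K : Set ℂ) : ℝ :=
  sSup { r : ℝ | ∃ (f : ℂ → ℂ) (l w : ℂ),
    DifferentiableOn ℂ f Kᶜ ∧ (∀ z ∈ Kᶜ, ‖f z‖ ≤ 1) ∧
    HasDerivAtInftyOn f Kᶜ l w ∧ r = ‖w‖ }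

/-- Data exhibiting the boundary of a compact set `K ⊆ ℂ` as a finite union of pairwise
disjoint `C^∞` Jordan curves, positively oriented: each curve is a `1`-periodic regular `C^∞`
parametrization, injective on a period, the curve images are pairwise disjoint and their union
is the frontier of `K`, and the total winding number around every point of `interior K` is `1`
(counterclockwise orientation). -/
structure SmoothBoundary (K : Set ℂ) where
  n : ℕ
  npos : 0 < n
  curve : Fin n → ℝ → ℂ
  smooth : ∀ i, ContDiff ℝ (⊤ : ℕ∞) (curve i)
  periodic : ∀ i, Function.Periodic (curve i) 1
  injOn : ∀ i, Set.InjOn (curve i) (Set.Ico (0:ℝ) 1)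
  regular : ∀ i t, deriv (curve i) t ≠ 0
  boundary : (⋃ i, Set.range (curve i)) = frontier K
  disjointCurves : ∀ i j, i ≠ j → Disjoint (Set.range (curve i)) (Set.range (curve j))
  orientation : ∀ w ∈ interior K,
    (∑ i, ∫ t in (0:ℝ)..1, deriv (curve i) t / (curve i t - w)) = 2 * Real.pi * Complex.I

/-- The contour integral `∫_{∂Ω} f(ζ) dζ` over a finite family of parametrized curves. -/
def contourIntegralOf {n : ℕ} (curve : Fin n → ℝ → ℂ) (f : ℂ → ℂ) : ℂ :=
  ∑ i, ∫ t in (0:ℝ)..1, f (curve i t) * deriv (curve i) t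

/-- The arc-length integral `∫_{∂Ω} f(ζ) |dζ|` over a finite family of parametrized curves. -/
def arcIntegralOf {n : ℕ} (curve : Fin n → ℝ → ℂ) (f : ℂ → ℝ) : ℝ :=
  ∑ i, ∫ t in (0:ℝ)..1, f (curve i t) * ‖deriv (curve i) t‖

/-- `f ∈ A(Ω)` with value `l` at `∞`, where `Ω = ℂ∞ ∖ K`: `f` is continuous on the closure of
`Ω` (whose finite part is `(interior K)ᶜ`), holomorphic on `Ω`, and `f(z) → l` as `z → ∞`. -/
def MemA (K : Set ℂ) (f : ℂ → ℂ) (l : ℂ) : Prop :=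
  ContinuousOn f (interior K)ᶜ ∧ DifferentiableOn ℂ f Kᶜ ∧
    Tendsto f (cobounded ℂ ⊓ 𝓟 Kᶜ) (𝓝 l)

/-- A smooth regular simple closed curve. -/
structure SC (γ : ℝ → ℂ) : Prop where
  smooth : ContDiff ℝ (⊤ : ℕ∞) γ
  per : Function.Periodic γ 1
  inj : Set.InjOn γ (Set.Ico (0:ℝ) 1)
  reg : ∀ t, deriv γ t ≠ 0

lemma per_deriv {f : ℝ → ℂ} (h : Function.Periodic f 1) : Function.Periodic (deriv f) 1 := by
  intro t
  have h1 : (fun x => f (x + 1)) = f := funext h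
  have h2 := deriv_comp_add_const f 1 t
  rw [h1] at h2
  exact h2.symm

lemma per_fract {E : Type*} {f : ℝ → E} (h : Function.Periodic f 1) (t : ℝ) :
    f t = f (Int.fract t) := by
  have := h.sub_int_mul_eq (x := t) ⌊t⌋
  rw [mul_one] at this
  rw [← this]; rfl

lemma per_bdd {f : ℝ → ℂ} (h : Function.Periodic f 1) (hc : Continuous f) :
    ∃ C, 0 < C ∧ ∀ t, ‖f t‖ ≤ C := by
  obtain ⟨C, hC⟩ := (isCompact_Icc (a := (0:ℝ)) (b := 1)).exists_bound_of_continuousOn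
    hc.continuousOn
  refine ⟨max C 1, by positivity, fun t => ?_⟩
  rw [per_fract h]
  exact (hC _ ⟨Int.fract_nonneg t, (Int.fract_lt_one t).le⟩).trans (le_max_left _ _)

lemma per_low {f : ℝ → ℂ} (h : Function.Periodic f 1) (hc : Continuous f) (h0 : ∀ t, f t ≠ 0) :
    ∃ c, 0 < c ∧ ∀ t, c ≤ ‖f t‖ := by
  have hp : Function.Periodic (fun t => (f t)⁻¹) 1 := fun t => by simp only [h t]
  obtain ⟨C, hC, hb⟩ := per_bdd hp (hc.inv₀ h0)
  refine ⟨C⁻¹, by positivity, fun t => ?_⟩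
  have := hb t
  rw [norm_inv] at this
  exact inv_le_of_inv_le₀ (norm_pos_iff.2 (h0 t)) this

lemma per_lip {f : ℝ → ℂ} (h : Function.Periodic f 1) (hc : ContDiff ℝ 1 f) :
    ∃ L, 0 < L ∧ ∀ t t', ‖f t - f t'‖ ≤ L * |t - t'| := by
  obtain ⟨C, hC, hb⟩ := per_bdd (per_deriv h) (hc.continuous_deriv le_rfl)
  refine ⟨C, hC, fun t t' => ?_⟩
  have := Convex.norm_image_sub_le_of_norm_deriv_le (f := f) (C := C) (s := univ) (x := t') (y := t)
    (fun x _ => hc.differentiable one_ne_zero x) (fun x _ => hb x) convex_univ (mem_univ _) (mem_univ _)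
  simpa using this

lemma smooth_deriv {f : ℝ → ℂ} (h : ContDiff ℝ (⊤ : ℕ∞) f) : ContDiff ℝ (⊤ : ℕ∞) (deriv f) :=
  (contDiff_infty_iff_deriv.1 h).2

namespace SC
variable {γ : ℝ → ℂ}

lemma diff (h : SC γ) : Differentiable ℝ γ := h.smooth.differentiable (by simp)
lemma hasD (h : SC γ) (t : ℝ) : HasDerivAt γ (deriv γ t) t := (h.diff t).hasDerivAt
lemma cont (h : SC γ) : Continuous γ := h.smooth.continuous
lemma smooth1 (h : SC γ) : ContDiff ℝ (⊤ : ℕ∞) (deriv γ) := smooth_deriv h.smooth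
lemma cont1 (h : SC γ) : Continuous (deriv γ) := h.smooth1.continuous
lemma hasD1 (h : SC γ) (t : ℝ) : HasDerivAt (deriv γ) (deriv (deriv γ) t) t :=
  (h.smooth1.differentiable (by simp) t).hasDerivAt
lemma smooth2 (h : SC γ) : ContDiff ℝ (⊤ : ℕ∞) (deriv (deriv γ)) := smooth_deriv h.smooth1
lemma cont2 (h : SC γ) : Continuous (deriv (deriv γ)) := h.smooth2.continuous
lemma per1 (h : SC γ) : Function.Periodic (deriv γ) 1 := per_deriv h.per
lemma per2 (h : SC γ) : Function.Periodic (deriv (deriv γ)) 1 := per_deriv h.per1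

lemma inj' (h : SC γ) {t t' : ℝ} (ht : |t - t'| < 1) (e : γ t = γ t') : t = t' := by
  have e1 : Int.fract t = Int.fract t' := by
    apply h.inj ⟨Int.fract_nonneg _, Int.fract_lt_one _⟩ ⟨Int.fract_nonneg _, Int.fract_lt_one _⟩
    rw [← per_fract h.per, ← per_fract h.per, e]
  obtain ⟨z, hz⟩ := Int.fract_eq_fract.1 e1
  have : |(z:ℝ)| < 1 := by rwa [← hz]
  have hz0 : z = 0 := by
    have : |z| < 1 := by exact_mod_cast this
    exact Int.abs_lt_one_iff.1 this
  rw [hz0] at hz; push_cast at hz; linarith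

end SC

/-- Average of `f` over the segment from `t` to `τ`. -/
def sl (f : ℝ → ℂ) (t τ : ℝ) : ℂ := ∫ θ in (0:ℝ)..1, f (t + θ * (τ - t))

def sl2 (f : ℝ → ℂ) (t τ : ℝ) : ℂ := ∫ θ in (0:ℝ)..1, (θ:ℂ) * f (t + θ * (τ - t))

lemma sl_eq {f : ℝ → ℂ} (hf : ContDiff ℝ 1 f) (t τ : ℝ) :
    f τ - f t = ((τ - t : ℝ) : ℂ) * sl (deriv f) t τ := by
  have h1 : ∀ θ ∈ uIcc (0:ℝ) 1, HasDerivAt (fun θ : ℝ => f (t + θ * (τ - t)))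
      (((τ - t : ℝ) : ℂ) * deriv f (t + θ * (τ - t))) θ := by
    intro θ _
    have hd := (hf.differentiable one_ne_zero (t + θ * (τ - t))).hasDerivAt
    have h2 : HasDerivAt (fun θ : ℝ => t + θ * (τ - t)) (τ - t) θ := by
      simpa using ((hasDerivAt_id θ).mul_const (τ - t)).const_add t
    have := hd.scomp θ h2
    simpa [Function.comp_def] using this
  have hc : Continuous (deriv f) := hf.continuous_deriv le_rfl
  have := intervalIntegral.integral_eq_sub_of_hasDerivAt h1
    (Continuous.intervalIntegrable (by fun_prop) _ _)
  rw [intervalIntegral.integral_const_mul] at this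
  rw [sl, this]; simp

lemma sl2_eq {f : ℝ → ℂ} (hf : ContDiff ℝ 1 f) (t τ : ℝ) :
    f τ = sl f t τ + ((τ - t : ℝ) : ℂ) * sl2 (deriv f) t τ := by
  have hc : Continuous (deriv f) := hf.continuous_deriv le_rfl
  have hc0 : Continuous f := hf.continuous
  have h1 : ∀ θ ∈ uIcc (0:ℝ) 1, HasDerivAt (fun θ : ℝ => (θ:ℂ) * f (t + θ * (τ - t)))
      (f (t + θ * (τ - t)) + ((τ - t : ℝ) : ℂ) * ((θ:ℂ) * deriv f (t + θ * (τ - t)))) θ := by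
    intro θ _
    have hd := (hf.differentiable one_ne_zero (t + θ * (τ - t))).hasDerivAt
    have h2 : HasDerivAt (fun θ : ℝ => t + θ * (τ - t)) (τ - t) θ := by
      simpa using ((hasDerivAt_id θ).mul_const (τ - t)).const_add t
    have h3 := hd.scomp θ h2
    have h4 : HasDerivAt (fun θ : ℝ => (θ:ℂ)) 1 θ := Complex.ofRealCLM.hasDerivAt
    have := h4.mul h3
    refine this.congr_deriv ?_
    simp only [Function.comp, Complex.real_smul]; ring
  have := intervalIntegral.integral_eq_sub_of_hasDerivAt h1
    (Continuous.intervalIntegrable (by fun_prop) _ _)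
  rw [intervalIntegral.integral_add (Continuous.intervalIntegrable (by fun_prop) _ _)
    (Continuous.intervalIntegrable (by fun_prop) _ _), intervalIntegral.integral_const_mul] at this
  rw [sl, sl2, this]; simp

lemma sl_cont {f : ℝ → ℂ} (hf : Continuous f) : Continuous (fun p : ℝ × ℝ => sl f p.1 p.2) := by
  unfold sl
  apply intervalIntegral.continuous_parametric_intervalIntegral_of_continuous'
  fun_prop

lemma sl2_cont {f : ℝ → ℂ} (hf : Continuous f) : Continuous (fun p : ℝ × ℝ => sl2 f p.1 p.2) := by
  unfold sl2
  apply intervalIntegral.continuous_parametric_intervalIntegral_of_continuous'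
  fun_prop

lemma sl_self (f : ℝ → ℂ) (t : ℝ) : sl f t t = f t := by simp [sl]

lemma sl_per {f : ℝ → ℂ} (hf : Function.Periodic f 1) (t τ : ℝ) : sl f (t+1) (τ+1) = sl f t τ := by
  unfold sl
  congr 1; ext θ
  rw [← hf (t + θ * (τ - t))]; congr 1; ring

lemma sl_bdd {f : ℝ → ℂ} {C : ℝ} (hf : ∀ t, ‖f t‖ ≤ C) (t τ : ℝ) : ‖sl f t τ‖ ≤ C := by
  have := intervalIntegral.norm_integral_le_of_norm_le_const (a := (0:ℝ)) (b := 1) (C := C)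
    (f := fun θ => f (t + θ * (τ - t))) (fun θ _ => hf _)
  simpa [sl] using this

lemma sl2_bdd {f : ℝ → ℂ} {C : ℝ} (hf : ∀ t, ‖f t‖ ≤ C) (t τ : ℝ) : ‖sl2 f t τ‖ ≤ C := by
  have := intervalIntegral.norm_integral_le_of_norm_le_const (a := (0:ℝ)) (b := 1) (C := C)
    (f := fun θ => (θ:ℂ) * f (t + θ * (τ - t))) (fun θ hθ => by
      rw [uIoc_of_le zero_le_one] at hθ
      rw [norm_mul, Complex.norm_real, Real.norm_of_nonneg hθ.1.le]
      calc θ * _ ≤ 1 * C := by gcongr; exact hθ.2; exact hf _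
        _ = C := one_mul _)
  simpa [sl2] using this

lemma sl_lip {f : ℝ → ℂ} {L : ℝ} (hc : Continuous f) (hf : ∀ t t', ‖f t - f t'‖ ≤ L * |t - t'|)
    (t t' τ : ℝ) : ‖sl f t τ - sl f t' τ‖ ≤ L * |t - t'| := by
  have hL : ∀ x : ℝ, 0 ≤ L * |x| := fun x => (norm_nonneg _).trans (by simpa using hf x 0)
  have := intervalIntegral.norm_integral_le_of_norm_le_const (a := (0:ℝ)) (b := 1) (C := L * |t - t'|)
    (f := fun θ => f (t + θ * (τ - t)) - f (t' + θ * (τ - t'))) (fun θ hθ => by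
      rw [uIoc_of_le zero_le_one] at hθ
      refine (hf _ _).trans ?_
      have e : t + θ * (τ - t) - (t' + θ * (τ - t')) = (1 - θ) * (t - t') := by ring
      rw [e, abs_mul, abs_of_nonneg (by linarith [hθ.2])]
      nlinarith [hL (t - t'), hθ.1, hθ.2])
  rw [intervalIntegral.integral_sub (Continuous.intervalIntegrable (by fun_prop) _ _)
    (Continuous.intervalIntegrable (by fun_prop) _ _)] at this
  simpa [sl] using this

lemma sl2_lip {f : ℝ → ℂ} {L : ℝ} (hc : Continuous f) (hf : ∀ t t', ‖f t - f t'‖ ≤ L * |t - t'|)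
    (t t' τ : ℝ) : ‖sl2 f t τ - sl2 f t' τ‖ ≤ L * |t - t'| := by
  have hL : ∀ x : ℝ, 0 ≤ L * |x| := fun x => (norm_nonneg _).trans (by simpa using hf x 0)
  have := intervalIntegral.norm_integral_le_of_norm_le_const (a := (0:ℝ)) (b := 1) (C := L * |t - t'|)
    (f := fun θ => (θ:ℂ) * f (t + θ * (τ - t)) - (θ:ℂ) * f (t' + θ * (τ - t'))) (fun θ hθ => by
      rw [uIoc_of_le zero_le_one] at hθ
      rw [← mul_sub, norm_mul, Complex.norm_real, Real.norm_of_nonneg hθ.1.le]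
      have h1 := hf (t + θ * (τ - t)) (t' + θ * (τ - t'))
      have e : t + θ * (τ - t) - (t' + θ * (τ - t')) = (1 - θ) * (t - t') := by ring
      rw [e, abs_mul, abs_of_nonneg (by linarith [hθ.2])] at h1
      have h2 : L * ((1 - θ) * |t - t'|) ≤ L * |t - t'| := by
        nlinarith [hL (t - t'), hθ.1, hθ.2]
      calc θ * _ ≤ 1 * (L * |t - t'|) := by
            exact mul_le_mul hθ.2 (h1.trans h2) (norm_nonneg _) zero_le_one
        _ = _ := one_mul _)
  rw [intervalIntegral.integral_sub (Continuous.intervalIntegrable (by fun_prop) _ _)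
    (Continuous.intervalIntegrable (by fun_prop) _ _)] at this
  simpa [sl2] using this

/-- chord-arc lower bound, in terms of the average of the derivative -/
lemma SC.sl_low {γ : ℝ → ℂ} (h : SC γ) :
    ∃ c, 0 < c ∧ ∀ t τ, |τ - t| ≤ 3/4 → c ≤ ‖sl (deriv γ) t τ‖ := by
  have hne : ∀ t τ, |τ - t| ≤ 3/4 → sl (deriv γ) t τ ≠ 0 := by
    intro t τ htτ h0
    by_cases e : t = τ
    · subst e; rw [sl_self] at h0; exact h.reg _ h0
    · have := sl_eq (h.smooth.of_le (by simp)) t τ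
      rw [h0, mul_zero, sub_eq_zero] at this
      exact e (h.inj' (by rw [abs_sub_comm]; linarith) this.symm)
  have hcomp : IsCompact ((fun p : ℝ × ℝ => (p.1, p.1 + p.2)) '' (Icc (0:ℝ) 1 ×ˢ Icc (-(3/4):ℝ) (3/4))) :=
    (isCompact_Icc.prod isCompact_Icc).image (by fun_prop)
  have hcont : ContinuousOn (fun p : ℝ × ℝ => ‖sl (deriv γ) p.1 p.2‖)
      ((fun p : ℝ × ℝ => (p.1, p.1 + p.2)) '' (Icc (0:ℝ) 1 ×ˢ Icc (-(3/4):ℝ) (3/4))) :=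
    (sl_cont h.cont1).norm.continuousOn
  have hne' : ((fun p : ℝ × ℝ => (p.1, p.1 + p.2)) '' (Icc (0:ℝ) 1 ×ˢ Icc (-(3/4):ℝ) (3/4))).Nonempty :=
    ⟨(0, 0+0), (0,0), by constructor <;> simp <;> norm_num, rfl⟩
  obtain ⟨p, hp, hmin⟩ := hcomp.exists_isMinOn hne' hcont
  refine ⟨‖sl (deriv γ) p.1 p.2‖, ?_, ?_⟩
  · obtain ⟨⟨a, b⟩, ⟨_, hb⟩, rfl⟩ := hp
    apply norm_pos_iff.2
    apply hne
    simpa [abs_le] using hb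
  · intro t τ htτ
    have key : sl (deriv γ) t τ = sl (deriv γ) (Int.fract t) (τ - ⌊t⌋) := by
      unfold sl
      congr 1; ext θ
      have := h.per1.sub_int_mul_eq (x := t + θ * (τ - t)) ⌊t⌋
      rw [mul_one] at this
      rw [← this]
      congr 1
      rw [Int.fract]; ring
    rw [key]
    refine isMinOn_iff.1 hmin (Int.fract t, τ - ⌊t⌋)
      ⟨(Int.fract t, τ - t), ⟨⟨Int.fract_nonneg _, (Int.fract_lt_one _).le⟩, abs_le.1 htτ⟩, ?_⟩
    ext
    · rfl
    · simp only [Int.fract]; ring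

/-- collar coordinates -/
def par (γ : ℝ → ℂ) (t s : ℝ) : ℂ := γ t + I * (s:ℂ) * deriv γ t

/-- t-derivative of collar coordinates -/
def dpar (γ : ℝ → ℂ) (t s : ℝ) : ℂ := deriv γ t + I * (s:ℂ) * deriv (deriv γ) t

@[simp] lemma par_zero (γ : ℝ → ℂ) (t : ℝ) : par γ t 0 = γ t := by simp [par]
@[simp] lemma dpar_zero (γ : ℝ → ℂ) (t : ℝ) : dpar γ t 0 = deriv γ t := by simp [dpar]

namespace SC
variable {γ : ℝ → ℂ}

lemma par_cont (h : SC γ) : Continuous (fun p : ℝ × ℝ => par γ p.1 p.2) := by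
  have := h.cont; have := h.cont1
  unfold par; fun_prop

lemma dpar_cont (h : SC γ) : Continuous (fun p : ℝ × ℝ => dpar γ p.1 p.2) := by
  have := h.cont2; have := h.cont1
  unfold dpar; fun_prop

lemma par_per (h : SC γ) (s : ℝ) : Function.Periodic (fun t => par γ t s) 1 := by
  intro t; simp only [par, h.per t, h.per1 t]

lemma dpar_per (h : SC γ) (s : ℝ) : Function.Periodic (fun t => dpar γ t s) 1 := by
  intro t; simp only [dpar, h.per2 t, h.per1 t]

lemma par_hasD (h : SC γ) (t s : ℝ) : HasDerivAt (fun t => par γ t s) (dpar γ t s) t :=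
  (h.hasD t).add ((h.hasD1 t).const_mul _)

lemma par_hasDs (_h : SC γ) (t s : ℝ) : HasDerivAt (fun s => par γ t s) (I * deriv γ t) s := by
  have h4 : HasDerivAt (fun θ : ℝ => (θ:ℂ)) 1 s := Complex.ofRealCLM.hasDerivAt
  refine (((h4.const_mul I).mul_const (deriv γ t)).const_add (γ t)).congr_deriv ?_
  ring

lemma dpar_hasDs (_h : SC γ) (t s : ℝ) : HasDerivAt (fun s => dpar γ t s) (I * deriv (deriv γ) t) s := by
  have h4 : HasDerivAt (fun θ : ℝ => (θ:ℂ)) 1 s := Complex.ofRealCLM.hasDerivAt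
  refine (((h4.const_mul I).mul_const (deriv (deriv γ) t)).const_add (deriv γ t)).congr_deriv ?_
  ring

lemma par_near (h : SC γ) : ∃ s0 c : ℝ, 0 < s0 ∧ 0 < c ∧ ∀ t t' s s' : ℝ, |t' - t| ≤ 3/4 →
    |s| ≤ s0 → |s'| ≤ s0 → c * (|t' - t| + |s' - s|) ≤ ‖par γ t' s' - par γ t s‖ := by
  obtain ⟨C, hC, hb⟩ := per_bdd h.per1 h.cont1
  obtain ⟨m, hm, hl⟩ := per_low h.per1 h.cont1 h.reg
  obtain ⟨L, hL, hlip⟩ := per_lip h.per1 (h.smooth1.of_le (by simp))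
  obtain ⟨c0, hc0, hsl⟩ := h.sl_low
  set δ : ℝ := m / (16 * L) with hδ
  have hδ0 : 0 < δ := by positivity
  set s0 : ℝ := min (min δ (1/8)) (min (c0 * δ / (8 * C)) (c0 / (4 * L))) with hs0
  have hs00 : 0 < s0 := by positivity
  have hs1 : s0 ≤ δ := (min_le_left _ _).trans (min_le_left _ _)
  have hs2 : s0 ≤ 1/8 := (min_le_left _ _).trans (min_le_right _ _)
  have hs3 : s0 * C ≤ c0 * δ / 8 := by
    have : s0 ≤ c0 * δ / (8 * C) := (min_le_right _ _).trans (min_le_left _ _)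
    calc s0 * C ≤ c0 * δ / (8 * C) * C := by gcongr
      _ = _ := by field_simp
  have hs4 : s0 * L ≤ c0 / 4 := by
    have : s0 ≤ c0 / (4 * L) := (min_le_right _ _).trans (min_le_right _ _)
    calc s0 * L ≤ c0 / (4 * L) * L := by gcongr
      _ = _ := by field_simp
  have hLδ : L * δ = m / 16 := by rw [hδ]; field_simp
  refine ⟨s0, min (m/4) (c0 * δ / 4), hs00, by positivity, ?_⟩
  intro t t' s s' ht hs hs'
  have hE : par γ t' s' - par γ t s = ((t' - t : ℝ):ℂ) * sl (deriv γ) t t'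
      + I * ((s' - s : ℝ) : ℂ) * deriv γ t + I * (s':ℂ) * (deriv γ t' - deriv γ t) := by
    rw [← sl_eq (h.smooth.of_le (by simp))]; simp only [par]; push_cast; ring
  have herr : ‖I * (s':ℂ) * (deriv γ t' - deriv γ t)‖ ≤ s0 * (L * |t' - t|) := by
    rw [norm_mul, norm_mul, norm_I, one_mul, norm_real]
    exact mul_le_mul hs' (hlip _ _) (norm_nonneg _) hs00.le
  by_cases hh : |t' - t| ≤ δ
  · have hsl2 : ‖sl (deriv γ) t t' - deriv γ t‖ ≤ L * |t' - t| + L * |t' - t| := by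
      have h1 := sl_lip h.cont1 hlip t t' t'
      rw [sl_self] at h1
      have h2 := hlip t' t
      calc _ = ‖(sl (deriv γ) t t' - deriv γ t') + (deriv γ t' - deriv γ t)‖ := by congr 1; ring
        _ ≤ _ := norm_add_le _ _
        _ ≤ _ := by rw [abs_sub_comm] at h1; gcongr
    have hE2 : par γ t' s' - par γ t s = (deriv γ t * (((t' - t : ℝ):ℂ) + I * ((s' - s : ℝ) : ℂ)))
        - (-(((t' - t : ℝ):ℂ) * (sl (deriv γ) t t' - deriv γ t)
         + I * (s':ℂ) * (deriv γ t' - deriv γ t))) := by rw [hE]; ring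
    have h5 : ‖((t' - t : ℝ):ℂ) * (sl (deriv γ) t t' - deriv γ t)
         + I * (s':ℂ) * (deriv γ t' - deriv γ t)‖ ≤ |t' - t| * (L * |t' - t| + L * |t' - t|)
          + s0 * (L * |t' - t|) := by
      refine (norm_add_le _ _).trans (add_le_add ?_ herr)
      rw [norm_mul, norm_real]
      exact mul_le_mul_of_nonneg_left hsl2 (abs_nonneg _)
    have h6 : |t' - t| + |s' - s| ≤ 2 * ‖((t' - t : ℝ):ℂ) + I * ((s' - s : ℝ) : ℂ)‖ := by
      have h1 := Complex.abs_re_le_norm (((t' - t : ℝ):ℂ) + I * ((s' - s : ℝ) : ℂ))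
      have h2 := Complex.abs_im_le_norm (((t' - t : ℝ):ℂ) + I * ((s' - s : ℝ) : ℂ))
      have h3 : (((t' - t : ℝ):ℂ) + I * ((s' - s : ℝ) : ℂ)).re = t' - t := by
        simp only [add_re, mul_re, I_re, I_im, ofReal_re, ofReal_im]; ring
      have h4 : (((t' - t : ℝ):ℂ) + I * ((s' - s : ℝ) : ℂ)).im = s' - s := by
        simp only [add_im, mul_im, I_re, I_im, ofReal_re, ofReal_im]; ring
      rw [h3] at h1; rw [h4] at h2; linarith
    have h7 : m / 2 * (|t' - t| + |s' - s|) ≤ ‖deriv γ t * (((t' - t : ℝ):ℂ) + I * ((s' - s : ℝ) : ℂ))‖ := by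
      rw [norm_mul]
      calc _ ≤ m / 2 * (2 * ‖((t' - t : ℝ):ℂ) + I * ((s' - s : ℝ) : ℂ)‖) := by gcongr
        _ = m * ‖((t' - t : ℝ):ℂ) + I * ((s' - s : ℝ) : ℂ)‖ := by ring
        _ ≤ _ := by gcongr; exact hl t
    have h8 := norm_sub_norm_le (deriv γ t * (((t' - t : ℝ):ℂ) + I * ((s' - s : ℝ) : ℂ)))
        (-(((t' - t : ℝ):ℂ) * (sl (deriv γ) t t' - deriv γ t)
         + I * (s':ℂ) * (deriv γ t' - deriv γ t)))
    rw [← hE2, norm_neg] at h8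
    have h9 : |t' - t| * (L * |t' - t| + L * |t' - t|) + s0 * (L * |t' - t|) ≤ 3 * (m / 16) * |t' - t| := by
      have := abs_nonneg (t' - t)
      calc _ ≤ |t' - t| * (L * δ + L * δ) + δ * (L * |t' - t|) := by gcongr
        _ = 3 * (L * δ) * |t' - t| := by ring
        _ = _ := by rw [hLδ]
    have h10 : min (m/4) (c0 * δ / 4) * (|t' - t| + |s' - s|) ≤ m / 4 * (|t' - t| + |s' - s|) := by
      gcongr; exact min_le_left _ _
    have hab := abs_nonneg (t' - t)
    have hab2 := abs_nonneg (s' - s)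
    nlinarith [mul_nonneg hm.le hab, mul_nonneg hm.le hab2]
  · push Not at hh
    have hss : |s' - s| ≤ 2 * s0 := by
      have := abs_sub s' s; linarith
    have h1 : c0 * |t' - t| ≤ ‖((t' - t : ℝ):ℂ) * sl (deriv γ) t t'‖ := by
      rw [norm_mul, norm_real, mul_comm]
      exact mul_le_mul_of_nonneg_left (hsl t t' ht) (abs_nonneg _)
    have h2 : ‖I * ((s' - s : ℝ) : ℂ) * deriv γ t‖ ≤ 2 * s0 * C := by
      rw [norm_mul, norm_mul, norm_I, one_mul, norm_real]
      exact mul_le_mul hss (hb t) (norm_nonneg _) (by positivity)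
    have h3 : ‖((t' - t : ℝ):ℂ) * sl (deriv γ) t t'‖ ≤ ‖par γ t' s' - par γ t s‖ +
        ‖I * ((s' - s : ℝ) : ℂ) * deriv γ t‖ + ‖I * (s':ℂ) * (deriv γ t' - deriv γ t)‖ := by
      rw [hE]
      generalize ((t' - t : ℝ):ℂ) * sl (deriv γ) t t' = A
      generalize I * ((s' - s : ℝ) : ℂ) * deriv γ t = B
      generalize I * (s':ℂ) * (deriv γ t' - deriv γ t) = D
      calc ‖A‖ = ‖(A + B + D) - B - D‖ := by congr 1; ring
        _ ≤ _ := (norm_sub_le _ _).trans (add_le_add (norm_sub_le _ _) le_rfl)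
    have h4 : s0 * (L * |t' - t|) ≤ c0 / 4 * |t' - t| := by
      rw [← mul_assoc]; gcongr
    have h5 : c0 * δ ≤ c0 * |t' - t| := by gcongr
    have h6 : min (m/4) (c0 * δ / 4) * (|t' - t| + |s' - s|) ≤ (c0 * δ / 4) * 1 := by
      apply mul_le_mul (min_le_right _ _) _ (by positivity) (by positivity)
      linarith
    have h7 : 0 < c0 * δ := by positivity
    linarith

lemma par_open (h : SC γ) : ∃ s0 : ℝ, 0 < s0 ∧ ∀ t s : ℝ, |s| ≤ s0 →
    Filter.map (fun p : ℝ × ℝ => par γ p.1 p.2) (𝓝 (t, s)) = 𝓝 (par γ t s) := by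
  obtain ⟨C, hC, hb⟩ := per_bdd h.per2 h.cont2
  obtain ⟨m, hm, hl⟩ := per_low h.per1 h.cont1 h.reg
  refine ⟨m / (2 * C), by positivity, fun t s hs => ?_⟩
  have hsm : ContDiff ℝ 1 (fun p : ℝ × ℝ => par γ p.1 p.2) := by
    have h1 : ContDiff ℝ 1 γ := h.smooth.of_le (by simp)
    have h2 : ContDiff ℝ 1 (deriv γ) := h.smooth1.of_le (by simp)
    have h3 : ContDiff ℝ 1 (fun x : ℝ => (x:ℂ)) := Complex.ofRealCLM.contDiff
    unfold par
    exact (h1.comp contDiff_fst).add ((contDiff_const.mul (h3.comp contDiff_snd)).mul (h2.comp contDiff_fst))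
  have hst := hsm.contDiffAt.hasStrictFDerivAt (x := (t, s)) one_ne_zero
  refine hst.map_nhds_eq_of_surj ?_
  rw [LinearMap.range_eq_top]
  set D := fderiv ℝ (fun p : ℝ × ℝ => par γ p.1 p.2) (t, s)
  have hD1 : D (1, 0) = dpar γ t s := by
    have h1 : HasDerivAt (fun x : ℝ => (x, s)) ((1:ℝ), (0:ℝ)) t := (hasDerivAt_id t).prodMk (hasDerivAt_const t s)
    have h2 := hst.hasFDerivAt.comp_hasDerivAt t h1
    exact h2.unique (h.par_hasD t s)
  have hD2 : D (0, 1) = I * deriv γ t := by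
    have h1 : HasDerivAt (fun x : ℝ => (t, x)) ((0:ℝ), (1:ℝ)) s := (hasDerivAt_const s t).prodMk (hasDerivAt_id s)
    have h2 := hst.hasFDerivAt.comp_hasDerivAt s h1
    exact h2.unique (h.par_hasDs t s)
  have hinj : Function.Injective (D : ℝ × ℝ →ₗ[ℝ] ℂ) := by
    rw [← LinearMap.ker_eq_bot, LinearMap.ker_eq_bot']
    rintro ⟨a, b⟩ hab
    have e : D (a, b) = (a:ℂ) * dpar γ t s + (b:ℂ) * (I * deriv γ t) := by
      have : ((a, b) : ℝ × ℝ) = a • ((1:ℝ), (0:ℝ)) + b • ((0:ℝ), (1:ℝ)) := by simp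
      rw [this, map_add, map_smul, map_smul, hD1, hD2]; rfl
    have hab' : D (a, b) = 0 := hab
    rw [e] at hab'
    have hz : (a:ℂ) * (1 + I * (s:ℂ) * (deriv (deriv γ) t / deriv γ t)) + b * I = 0 := by
      have hne := h.reg t
      have : (a:ℂ) * (1 + I * (s:ℂ) * (deriv (deriv γ) t / deriv γ t)) + b * I
        = ((a:ℂ) * dpar γ t s + (b:ℂ) * (I * deriv γ t)) / deriv γ t := by
        unfold dpar; field_simp
      rw [this, hab', zero_div]
    have hsmall : ‖I * (s:ℂ) * (deriv (deriv γ) t / deriv γ t)‖ ≤ 1/2 := by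
      rw [norm_mul, norm_mul, norm_I, one_mul, norm_real, norm_div]
      calc |s| * (‖deriv (deriv γ) t‖ / ‖deriv γ t‖) ≤ m / (2 * C) * (C / m) := by
            gcongr
            · exact hb t
            · exact hl t
        _ = 1/2 := by field_simp
    set w := I * (s:ℂ) * (deriv (deriv γ) t / deriv γ t)
    have hre := congrArg Complex.re hz
    have him := congrArg Complex.im hz
    simp at hre him
    have hw := (Complex.abs_re_le_norm w).trans hsmall
    have ha : a = 0 := by
      rcases hre with h1 | h1
      · exact h1
      · have := abs_le.1 hw; linarith
    subst ha
    simp at him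
    subst him; rfl
  have hfr : Module.finrank ℝ (ℝ × ℝ) = Module.finrank ℝ ℂ := by
    rw [Complex.finrank_real_complex]; simp
  exact (LinearMap.injective_iff_surjective_of_finrank_eq_finrank hfr).1 hinj

end SC

/-- A finite family of smooth curves together with a good collar. -/
structure Fam {n : ℕ} (γ : Fin n → ℝ → ℂ) (s0 c : ℝ) : Prop where
  sc : ∀ i, SC (γ i)
  s0pos : 0 < s0
  cpos : 0 < c
  near : ∀ i (t t' s s' : ℝ), |t' - t| ≤ 3/4 → |s| ≤ s0 → |s'| ≤ s0 →
    c * (|t' - t| + |s' - s|) ≤ ‖par (γ i) t' s' - par (γ i) t s‖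
  far : ∀ i j, i ≠ j → ∀ (t t' s s' : ℝ), |s| ≤ s0 → |s'| ≤ s0 →
    c ≤ ‖par (γ j) t' s' - par (γ i) t s‖
  opn : ∀ i (t s : ℝ), |s| ≤ s0 →
    Filter.map (fun p : ℝ × ℝ => par (γ i) p.1 p.2) (𝓝 (t, s)) = 𝓝 (par (γ i) t s)

lemma sc_far {γ γ' : ℝ → ℂ} (h : SC γ) (h' : SC γ') (hd : Disjoint (range γ) (range γ')) :
    ∃ s0 c : ℝ, 0 < s0 ∧ 0 < c ∧ ∀ t t' s s' : ℝ, |s| ≤ s0 → |s'| ≤ s0 →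
      c ≤ ‖par γ' t' s' - par γ t s‖ := by
  obtain ⟨C, hC, hb⟩ := per_bdd h.per1 h.cont1
  obtain ⟨C', hC', hb'⟩ := per_bdd h'.per1 h'.cont1
  have hcomp : ∀ {g : ℝ → ℂ}, SC g → IsCompact (range g) := by
    intro g hg
    have : range g = g '' Icc 0 1 := by
      apply Subset.antisymm
      · rintro _ ⟨t, rfl⟩
        exact ⟨Int.fract t, ⟨Int.fract_nonneg t, (Int.fract_lt_one t).le⟩, (per_fract hg.per t).symm⟩
      · exact image_subset_range _ _
    rw [this]; exact isCompact_Icc.image hg.cont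
  obtain ⟨r, hr, hdist⟩ := Metric.exists_pos_forall_lt_edist (hcomp h) (hcomp h').isClosed hd
  have hr' : (0:ℝ) < r := by exact_mod_cast hr
  refine ⟨min (r / (4 * C)) (r / (4 * C')), r/2, by positivity, by positivity, ?_⟩
  intro t t' s s' hs hs'
  have h1 : (r:ℝ) < ‖γ' t' - γ t‖ := by
    have := hdist (γ t) ⟨t, rfl⟩ (γ' t') ⟨t', rfl⟩
    rw [edist_dist, ENNReal.lt_ofReal_iff_toReal_lt (by simp)] at this
    simpa [dist_eq_norm, norm_sub_rev] using this
  have h2 : ‖I * (s:ℂ) * deriv γ t‖ ≤ r/4 := by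
    rw [norm_mul, norm_mul, norm_I, one_mul, norm_real]
    calc ‖s‖ * ‖deriv γ t‖ ≤ (r / (4 * C)) * C :=
          mul_le_mul (hs.trans (min_le_left _ _)) (hb t) (norm_nonneg _) (by positivity)
      _ = _ := by field_simp
  have h3 : ‖I * (s':ℂ) * deriv γ' t'‖ ≤ r/4 := by
    rw [norm_mul, norm_mul, norm_I, one_mul, norm_real]
    calc ‖s'‖ * ‖deriv γ' t'‖ ≤ (r / (4 * C')) * C' :=
          mul_le_mul (hs'.trans (min_le_right _ _)) (hb' t') (norm_nonneg _) (by positivity)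
      _ = _ := by field_simp
  have e : γ' t' - γ t = (par γ' t' s' - par γ t s) - I * (s':ℂ) * deriv γ' t' + I * (s:ℂ) * deriv γ t := by
    unfold par; ring
  have h4 : ‖γ' t' - γ t‖ ≤ ‖par γ' t' s' - par γ t s‖ + ‖I * (s':ℂ) * deriv γ' t'‖ + ‖I * (s:ℂ) * deriv γ t‖ := by
    rw [e]; exact (norm_add_le _ _).trans (add_le_add (norm_sub_le _ _) le_rfl)
  linarith

lemma Fam.mono {n : ℕ} {γ : Fin n → ℝ → ℂ} {s0 c : ℝ} (h : Fam γ s0 c) {s1 : ℝ} (h1 : 0 < s1) (h2 : s1 ≤ s0) :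
    Fam γ s1 c :=
  ⟨h.sc, h1, h.cpos, fun i t t' s s' a b d => h.near i t t' s s' a (b.trans h2) (d.trans h2),
    fun i j hij t t' s s' b d => h.far i j hij t t' s s' (b.trans h2) (d.trans h2),
    fun i t s b => h.opn i t s (b.trans h2)⟩

lemma finite_min {ι : Type*} [Finite ι] {P : ι → ℝ → Prop} (hP : ∀ i, ∃ a, 0 < a ∧ P i a)
    (hm : ∀ i a b, 0 < b → b ≤ a → P i a → P i b) : ∃ a, 0 < a ∧ ∀ i, P i a := by
  cases nonempty_fintype ι
  choose f hf hf2 using hP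
  by_cases hne : Nonempty ι
  · refine ⟨Finset.univ.inf' Finset.univ_nonempty f, ?_, fun i => ?_⟩
    · rw [Finset.lt_inf'_iff]; exact fun i _ => hf i
    · refine hm i (f i) _ ?_ (Finset.inf'_le _ (Finset.mem_univ i)) (hf2 i)
      rw [Finset.lt_inf'_iff]; exact fun i _ => hf i
  · exact ⟨1, one_pos, fun i => (hne ⟨i⟩).elim⟩

lemma exists_fam {n : ℕ} {γ : Fin n → ℝ → ℂ} (h : ∀ i, SC (γ i))
    (hd : ∀ i j, i ≠ j → Disjoint (range (γ i)) (range (γ j))) : ∃ s0 c, Fam γ s0 c := by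
  have h1 : ∃ a, 0 < a ∧ ∀ i, (∀ (t t' s s' : ℝ), |t' - t| ≤ 3/4 → |s| ≤ a → |s'| ≤ a →
    a * (|t' - t| + |s' - s|) ≤ ‖par (γ i) t' s' - par (γ i) t s‖) := by
    apply finite_min
    · intro i
      obtain ⟨a, b, ha, hb, hab⟩ := (h i).par_near
      refine ⟨min a b, by positivity, fun t t' s s' h1 h2 h3 =>
        le_trans ?_ (hab t t' s s' h1 (h2.trans (min_le_left _ _)) (h3.trans (min_le_left _ _)))⟩
      gcongr; exact min_le_right _ _
    · intro i a b hb hba H t t' s s' h1 h2 h3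
      exact le_trans (by gcongr) (H t t' s s' h1 (h2.trans hba) (h3.trans hba))
  have h2 : ∃ a, 0 < a ∧ ∀ p : Fin n × Fin n, (p.1 ≠ p.2 → ∀ (t t' s s' : ℝ), |s| ≤ a → |s'| ≤ a →
    a ≤ ‖par (γ p.2) t' s' - par (γ p.1) t s‖) := by
    apply finite_min
    · rintro ⟨i, j⟩
      by_cases hij : i = j
      · exact ⟨1, one_pos, fun H => (H hij).elim⟩
      obtain ⟨a, b, ha, hb, hab⟩ := sc_far (h i) (h j) (hd i j hij)
      exact ⟨min a b, by positivity, fun _ t t' s s' h2 h3 =>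
        (min_le_right _ _).trans (hab t t' s s' (h2.trans (min_le_left _ _)) (h3.trans (min_le_left _ _)))⟩
    · intro i a b hb hba H hp t t' s s' h2 h3
      exact hba.trans (H hp t t' s s' (h2.trans hba) (h3.trans hba))
  have h3 : ∃ a, 0 < a ∧ ∀ i, (∀ (t s : ℝ), |s| ≤ a →
    Filter.map (fun p : ℝ × ℝ => par (γ i) p.1 p.2) (𝓝 (t, s)) = 𝓝 (par (γ i) t s)) := by
    apply finite_min
    · intro i; exact (h i).par_open
    · intro i a b hb hba H t s hs
      exact H t s (hs.trans hba)
  obtain ⟨a, ha, Ha⟩ := h1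
  obtain ⟨b, hb, Hb⟩ := h2
  obtain ⟨d, hd, Hd⟩ := h3
  have q1 : min a (min b d) ≤ a := min_le_left _ _
  have q2 : min a (min b d) ≤ b := (min_le_right _ _).trans (min_le_left _ _)
  have q3 : min a (min b d) ≤ d := (min_le_right _ _).trans (min_le_right _ _)
  refine ⟨min a (min b d), min a b, h, by positivity, by positivity, ?_, ?_, ?_⟩
  · intro i t t' s s' h1 h2 h3
    exact le_trans (by gcongr; exact min_le_left _ _) (Ha i t t' s s' h1 (h2.trans q1) (h3.trans q1))
  · intro i j hij t t' s s' h2 h3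
    exact (min_le_right _ _).trans (Hb (i, j) hij t t' s s' (h2.trans q2) (h3.trans q2))
  · intro i t s hs
    exact Hd i t s (hs.trans q3)

lemma param_slice {X : Type*} [TopologicalSpace X] {f : X → ℝ → ℂ} {S : Set X}
    (hf : ContinuousOn (Function.uncurry f) (S ×ˢ Icc (0:ℝ) 1)) {x : X} (hx : x ∈ S) :
    ContinuousOn (f x) (Icc 0 1) :=
  hf.comp (f := fun t => (x, t)) (by fun_prop) (fun t ht => ⟨hx, ht⟩)

lemma param_int {f : ℝ → ℂ} (hf : ContinuousOn f (Icc 0 1)) : IntervalIntegrable f volume 0 1 :=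
  ContinuousOn.intervalIntegrable (by rwa [uIcc_of_le zero_le_one])

lemma param_meas {f : ℝ → ℂ} (hf : ContinuousOn f (Icc 0 1)) :
    AEStronglyMeasurable f (volume.restrict (uIoc (0:ℝ) 1)) := by
  rw [uIoc_of_le zero_le_one]
  exact (hf.mono Ioc_subset_Icc_self).aestronglyMeasurable measurableSet_Ioc

lemma param_cont {X : Type*} [TopologicalSpace X] [FirstCountableTopology X] {f : X → ℝ → ℂ} {S : Set X} (hS : IsCompact S)
    (hf : ContinuousOn (Function.uncurry f) (S ×ˢ Icc (0:ℝ) 1)) :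
    ContinuousOn (fun x => ∫ t in (0:ℝ)..1, f x t) S := by
  obtain ⟨C, hC⟩ := (hS.prod isCompact_Icc).exists_bound_of_continuousOn hf
  intro x hx
  apply intervalIntegral.continuousWithinAt_of_dominated_interval (bound := fun _ => C)
  · filter_upwards [self_mem_nhdsWithin] with y hy
    exact param_meas (param_slice hf hy)
  · filter_upwards [self_mem_nhdsWithin] with y hy
    refine ae_of_all _ fun t ht => ?_
    rw [uIoc_of_le zero_le_one] at ht
    exact hC (y, t) ⟨hy, Ioc_subset_Icc_self ht⟩
  · simp
  · refine ae_of_all _ fun t ht => ?_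
    rw [uIoc_of_le zero_le_one] at ht
    exact (hf (x, t) ⟨hx, Ioc_subset_Icc_self ht⟩).comp (f := fun y => (y, t)) (by fun_prop)
      (fun y hy => ⟨hy, Ioc_subset_Icc_self ht⟩)

lemma param_deriv {𝕜 : Type*} [RCLike 𝕜] [NormedSpace 𝕜 ℂ] {F F' : 𝕜 → ℝ → ℂ} {V : Set 𝕜} (hV : IsOpen V)
    (hF : ContinuousOn (Function.uncurry F) (V ×ˢ Icc (0:ℝ) 1))
    (hF' : ContinuousOn (Function.uncurry F') (V ×ˢ Icc (0:ℝ) 1))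
    (hd : ∀ x ∈ V, ∀ t ∈ Icc (0:ℝ) 1, HasDerivAt (fun x => F x t) (F' x t) x) {x : 𝕜} (hx : x ∈ V) :
    HasDerivAt (fun x => ∫ t in (0:ℝ)..1, F x t) (∫ t in (0:ℝ)..1, F' x t) x := by
  obtain ⟨r, hr, hrV⟩ := Metric.nhds_basis_closedBall.mem_iff.1 (hV.mem_nhds hx)
  obtain ⟨C, hC⟩ := ((isCompact_closedBall x r).prod (isCompact_Icc (a := (0:ℝ)) (b := 1))).exists_bound_of_continuousOn
    (hF'.mono (prod_mono_left hrV))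
  refine (intervalIntegral.hasDerivAt_integral_of_dominated_loc_of_deriv_le (bound := fun _ => C)
    (closedBall_mem_nhds x hr) ?_ ?_ ?_ ?_ ?_ ?_).2
  · filter_upwards [hV.mem_nhds hx] with y hy
    exact param_meas (param_slice hF hy)
  · exact param_int (param_slice hF hx)
  · exact param_meas (param_slice hF' hx)
  · refine ae_of_all _ fun t ht y hy => ?_
    rw [uIoc_of_le zero_le_one] at ht
    exact hC (y, t) ⟨hy, Ioc_subset_Icc_self ht⟩
  · simp
  · refine ae_of_all _ fun t ht y hy => ?_
    rw [uIoc_of_le zero_le_one] at ht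
    exact hd y (hrV hy) t (Ioc_subset_Icc_self ht)

/-- Cauchy-type integral with density φ along the path c. -/
def CT (c φ : ℝ → ℂ) (z : ℂ) : ℂ := ∫ τ in (0:ℝ)..1, φ τ / (c τ - z)

lemma CT_contOn {c φ : ℝ → ℂ} (hc : Continuous c) (hφ : Continuous φ) (k : ℕ) :
    ContinuousOn (Function.uncurry fun (z:ℂ) (τ:ℝ) => φ τ / (c τ - z) ^ k)
      ((c '' Icc 0 1)ᶜ ×ˢ Icc (0:ℝ) 1) := by
  have : ∀ x ∈ ((c '' Icc 0 1)ᶜ ×ˢ Icc (0:ℝ) 1), (c x.2 - x.1) ^ k ≠ 0 := by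
    rintro ⟨z, t⟩ ⟨hz, ht⟩
    apply pow_ne_zero
    rw [sub_ne_zero]
    intro e
    exact hz ⟨t, ht, e⟩
  unfold Function.uncurry
  exact ContinuousOn.div (by fun_prop) (by fun_prop) this

lemma CT_hasD {c φ : ℝ → ℂ} (hc : Continuous c) (hφ : Continuous φ) {z : ℂ}
    (hz : z ∉ c '' Icc 0 1) : HasDerivAt (CT c φ) (∫ τ in (0:ℝ)..1, φ τ / (c τ - z) ^ 2) z := by
  have hcl : IsOpen (c '' Icc 0 1)ᶜ := (isCompact_Icc.image hc).isClosed.isOpen_compl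
  have h1 := CT_contOn hc hφ 1
  simp only [pow_one] at h1
  refine param_deriv hcl h1 (CT_contOn hc hφ 2) ?_ hz
  intro x hx t ht
  have hne : c t - x ≠ 0 := by
    rw [sub_ne_zero]; rintro rfl
    exact hx ⟨t, ht, rfl⟩
  have := (((hasDerivAt_id x).const_sub (c t)).inv hne).const_mul (φ t)
  refine (this.congr_deriv ?_)
  simp [div_eq_mul_inv]

lemma CT_diffOn {c φ : ℝ → ℂ} (hc : Continuous c) (hφ : Continuous φ) :
    DifferentiableOn ℂ (CT c φ) (c '' Icc 0 1)ᶜ :=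
  fun _ hz => (CT_hasD hc hφ hz).differentiableAt.differentiableWithinAt

lemma CT_infty {c φ : ℝ → ℂ} (hc : Continuous c) (hφ : Continuous φ) :
    Tendsto (fun z => z * CT c φ z) (cobounded ℂ) (𝓝 (-∫ τ in (0:ℝ)..1, φ τ)) := by
  obtain ⟨R, hR⟩ := (isCompact_Icc (a := (0:ℝ)) (b := 1)).exists_bound_of_continuousOn hc.continuousOn
  obtain ⟨C, hC⟩ := (isCompact_Icc (a := (0:ℝ)) (b := 1)).exists_bound_of_continuousOn hφ.continuousOn
  have hC0 : 0 ≤ C := (norm_nonneg _).trans (hC 0 (by simp))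
  have hR0 : 0 ≤ R := (norm_nonneg _).trans (hR 0 (by simp))
  rw [← intervalIntegral.integral_neg]
  have e : (fun z => z * CT c φ z) = fun z => ∫ τ in (0:ℝ)..1, z * (φ τ / (c τ - z)) := by
    ext z; rw [intervalIntegral.integral_const_mul]; rfl
  rw [e]
  have hbig : ∀ᶠ z : ℂ in cobounded ℂ, 2 * R + 1 ≤ ‖z‖ := tendsto_norm_cobounded_atTop.eventually_ge_atTop _
  have hlow : ∀ z : ℂ, 2 * R + 1 ≤ ‖z‖ → ∀ t ∈ Icc (0:ℝ) 1, ‖z‖ / 2 ≤ ‖c t - z‖ := by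
    intro z hz t ht
    have h1 := norm_sub_norm_le z (c t)
    rw [norm_sub_rev] at h1
    have := hR t ht
    linarith
  have hcg : (cobounded ℂ).IsCountablyGenerated := by rw [← comap_norm_atTop]; infer_instance
  apply intervalIntegral.tendsto_integral_filter_of_dominated_convergence (bound := fun _ => 2 * C)
  · filter_upwards [hbig] with z hz
    apply param_meas
    refine continuousOn_const.mul (ContinuousOn.div hφ.continuousOn (by fun_prop) ?_)
    intro t ht h0
    have := hlow z hz t ht
    rw [h0, norm_zero] at this; linarith
  · filter_upwards [hbig] with z hz
    refine ae_of_all _ fun t ht => ?_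
    rw [uIoc_of_le zero_le_one] at ht
    have h2 := hlow z hz t (Ioc_subset_Icc_self ht)
    have h3 := hC t (Ioc_subset_Icc_self ht)
    have h4 : 0 < ‖z‖ := by linarith
    rw [norm_mul, norm_div]
    calc ‖z‖ * (‖φ t‖ / ‖c t - z‖) ≤ ‖z‖ * (C / (‖z‖ / 2)) := by gcongr
      _ = 2 * C := by field_simp
  · simp
  · refine ae_of_all _ fun t ht => ?_
    have h1 : Tendsto (fun z : ℂ => c t * z⁻¹ - 1) (cobounded ℂ) (𝓝 (c t * 0 - 1)) :=
      (tendsto_inv₀_cobounded.const_mul _).sub_const _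
    have h2 := (tendsto_const_nhds (x := φ t)).div h1 (by simp)
    have h3 : φ t / (c t * 0 - 1) = - φ t := by simp [div_neg]
    rw [h3] at h2
    refine h2.congr' ?_
    filter_upwards [hbig] with z hz
    have hz0 : z ≠ 0 := by
      rintro rfl; simp at hz; linarith
    have : c t * z⁻¹ - 1 = (c t - z) / z := by field_simp
    simp only [Pi.div_apply]
    rw [this, div_div_eq_mul_div]; ring

lemma tendsto_zero_of_mul {f : ℂ → ℂ} {w : ℂ} {l : Filter ℂ} (hl : l ≤ cobounded ℂ)
    (h : Tendsto (fun z => z * f z) l (𝓝 w)) :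
    Tendsto f l (𝓝 0) := by
  have h1 := (tendsto_inv₀_cobounded (α := ℂ)).mono_left hl
  have h2 := h1.mul h
  rw [zero_mul] at h2
  refine h2.congr' ?_
  have : ∀ᶠ z : ℂ in l, z ≠ 0 := by
    have : ∀ᶠ z : ℂ in cobounded ℂ, 1 ≤ ‖z‖ := tendsto_norm_cobounded_atTop.eventually_ge_atTop _
    filter_upwards [hl this] with z hz h0
    have hz' : 1 ≤ ‖z‖ := hz
    rw [h0, norm_zero] at hz'; linarith
  filter_upwards [this] with z hz
  field_simp

/-- winding integral of a closed curve is locally constant -/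
lemma CT_wind_const {c c' : ℝ → ℂ} (hc : ∀ t, HasDerivAt c (c' t) t) (hc' : Continuous c')
    (hcl : c 1 = c 0) {S : Set ℂ} (hSo : IsOpen S) (hS : IsPreconnected S) (hd : ∀ t ∈ Icc (0:ℝ) 1, c t ∉ S) :
    ∀ x ∈ S, ∀ y ∈ S, CT c c' x = CT c c' y := by
  have hcc : Continuous c := continuous_iff_continuousAt.2 fun t => (hc t).continuousAt
  have hS' : S ⊆ (c '' Icc 0 1)ᶜ := by
    rintro z hz ⟨t, ht, rfl⟩; exact hd t ht hz
  have hder : ∀ z ∈ S, HasDerivAt (CT c c') 0 z := by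
    intro z hz
    refine (CT_hasD hcc hc' (hS' hz)).congr_deriv ?_
    have h1 : ∀ t ∈ uIcc (0:ℝ) 1, HasDerivAt (fun t => -(c t - z)⁻¹) (c' t / (c t - z)^2) t := by
      intro t ht
      rw [uIcc_of_le zero_le_one] at ht
      have hne : c t - z ≠ 0 := by
        rw [sub_ne_zero]; rintro rfl; exact hd t ht hz
      refine (((hc t).sub_const z).inv hne).neg.congr_deriv ?_
      rw [neg_div, neg_neg]
    rw [intervalIntegral.integral_eq_sub_of_hasDerivAt h1, hcl, sub_self]
    apply param_int
    exact ContinuousOn.div (by fun_prop) (by fun_prop) (fun t ht => by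
      apply pow_ne_zero; rw [sub_ne_zero]; rintro rfl; exact hd t ht hz)
  intro x hx y hy
  exact hSo.is_const_of_deriv_eq_zero hS (fun z hz => (hder z hz).differentiableAt.differentiableWithinAt)
    (fun z hz => (hder z hz).deriv) hx hy

lemma CT_wind_zero {c c' : ℝ → ℂ} (hc : ∀ t, HasDerivAt c (c' t) t) (hc' : Continuous c')
    (hcl : c 1 = c 0) {S : Set ℂ} (hSo : IsOpen S) (hS : IsPreconnected S) (hd : ∀ t ∈ Icc (0:ℝ) 1, c t ∉ S)
    (hub : (cobounded ℂ ⊓ 𝓟 S).NeBot) : ∀ x ∈ S, CT c c' x = 0 := by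
  have hcc : Continuous c := continuous_iff_continuousAt.2 fun t => (hc t).continuousAt
  intro x hx
  have h1 := (tendsto_zero_of_mul le_rfl (CT_infty hcc hc')).mono_left (inf_le_left (b := 𝓟 S))
  have h2 : Tendsto (CT c c') (cobounded ℂ ⊓ 𝓟 S) (𝓝 (CT c c' x)) := by
    refine tendsto_const_nhds.congr' ?_
    filter_upwards [mem_inf_of_right (mem_principal_self S)] with y hy
    exact CT_wind_const hc hc' hcl hSo hS hd x hx y hy
  exact tendsto_nhds_unique h2 h1

lemma neBot_compl {K : Set ℂ} (hK : IsCompact K) : (cobounded ℂ ⊓ 𝓟 Kᶜ).NeBot := by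
  have : Kᶜ ∈ cobounded ℂ := isBounded_def.1 hK.isBounded
  rw [inf_eq_left.2 (le_principal_iff.2 this)]; infer_instance

lemma inf_compl {K : Set ℂ} (hK : IsCompact K) : cobounded ℂ ⊓ 𝓟 Kᶜ = cobounded ℂ := by
  have : Kᶜ ∈ cobounded ℂ := isBounded_def.1 hK.isBounded
  rw [inf_eq_left.2 (le_principal_iff.2 this)]

/-- Deformation invariance of contour integrals in a collar. -/
lemma collar_int_const {γ : ℝ → ℂ} (h : SC γ) {G : ℂ → ℂ} {U : Set ℂ} (hU : IsOpen U) (hG : DifferentiableOn ℂ G U)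
    {a b : ℝ} (hab : ∀ t, ∀ s ∈ Ioo a b, par γ t s ∈ U) {s s' : ℝ} (hs : s ∈ Ioo a b) (hs' : s' ∈ Ioo a b) :
    ∫ t in (0:ℝ)..1, G (par γ t s) * dpar γ t s = ∫ t in (0:ℝ)..1, G (par γ t s') * dpar γ t s' := by
  have hGc : ContinuousOn G U := hG.continuousOn
  have hG' : ContinuousOn (deriv G) U := (hG.deriv hU).continuousOn
  have hp : ContinuousOn (fun p : ℝ × ℝ => par γ p.2 p.1) (Ioo a b ×ˢ Icc (0:ℝ) 1) :=
    (h.par_cont.comp continuous_swap).continuousOn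
  have hdp : Continuous (fun p : ℝ × ℝ => dpar γ p.2 p.1) := h.dpar_cont.comp continuous_swap
  have hm : MapsTo (fun p : ℝ × ℝ => par γ p.2 p.1) (Ioo a b ×ˢ Icc (0:ℝ) 1) U := fun p hp => hab p.2 p.1 hp.1
  have := h.cont1; have := h.cont2
  have key : ∀ s ∈ Ioo a b, HasDerivAt (fun s => ∫ t in (0:ℝ)..1, G (par γ t s) * dpar γ t s) 0 s := by
    intro s hs
    have := param_deriv (F := fun s t => G (par γ t s) * dpar γ t s)
      (F' := fun s t => deriv G (par γ t s) * (I * deriv γ t) * dpar γ t s + G (par γ t s) * (I * deriv (deriv γ) t)) isOpen_Ioo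
      (hF := (hGc.comp hp hm).mul hdp.continuousOn)
      (hF' := by
        have h1 := hGc.comp hp hm
        have h2 := hG'.comp hp hm
        exact ((h2.mul (by fun_prop)).mul hdp.continuousOn).add (h1.mul (by fun_prop)))
      (hd := by
        intro s hs t _
        have h1 := (hG.differentiableAt (hU.mem_nhds (hab t s hs))).hasDerivAt.comp s (h.par_hasDs t s)
        exact h1.mul (h.dpar_hasDs t s)) hs
    refine this.congr_deriv ?_
    have h3 : ∀ t ∈ uIcc (0:ℝ) 1, HasDerivAt (fun t => G (par γ t s) * (I * deriv γ t))
        (deriv G (par γ t s) * (I * deriv γ t) * dpar γ t s + G (par γ t s) * (I * deriv (deriv γ) t)) t := by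
      intro t _
      have h1 := (hG.differentiableAt (hU.mem_nhds (hab t s hs))).hasDerivAt.comp t (h.par_hasD t s)
      refine (h1.mul ((h.hasD1 t).const_mul I)).congr_deriv ?_
      simp only [Function.comp]; ring
    rw [intervalIntegral.integral_eq_sub_of_hasDerivAt h3]
    · have e1 := h.par_per s 0
      have e2 := h.per1 0
      simp only [zero_add] at e1 e2
      rw [e1, e2, sub_self]
    · apply param_int
      have q1 : ContinuousOn (fun t => par γ t s) (Icc 0 1) := (h.par_cont.comp (by fun_prop : Continuous fun t => (t, s))).continuousOn
      have q2 : MapsTo (fun t => par γ t s) (Icc 0 1) U := fun t _ => hab t s hs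
      have q3 : Continuous (fun t => dpar γ t s) := h.dpar_cont.comp (by fun_prop : Continuous fun t => (t, s))
      exact (((hG'.comp q1 q2).mul (by fun_prop)).mul q3.continuousOn).add ((hGc.comp q1 q2).mul (by fun_prop))
  exact isOpen_Ioo.is_const_of_deriv_eq_zero isPreconnected_Ioo
    (fun z hz => (key z hz).differentiableAt.differentiableWithinAt) (fun z hz => (key z hz).deriv) hs hs'

lemma alg_poisson {g e : ℂ} (hg : ‖g - 1‖ ≤ 1/10) (he : ‖e - 1‖ ≤ 1/10) (h : ℝ) {s : ℝ} (hs : 0 < s) :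
    s / (16 * (h^2 + s^2)) ≤ (2 * s * g / (h^2 * e^2 + s^2)).re := by
  set D : ℂ := h^2 * e^2 + s^2 with hD
  have hpos : 0 < h^2 + s^2 := by positivity
  have hce : ‖(starRingEnd ℂ) e - 1‖ ≤ 1/10 := by
    rw [← norm_conj]; simpa using he
  have hce1 : ‖(starRingEnd ℂ) e‖ ≤ 11/10 := by
    have := norm_add_le ((starRingEnd ℂ) e - 1) 1
    simp only [sub_add_cancel, norm_one] at this; linarith
  have he1 : ‖e‖ ≤ 11/10 := by rwa [norm_conj] at hce1
  have h1 : ‖g * (starRingEnd ℂ) e ^ 2 - 1‖ ≤ 34/100 := by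
    have e1 : g * (starRingEnd ℂ) e ^ 2 - 1 = (g - 1) * (starRingEnd ℂ) e ^ 2 +
      ((starRingEnd ℂ) e - 1) * ((starRingEnd ℂ) e) + ((starRingEnd ℂ) e - 1) := by ring
    rw [e1]
    calc _ ≤ ‖(g - 1) * (starRingEnd ℂ) e ^ 2‖ + ‖((starRingEnd ℂ) e - 1) * ((starRingEnd ℂ) e)‖ + ‖(starRingEnd ℂ) e - 1‖ :=
          (norm_add_le _ _).trans (add_le_add (norm_add_le _ _) le_rfl)
      _ ≤ 1/10 * (11/10)^2 + 1/10 * (11/10) + 1/10 := by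
          rw [norm_mul, norm_mul, norm_pow]; gcongr
      _ ≤ _ := by norm_num
  have h2 : 66/100 ≤ (g * (starRingEnd ℂ) e ^ 2).re := by
    have := (abs_le.1 ((Complex.abs_re_le_norm _).trans h1)).1
    simp only [sub_re, one_re] at this; linarith
  have h3 : 9/10 ≤ g.re := by
    have := (abs_le.1 ((Complex.abs_re_le_norm _).trans hg)).1
    simp only [sub_re, one_re] at this; linarith
  have h4 : (g * (starRingEnd ℂ) D).re = h^2 * (g * (starRingEnd ℂ) e ^ 2).re + s^2 * g.re := by
    have : g * (starRingEnd ℂ) D = ((h^2 : ℝ) : ℂ) * (g * (starRingEnd ℂ) e ^ 2) + ((s^2:ℝ):ℂ) * g := by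
      rw [hD]; simp only [map_add, map_mul, map_pow, conj_ofReal]; push_cast; ring
    rw [this, add_re, re_ofReal_mul, re_ofReal_mul]
  have h5 : 66/100 * (h^2 + s^2) ≤ (g * (starRingEnd ℂ) D).re := by
    rw [h4]; nlinarith [sq_nonneg h, sq_nonneg s]
  have h6 : ‖D‖ ≤ (121/100) * (h^2 + s^2) := by
    calc ‖D‖ ≤ ‖(h:ℂ)^2 * e^2‖ + ‖(s:ℂ)^2‖ := norm_add_le _ _
      _ = h^2 * ‖e‖^2 + s^2 := by simp
      _ ≤ h^2 * (11/10)^2 + s^2 := by gcongr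
      _ ≤ _ := by nlinarith [sq_nonneg s]
  have h7 : 0 < normSq D := by
    rw [normSq_pos]; intro h0
    rw [h0] at h5; simp at h5; linarith
  have h8 : normSq D ≤ ((121/100) * (h^2 + s^2))^2 := by
    rw [normSq_eq_norm_sq]; gcongr
  have h9 : (2 * s * g / D).re = 2 * s * (g * (starRingEnd ℂ) D).re / normSq D := by
    have : 2 * s * g / D = (((2 * s / normSq D : ℝ)) : ℂ) * (g * (starRingEnd ℂ) D) := by
      rw [div_eq_mul_inv, inv_def]; push_cast; ring
    rw [this, re_ofReal_mul]; ring
  rw [h9, div_le_div_iff₀ (by positivity) h7]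
  calc s * normSq D ≤ s * ((121/100) * (h^2 + s^2))^2 := by gcongr
    _ ≤ 2 * s * (66/100 * (h^2 + s^2)) * (16 * (h^2 + s^2)) := by
        have : 0 ≤ s * (h^2+s^2)^2 := by positivity
        nlinarith
    _ ≤ _ := by gcongr

/-- Poisson-like kernel -/
def PK (γ : ℝ → ℂ) (t τ s : ℝ) : ℂ :=
  2 * s * (deriv γ τ * deriv γ t) / ((γ τ - γ t) ^ 2 + s ^ 2 * deriv γ t ^ 2)

/-- local comparison constants -/
lemma SC.ratio {γ : ℝ → ℂ} (h : SC γ) : ∃ δ : ℝ, 0 < δ ∧ δ ≤ 1/2 ∧ ∀ t τ : ℝ, |τ - t| ≤ δ →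
    ‖deriv γ τ / deriv γ t - 1‖ ≤ 1/10 ∧ ‖sl (deriv γ) t τ / deriv γ t - 1‖ ≤ 1/10 := by
  obtain ⟨m, hm, hl⟩ := per_low h.per1 h.cont1 h.reg
  obtain ⟨L, hL, hlip⟩ := per_lip h.per1 (h.smooth1.of_le (by simp))
  refine ⟨min (1/2) (m / (20 * L)), by positivity, min_le_left _ _, fun t τ ht => ?_⟩
  have ht2 : L * |τ - t| ≤ m / 20 := by
    have : |τ - t| ≤ m / (20 * L) := ht.trans (min_le_right _ _)
    calc L * |τ - t| ≤ L * (m / (20 * L)) := by gcongr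
      _ = _ := by field_simp
  have h1 := hlip τ t
  have h2 := sl_lip h.cont1 hlip t τ τ
  rw [sl_self, abs_sub_comm] at h2
  have key : ∀ x : ℂ, ‖x - deriv γ t‖ ≤ m / 10 → ‖x / deriv γ t - 1‖ ≤ 1/10 := by
    intro x hx
    have : x / deriv γ t - 1 = (x - deriv γ t) / deriv γ t := by
      have := h.reg t
      field_simp
    rw [this, norm_div]
    calc _ ≤ (m/10) / m := by gcongr; exact hl t
      _ = _ := by field_simp
  constructor
  · apply key; linarith
  · apply key
    calc _ = ‖(sl (deriv γ) t τ - deriv γ τ) + (deriv γ τ - deriv γ t)‖ := by congr 1; ring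
      _ ≤ _ := norm_add_le _ _
      _ ≤ _ := by linarith

lemma SC.poisson {γ : ℝ → ℂ} (h : SC γ) {s0 c : ℝ} (hc : 0 < c)
    (near : ∀ (t t' s s' : ℝ), |t' - t| ≤ 3/4 → |s| ≤ s0 → |s'| ≤ s0 →
    c * (|t' - t| + |s' - s|) ≤ ‖par γ t' s' - par γ t s‖) :
    ∃ δ C : ℝ, 0 < δ ∧ δ ≤ 1/2 ∧ 0 < C ∧ ∀ t τ s, 0 < s → s ≤ s0 →
      (|τ - t| ≤ δ → s / (16 * ((τ-t)^2 + s^2)) ≤ (PK γ t τ s).re) ∧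
      (δ ≤ |τ - t| → |τ - t| ≤ 1/2 → ‖PK γ t τ s‖ ≤ C * s) := by
  obtain ⟨δ, hδ, hδ2, hr⟩ := h.ratio
  obtain ⟨C1, hC1, hb⟩ := per_bdd h.per1 h.cont1
  refine ⟨δ, 2 * C1^2 / (c * δ)^2, hδ, hδ2, by positivity, fun t τ s hs hs0 => ⟨fun ht => ?_, fun ht ht2 => ?_⟩⟩
  · obtain ⟨h1, h2⟩ := hr t τ ht
    refine (alg_poisson h1 h2 (τ - t) hs).trans_eq ?_
    congr 1
    have h3 := sl_eq (h.smooth.of_le (by simp)) t τ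
    have hne := h.reg t
    unfold PK
    rw [h3]
    have e : ((τ - t : ℝ):ℂ)^2 * (sl (deriv γ) t τ / deriv γ t)^2 + s^2 =
      ((((τ - t : ℝ):ℂ) * sl (deriv γ) t τ) ^ 2 + s ^ 2 * deriv γ t ^ 2) / deriv γ t ^ 2 := by
      field_simp
    rw [e, div_div_eq_mul_div]
    congr 1
    field_simp
  · have e : (γ τ - γ t) ^ 2 + s ^ 2 * deriv γ t ^ 2 = (par γ τ 0 - par γ t s) * (par γ τ 0 - par γ t (-s)) := by
      simp only [par]; push_cast; ring_nf; simp only [I_sq]; ring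
    have hs' : |s| ≤ s0 := by rwa [abs_of_pos hs]
    have h00 : |(0:ℝ)| ≤ s0 := by rw [abs_zero]; linarith
    have n1 := near t τ s 0 (by linarith) hs' h00
    have n2 := near t τ (-s) 0 (by linarith) (by rwa [abs_neg]) h00
    have m1 : c * δ ≤ ‖par γ τ 0 - par γ t s‖ := le_trans (by gcongr; linarith [abs_nonneg (0 - s)]) n1
    have m2 : c * δ ≤ ‖par γ τ 0 - par γ t (-s)‖ := le_trans (by gcongr; linarith [abs_nonneg (0 - -s)]) n2
    unfold PK
    rw [e, norm_div, norm_mul, norm_mul, norm_mul, norm_mul]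
    simp only [norm_real, Real.norm_of_nonneg hs.le, Complex.norm_ofNat]
    calc _ ≤ 2 * s * (C1 * C1) / ((c * δ) * (c * δ)) := by
          gcongr
          · exact hb τ
          · exact hb t
      _ = _ := by ring

lemma int_pos_of_poisson {f : ℝ → ℝ} (hf : Continuous f) (hp : Function.Periodic f 1) {t δ C s : ℝ}
    (hδ2 : δ ≤ 1/2) (hC : 0 < C) (hs : 0 < s) (hsδ : s ≤ δ) (hCs : C * s < 1/32)
    (h1 : ∀ τ, |τ - t| ≤ δ → s / (16 * ((τ-t)^2 + s^2)) ≤ f τ)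
    (h2 : ∀ τ, δ ≤ |τ - t| → |τ - t| ≤ 1/2 → |f τ| ≤ C * s) : 0 < ∫ τ in (0:ℝ)..1, f τ := by
  have hlow : ∀ τ, |τ - t| ≤ 1/2 → -(C * s) ≤ f τ := by
    intro τ hτ
    by_cases h : |τ - t| ≤ δ
    · refine le_trans ?_ (h1 τ h)
      have : 0 ≤ s / (16 * ((τ-t)^2 + s^2)) := by positivity
      nlinarith
    · exact (abs_le.1 (h2 τ (not_le.1 h).le hτ)).1
  have hlow2 : ∀ τ, |τ - t| ≤ s → 1 / (32 * s) ≤ f τ := by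
    intro τ hτ
    refine le_trans ?_ (h1 τ (hτ.trans hsδ))
    have : (τ - t)^2 ≤ s^2 := sq_le_sq' (by linarith [(abs_le.1 hτ).1]) (abs_le.1 hτ).2
    rw [div_le_div_iff₀ (by positivity) (by positivity)]
    nlinarith
  have e := hp.intervalIntegral_add_eq (t - 1/2) 0
  rw [zero_add] at e
  rw [← e, show t - 1/2 + 1 = t + 1/2 by ring]
  have ii : ∀ a b, IntervalIntegrable f volume a b := fun a b => hf.intervalIntegrable a b
  rw [← intervalIntegral.integral_add_adjacent_intervals (ii (t-1/2) (t-s)) (ii (t-s) (t+1/2)),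
    ← intervalIntegral.integral_add_adjacent_intervals (ii (t-s) (t+s)) (ii (t+s) (t+1/2))]
  have a1 : ∫ τ in (t-1/2)..(t-s), -(C*s) ≤ ∫ τ in (t-1/2)..(t-s), f τ := by
    apply intervalIntegral.integral_mono_on (by linarith) (by simp) (ii _ _)
    intro x hx; apply hlow; rw [abs_le]; constructor <;> linarith [hx.1, hx.2]
  have a2 : ∫ τ in (t-s)..(t+s), 1/(32*s) ≤ ∫ τ in (t-s)..(t+s), f τ := by
    apply intervalIntegral.integral_mono_on (by linarith) (by simp) (ii _ _)
    intro x hx; apply hlow2; rw [abs_le]; constructor <;> linarith [hx.1, hx.2]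
  have a3 : ∫ τ in (t+s)..(t+1/2), -(C*s) ≤ ∫ τ in (t+s)..(t+1/2), f τ := by
    apply intervalIntegral.integral_mono_on (by linarith) (by simp) (ii _ _)
    intro x hx; apply hlow; rw [abs_le]; constructor <;> linarith [hx.1, hx.2]
  rw [intervalIntegral.integral_const, smul_eq_mul] at a1 a2 a3
  have : (t + s - (t - s)) * (1/(32*s)) = 1/16 := by field_simp; ring
  rw [this] at a2
  have hCs0 : 0 < C * s := by positivity
  nlinarith

section fam
variable {n : ℕ} {γ : Fin n → ℝ → ℂ} {s0 c : ℝ}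

lemma round_shift (t t' : ℝ) : ∃ k : ℤ, |t' + k - t| ≤ 1/2 := by
  refine ⟨- round (t' - t), ?_⟩
  have := abs_sub_round (t' - t)
  have e : t' + ((-round (t' - t) : ℤ) : ℝ) - t = t' - t - round (t' - t) := by push_cast; ring
  rw [e]; exact this

lemma per_int {E : Type*} {f : ℝ → E} (h : Function.Periodic f 1) (t : ℝ) (k : ℤ) : f (t + k) = f t := by
  have := h.int_mul k t
  rw [mul_one] at this; exact this

lemma Fam.par_int (F : Fam γ s0 c) (i : Fin n) (t s : ℝ) (k : ℤ) : par (γ i) (t + k) s = par (γ i) t s :=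
  per_int ((F.sc i).par_per s) t k

lemma Fam.par_inj (F : Fam γ s0 c) {i j : Fin n} {t t' s s' : ℝ} (hs : |s| ≤ s0) (hs' : |s'| ≤ s0)
    (e : par (γ i) t s = par (γ j) t' s') : i = j ∧ s = s' := by
  have hij : i = j := by
    by_contra hij
    have := F.far i j hij t t' s s' hs hs'
    rw [e, sub_self, norm_zero] at this
    linarith [F.cpos]
  subst hij
  refine ⟨rfl, ?_⟩
  obtain ⟨k, hk⟩ := round_shift t t'
  have := F.near i t (t' + k) s s' (by linarith) hs hs'
  rw [F.par_int, e, sub_self, norm_zero] at this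
  have h1 : |t' + k - t| + |s' - s| ≤ 0 := by
    by_contra h; push Not at h
    have := mul_pos F.cpos h; linarith
  have h2 := abs_nonneg (t' + k - t)
  have h3 : |s' - s| = 0 := le_antisymm (by linarith) (abs_nonneg _)
  rw [abs_eq_zero] at h3; linarith

/-- open sub-collar -/
def band (γ : ℝ → ℂ) (a b : ℝ) : Set ℂ := (fun p : ℝ × ℝ => par γ p.1 p.2) '' (univ ×ˢ Ioo a b)

lemma mem_band {γ : ℝ → ℂ} {a b : ℝ} {z : ℂ} : z ∈ band γ a b ↔ ∃ t s, a < s ∧ s < b ∧ par γ t s = z := by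
  constructor
  · rintro ⟨⟨t, s⟩, ⟨_, h⟩, rfl⟩; exact ⟨t, s, h.1, h.2, rfl⟩
  · rintro ⟨t, s, h1, h2, rfl⟩; exact ⟨(t, s), ⟨mem_univ _, h1, h2⟩, rfl⟩

lemma Fam.band_open (F : Fam γ s0 c) (i : Fin n) {a b : ℝ} (ha : -s0 ≤ a) (hb : b ≤ s0) : IsOpen (band (γ i) a b) := by
  rw [isOpen_iff_mem_nhds]
  rintro _ ⟨⟨t, s⟩, ⟨_, h⟩, rfl⟩
  simp only
  rw [← F.opn i t s (abs_le.2 ⟨by linarith [h.1], by linarith [h.2]⟩)]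
  apply image_mem_map
  exact (isOpen_univ.prod isOpen_Ioo).mem_nhds ⟨mem_univ _, h⟩

lemma Fam.band_conn (F : Fam γ s0 c) (i : Fin n) {a b : ℝ} : IsPreconnected (band (γ i) a b) :=
  (isPreconnected_univ.prod isPreconnected_Ioo).image _ (F.sc i).par_cont.continuousOn

/-- winding of the j-th curve -/
def wd (γ : ℝ → ℂ) (z : ℂ) : ℂ := CT γ (deriv γ) z

lemma Fam.jump_pos (F : Fam γ s0 c) (i : Fin n) : ∃ s1, 0 < s1 ∧ s1 ≤ s0 ∧ ∀ s, 0 < s → s ≤ s1 → ∀ t,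
    0 < ((wd (γ i) (par (γ i) t s) - wd (γ i) (par (γ i) t (-s))) / I).re := by
  have h := F.sc i
  obtain ⟨δ, C, hδ, hδ2, hC, hP⟩ := h.poisson F.cpos (F.near i)
  have hs0 := F.s0pos
  refine ⟨min s0 (min δ (1/(64*C))), by positivity, min_le_left _ _, fun s hs hss t => ?_⟩
  have hs1 : s ≤ s0 := hss.trans (min_le_left _ _)
  have hs2 : s ≤ δ := (hss.trans (min_le_right _ _)).trans (min_le_left _ _)
  have hs3 : C * s < 1/32 := by
    have : s ≤ 1/(64*C) := (hss.trans (min_le_right _ _)).trans (min_le_right _ _)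
    calc C * s ≤ C * (1/(64*C)) := by gcongr
      _ = 1/64 := by field_simp
      _ < _ := by norm_num
  have habs : |s| ≤ s0 := by rwa [abs_of_pos hs]
  have ne1 : ∀ τ, γ i τ - par (γ i) t s ≠ 0 := by
    intro τ h0
    rw [← par_zero (γ i) τ, sub_eq_zero] at h0
    have := (F.par_inj (by simpa using hs0.le) habs h0).2; linarith
  have ne2 : ∀ τ, γ i τ - par (γ i) t (-s) ≠ 0 := by
    intro τ h0
    rw [← par_zero (γ i) τ, sub_eq_zero] at h0
    have := (F.par_inj (by simpa using hs0.le) (by rwa [abs_neg]) h0).2; linarith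
  have hc := h.cont
  have hc1 := h.cont1
  have e0 : ∀ τ, (γ i τ - γ i t)^2 + s^2 * deriv (γ i) t ^2 = (γ i τ - par (γ i) t s) * (γ i τ - par (γ i) t (-s)) := by
    intro τ
    simp only [par]; push_cast; ring_nf; simp only [I_sq]; ring
  have hPKc : Continuous (fun τ => PK (γ i) t τ s) := by
    unfold PK
    refine Continuous.div (by fun_prop) (by fun_prop) ?_
    intro τ; rw [e0]; exact mul_ne_zero (ne1 τ) (ne2 τ)
  have e1 : (wd (γ i) (par (γ i) t s) - wd (γ i) (par (γ i) t (-s))) / I = ∫ τ in (0:ℝ)..1, PK (γ i) t τ s := by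
    unfold wd CT
    rw [← intervalIntegral.integral_sub, ← intervalIntegral.integral_div]
    · congr 1; ext τ
      unfold PK
      rw [e0, div_sub_div _ _ (ne1 τ) (ne2 τ), div_div, mul_comm _ I, ← div_div]
      congr 1
      simp only [par]; push_cast
      rw [div_eq_iff I_ne_zero]; ring
    · exact (Continuous.div hc1 (by fun_prop) ne1).intervalIntegrable _ _
    · exact (Continuous.div hc1 (by fun_prop) ne2).intervalIntegrable _ _
  have e2 : (∫ τ in (0:ℝ)..1, PK (γ i) t τ s).re = ∫ τ in (0:ℝ)..1, (PK (γ i) t τ s).re := by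
    have := Complex.reCLM.intervalIntegral_comp_comm (hPKc.intervalIntegrable (μ := volume) 0 1)
    exact this.symm
  rw [e1, e2]
  refine int_pos_of_poisson (t := t) (Complex.continuous_re.comp hPKc) ?_ hδ2 hC hs hs2 hs3 (fun τ hτ => (hP t τ s hs hs1).1 hτ)
    (fun τ hτ hτ2 => (Complex.abs_re_le_norm _).trans ((hP t τ s hs hs1).2 hτ hτ2))
  intro τ
  simp only [PK, h.per τ, h.per1 τ]

end fam

/-- The geometric situation. -/
structure Dom {n : ℕ} (K : Set ℂ) (γ : Fin n → ℝ → ℂ) (s0 c : ℝ) : Prop extends Fam γ s0 c where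
  comp : IsCompact K
  conn : IsConnected Kᶜ
  bd : (⋃ i, range (γ i)) = frontier K
  pos : ∀ i t s, 0 < s → s ≤ s0 → par (γ i) t s ∈ interior K
  neg : ∀ i t s, s < 0 → -s0 ≤ s → par (γ i) t s ∈ Kᶜ
  wpos : ∀ i t s, 0 < s → s ≤ s0 → wd (γ i) (par (γ i) t s) = 2 * Real.pi * I
  wout : ∀ i, ∀ z ∈ Kᶜ, wd (γ i) z = 0
  wother : ∀ i j, i ≠ j → ∀ t s, |s| ≤ s0 → wd (γ j) (par (γ i) t s) = 0

lemma exists_dom {K : Set ℂ} (hK : IsCompact K) (hconn : IsConnected Kᶜ) (B : SmoothBoundary K) :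
    ∃ s0 c, Dom K B.curve s0 c := by
  have hsc : ∀ i, SC (B.curve i) := fun i => ⟨B.smooth i, B.periodic i, B.injOn i, B.regular i⟩
  obtain ⟨s0, c, F⟩ := exists_fam hsc B.disjointCurves
  have hs0 := F.s0pos
  have hfr : ∀ i t, B.curve i t ∈ frontier K := fun i t => by
    rw [← B.boundary]; exact mem_iUnion.2 ⟨i, t, rfl⟩
  have hcl : IsClosed K := hK.isClosed
  have hKo : IsOpen Kᶜ := hcl.isOpen_compl
  have hnot : ∀ i t, B.curve i t ∉ Kᶜ ∧ B.curve i t ∉ interior K := by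
    intro i t
    have := hfr i t
    rw [hcl.frontier_eq] at this
    exact ⟨fun h => h this.1, this.2⟩
  have per0 : ∀ i, B.curve i 1 = B.curve i 0 := fun i => by simpa using B.periodic i 0
  have wout : ∀ i, ∀ z ∈ Kᶜ, wd (B.curve i) z = 0 := fun i =>
    CT_wind_zero (hsc i).hasD (hsc i).cont1 (per0 i) hKo hconn.isPreconnected (fun t _ => (hnot i t).1) (neBot_compl hK)
  have hside : ∀ i a b, -s0 ≤ a → b ≤ s0 → (0 ≤ a ∨ b ≤ 0) →
      band (B.curve i) a b ⊆ interior K ∨ band (B.curve i) a b ⊆ Kᶜ := by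
    intro i a b ha hb hab
    apply IsPreconnected.subset_or_subset isOpen_interior hKo
      (disjoint_compl_right.mono_left interior_subset) _ (F.band_conn i)
    intro z hz
    obtain ⟨t, s, h1, h2, rfl⟩ := mem_band.1 hz
    by_contra hcon
    rw [mem_union, not_or] at hcon
    have : par (B.curve i) t s ∈ frontier K := by
      rw [hcl.frontier_eq]; exact ⟨not_not.1 hcon.2, hcon.1⟩
    rw [← B.boundary] at this
    obtain ⟨j, t', ht'⟩ := mem_iUnion.1 this
    rw [← par_zero (B.curve j) t'] at ht'
    have := (F.par_inj (by simpa using hs0.le) (abs_le.2 ⟨by linarith, by linarith⟩) ht').2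
    rcases hab with h | h <;> linarith
  have hother : ∀ i j, i ≠ j → ∀ x ∈ band (B.curve i) (-s0) s0, ∀ y ∈ band (B.curve i) (-s0) s0,
      wd (B.curve j) x = wd (B.curve j) y := by
    intro i j hij
    apply CT_wind_const (hsc j).hasD (hsc j).cont1 (per0 j) (F.band_open i le_rfl le_rfl) (F.band_conn i)
    intro t _ hm
    obtain ⟨t', s, h1, h2, e⟩ := mem_band.1 hm
    rw [← par_zero (B.curve j)] at e
    exact hij (F.par_inj (abs_le.2 ⟨h1.le, h2.le⟩) (by simpa using hs0.le) e).1
  have htot : ∀ z ∈ interior K, ∑ j, wd (B.curve j) z = 2 * Real.pi * I := fun z hz => B.orientation z hz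
  have main : ∀ i, band (B.curve i) 0 s0 ⊆ interior K ∧ band (B.curve i) (-s0) 0 ⊆ Kᶜ ∧
      (∀ j, i ≠ j → ∀ x ∈ band (B.curve i) (-s0) s0, wd (B.curve j) x = 0) := by
    intro i
    obtain ⟨s1, hs1, hs10, hj⟩ := F.jump_pos i
    set s := s1 / 2
    have hs : 0 < s := by positivity
    have hss : s < s0 := by simp only [s]; linarith
    have J := hj s hs (by simp only [s]; linarith) 0
    have mp : par (B.curve i) 0 s ∈ band (B.curve i) 0 s0 := mem_band.2 ⟨0, s, hs, hss, rfl⟩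
    have mn : par (B.curve i) 0 (-s) ∈ band (B.curve i) (-s0) 0 := mem_band.2 ⟨0, -s, by linarith, by linarith, rfl⟩
    have mp' : par (B.curve i) 0 s ∈ band (B.curve i) (-s0) s0 := mem_band.2 ⟨0, s, by linarith, hss, rfl⟩
    have mn' : par (B.curve i) 0 (-s) ∈ band (B.curve i) (-s0) s0 := mem_band.2 ⟨0, -s, by linarith, by linarith, rfl⟩
    have tot : ∑ j, wd (B.curve j) (par (B.curve i) 0 s) - ∑ j, wd (B.curve j) (par (B.curve i) 0 (-s))
       = wd (B.curve i) (par (B.curve i) 0 s) - wd (B.curve i) (par (B.curve i) 0 (-s)) := by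
      rw [← Finset.sum_sub_distrib]
      apply Finset.sum_eq_single i
      · intro j _ hji
        rw [hother i j hji.symm _ mp' _ mn', sub_self]
      · simp
    rw [← tot] at J
    have tot0 : ∀ z ∈ Kᶜ, ∑ j, wd (B.curve j) z = 0 := fun z hz => Finset.sum_eq_zero fun j _ => wout j z hz
    rcases hside i 0 s0 (by linarith) le_rfl (Or.inl le_rfl) with hp | hp <;>
    rcases hside i (-s0) 0 le_rfl (by linarith) (Or.inr le_rfl) with hn | hn
    · rw [htot _ (hp mp), htot _ (hn mn)] at J; simp at J
    · refine ⟨hp, hn, fun j hij x hx => ?_⟩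
      rw [hother i j hij x hx _ mn']; exact wout j _ (hn mn)
    · rw [tot0 _ (hp mp), htot _ (hn mn)] at J
      have e : (0 - 2 * (Real.pi:ℂ) * I) / I = ((-(2 * Real.pi) : ℝ) : ℂ) := by
        rw [div_eq_iff I_ne_zero]; push_cast; ring
      rw [e, ofReal_re] at J
      linarith [Real.pi_pos]
    · rw [tot0 _ (hp mp), tot0 _ (hn mn)] at J; simp at J
  refine ⟨s0 / 2, c, F.mono (by positivity) (by linarith), hK, hconn, B.boundary, ?_, ?_, ?_, wout, ?_⟩
  · intro i t s h1 h2
    exact (main i).1 (mem_band.2 ⟨t, s, h1, by linarith, rfl⟩)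
  · intro i t s h1 h2
    exact (main i).2.1 (mem_band.2 ⟨t, s, by linarith, h1, rfl⟩)
  · intro i t s h1 h2
    rw [← htot _ ((main i).1 (mem_band.2 ⟨t, s, h1, by linarith, rfl⟩))]
    symm
    apply Finset.sum_eq_single i
    · intro j _ hji
      exact (main i).2.2 j hji.symm _ (mem_band.2 ⟨t, s, by linarith, by linarith, rfl⟩)
    · simp
  · intro i j hij t s hs
    exact (main i).2.2 j hij _ (mem_band.2 ⟨t, s, by linarith [(abs_le.1 hs).1], by linarith [(abs_le.1 hs).2], rfl⟩)

/-- winding of the shifted curve -/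
def wds (γ : ℝ → ℂ) (s : ℝ) (z : ℂ) : ℂ := CT (fun τ => par γ τ s) (fun τ => dpar γ τ s) z

/-- shifted contour integral -/
def CI {n : ℕ} (γ : Fin n → ℝ → ℂ) (F : ℂ → ℂ) (s : ℝ) : ℂ :=
  ∑ j, ∫ τ in (0:ℝ)..1, F (par (γ j) τ s) * dpar (γ j) τ s

/-- shifted Cauchy integral -/
def lev {n : ℕ} (γ : Fin n → ℝ → ℂ) (F : ℂ → ℂ) (s : ℝ) (z : ℂ) : ℂ :=
  ∑ j, CT (fun τ => par (γ j) τ s) (fun τ => F (par (γ j) τ s) * dpar (γ j) τ s) z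

lemma SC.par_cont' {γ : ℝ → ℂ} (h : SC γ) (s : ℝ) : Continuous (fun t => par γ t s) :=
  h.par_cont.comp (by fun_prop : Continuous fun t => (t, s))
lemma SC.dpar_cont' {γ : ℝ → ℂ} (h : SC γ) (s : ℝ) : Continuous (fun t => dpar γ t s) :=
  h.dpar_cont.comp (by fun_prop : Continuous fun t => (t, s))

section
variable {n : ℕ} {γ : Fin n → ℝ → ℂ} {s0 c : ℝ} {K : Set ℂ}

lemma wds_eq (F : Fam γ s0 c) (j : Fin n) {a b s s' : ℝ} {z : ℂ} (hz : z ∉ band (γ j) a b)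
    (hs : s ∈ Ioo a b) (hs' : s' ∈ Ioo a b) : wds (γ j) s z = wds (γ j) s' z := by
  have := collar_int_const (F.sc j) (G := fun ζ => (ζ - z)⁻¹) (U := {z}ᶜ) isOpen_compl_singleton
    (fun ζ hζ => ((differentiableAt_id.sub_const z).inv (sub_ne_zero.2 hζ)).differentiableWithinAt)
    (a := a) (b := b) (fun t s hs h => hz (mem_band.2 ⟨t, s, hs.1, hs.2, h⟩)) hs hs'
  simpa only [wds, CT, div_eq_inv_mul] using this

lemma wds_zero (j : Fin n) (z : ℂ) : wds (γ j) 0 z = wd (γ j) z := by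
  simp [wds, wd]

lemma wds_const (F : Fam γ s0 c) (j k : Fin n) {a b s : ℝ} (ha : -s0 ≤ a) (hb : b ≤ s0) (hs : |s| ≤ s0)
    (h : j ≠ k ∨ s ∉ Ioo a b) : ∀ x ∈ band (γ k) a b, ∀ y ∈ band (γ k) a b, wds (γ j) s x = wds (γ j) s y := by
  have hp := (F.sc j).par_per s 0
  simp only [zero_add] at hp
  apply CT_wind_const (fun t => (F.sc j).par_hasD t s) ((F.sc j).dpar_cont' s) hp (F.band_open k ha hb) (F.band_conn k)
  intro t _ hm
  obtain ⟨t', s', h1, h2, e⟩ := mem_band.1 hm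
  have h3 := F.par_inj (abs_le.2 ⟨by linarith, by linarith⟩) hs e
  rcases h with h | h
  · exact h h3.1.symm
  · apply h; rw [← h3.2]; exact ⟨h1, h2⟩

lemma Dom.wds_pos (D : Dom K γ s0 c) (j : Fin n) {s r t : ℝ} (hs : -s0 < s) (hr : s < r) (hr' : r < s0) :
    wds (γ j) s (par (γ j) t r) = 2 * Real.pi * I := by
  have h0 := D.s0pos
  set r' := max (s0/2) ((r + s0)/2) with hr'd
  have hr1 : r < r' := lt_of_lt_of_le (by linarith) (le_max_right _ _)
  have hr2 : 0 < r' := lt_of_lt_of_le (by linarith) (le_max_left _ _)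
  have hr3 : r' < s0 := max_lt (by linarith) (by linarith)
  rw [wds_const D.toFam j j (a := s) (b := s0) hs.le le_rfl (abs_le.2 ⟨hs.le, by linarith⟩) (Or.inr (by simp))
    _ (mem_band.2 ⟨t, r, hr, hr', rfl⟩) _ (mem_band.2 ⟨t, r', by linarith, hr3, rfl⟩),
    wds_eq D.toFam j (a := -s0) (b := r') (s' := 0) ?_ ⟨hs, by linarith⟩ ⟨by linarith, hr2⟩, wds_zero]
  · exact D.wpos j t r' hr2 hr3.le
  · intro hm
    obtain ⟨t', s', h1, h2, e⟩ := mem_band.1 hm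
    have := (D.par_inj (abs_le.2 ⟨by linarith, by linarith⟩) (abs_le.2 ⟨by linarith, by linarith⟩) e).2
    linarith

lemma Dom.wds_neg (D : Dom K γ s0 c) (j : Fin n) {s r t : ℝ} (hs : s < s0) (hr : r < s) (hr' : -s0 < r) :
    wds (γ j) s (par (γ j) t r) = 0 := by
  have h0 := D.s0pos
  set r' := min (-s0/2) ((r - s0)/2) with hr'd
  have hr1 : r' < r := lt_of_le_of_lt (min_le_right _ _) (by linarith)
  have hr2 : r' < 0 := lt_of_le_of_lt (min_le_left _ _) (by linarith)
  have hr3 : -s0 < r' := lt_min (by linarith) (by linarith)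
  rw [wds_const D.toFam j j (a := -s0) (b := s) le_rfl hs.le (abs_le.2 ⟨by linarith, hs.le⟩) (Or.inr (by simp))
    _ (mem_band.2 ⟨t, r, hr', hr, rfl⟩) _ (mem_band.2 ⟨t, r', hr3, by linarith, rfl⟩),
    wds_eq D.toFam j (a := r') (b := s0) (s' := 0) ?_ ⟨by linarith, hs⟩ ⟨hr2, by linarith⟩, wds_zero]
  · exact D.wout j _ (D.neg j t r' hr2 hr3.le)
  · intro hm
    obtain ⟨t', s', h1, h2, e⟩ := mem_band.1 hm
    have := (D.par_inj (abs_le.2 ⟨by linarith, by linarith⟩) (abs_le.2 ⟨by linarith, by linarith⟩) e).2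
    linarith

lemma Dom.wds_other (D : Dom K γ s0 c) {j k : Fin n} (hjk : k ≠ j) {s r t : ℝ} (hs : |s| < s0) (hr : |r| < s0) :
    wds (γ j) s (par (γ k) t r) = 0 := by
  have h0 := D.s0pos
  obtain ⟨h1, h2⟩ := abs_lt.1 hs
  rw [wds_eq D.toFam j (a := -s0) (b := s0) (s' := 0) ?_ ⟨h1, h2⟩ ⟨by linarith, h0⟩, wds_zero]
  · exact D.wother k j hjk t r hr.le
  · intro hm
    obtain ⟨t', s', h1, h2, e⟩ := mem_band.1 hm
    exact hjk (D.par_inj (abs_le.2 ⟨by linarith, by linarith⟩) hr.le e).1.symm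

lemma lev_cont (F : Fam γ s0 c) {G : ℂ → ℂ} {V : Set ℂ} (hG : ContinuousOn G V) {s : ℝ} (hs : ∀ j t, par (γ j) t s ∈ V)
    (j : Fin n) : Continuous (fun τ => G (par (γ j) τ s) * dpar (γ j) τ s) :=
  (hG.comp_continuous ((F.sc j).par_cont' s) (hs j)).mul ((F.sc j).dpar_cont' s)

lemma lev_diff (F : Fam γ s0 c) {G : ℂ → ℂ} {V : Set ℂ} (hG : ContinuousOn G V) {s : ℝ} (hs : ∀ j t, par (γ j) t s ∈ V)
    {z : ℂ} (hz : ∀ j t, par (γ j) t s ≠ z) : DifferentiableAt ℂ (lev γ G s) z := by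
  have : lev γ G s = ∑ j, CT (fun τ => par (γ j) τ s) (fun τ => G (par (γ j) τ s) * dpar (γ j) τ s) := by
    ext z; simp [lev]
  rw [this]
  apply DifferentiableAt.sum
  intro j _
  refine (CT_hasD ((F.sc j).par_cont' s) (lev_cont F hG hs j) ?_).differentiableAt
  rintro ⟨t, _, h⟩; exact hz j t h

lemma lev_infty (F : Fam γ s0 c) {G : ℂ → ℂ} {V : Set ℂ} (hG : ContinuousOn G V) {s : ℝ} (hs : ∀ j t, par (γ j) t s ∈ V) :
    Tendsto (fun z => z * lev γ G s z) (cobounded ℂ) (𝓝 (- CI γ G s)) := by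
  unfold lev CI
  simp only [Finset.mul_sum]
  rw [← Finset.sum_neg_distrib]
  exact tendsto_finsetSum _ fun j _ => CT_infty ((F.sc j).par_cont' s) (lev_cont F hG hs j)

lemma Dom.overlap (D : Dom K γ s0 c) {G : ℂ → ℂ} {V : Set ℂ} (hV : IsOpen V) (hG : DifferentiableOn ℂ G V)
    {a b : ℝ} (ha : -s0 ≤ a) (hb : b ≤ s0) (hab : ∀ j t, ∀ s ∈ Ioo a b, par (γ j) t s ∈ V)
    {s2 r s1 : ℝ} (h2 : a < s2) (h2r : s2 < r) (hr1 : r < s1) (h1 : s1 < b) (k : Fin n) (t : ℝ) :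
    lev γ G s2 (par (γ k) t r) - lev γ G s1 (par (γ k) t r) = 2 * Real.pi * I * G (par (γ k) t r) := by
  set z0 := par (γ k) t r with hz0
  have hz0V : z0 ∈ V := hab k t r ⟨by linarith, by linarith⟩
  have hd : DifferentiableOn ℂ (dslope G z0) V := (Complex.differentiableOn_dslope (hV.mem_nhds hz0V)).2 hG
  have hne : ∀ s ∈ Ioo a b, s ≠ r → ∀ j τ, par (γ j) τ s - z0 ≠ 0 := by
    intro s hs hsr j τ h0
    rw [sub_eq_zero] at h0
    exact hsr (D.par_inj (abs_le.2 ⟨by linarith [hs.1], by linarith [hs.2]⟩) (abs_le.2 ⟨by linarith, by linarith⟩) h0).2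
  have key : ∀ s ∈ Ioo a b, s ≠ r → ∀ j, ∫ τ in (0:ℝ)..1, dslope G z0 (par (γ j) τ s) * dpar (γ j) τ s
      = CT (fun τ => par (γ j) τ s) (fun τ => G (par (γ j) τ s) * dpar (γ j) τ s) z0 - G z0 * wds (γ j) s z0 := by
    intro s hs hsr j
    have hc1 := (D.sc j).par_cont' s
    have hc2 := (D.sc j).dpar_cont' s
    have hc3 := lev_cont D.toFam hG.continuousOn (fun j t => hab j t s hs) j
    unfold wds CT
    rw [← intervalIntegral.integral_const_mul, ← intervalIntegral.integral_sub]
    · apply intervalIntegral.integral_congr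
      intro τ _
      have := hne s hs hsr j τ
      simp only
      rw [dslope_of_ne _ (sub_ne_zero.1 this), slope_def_field]
      field_simp
    · exact (hc3.div (by fun_prop) (hne s hs hsr j)).intervalIntegrable _ _
    · exact (continuous_const.mul (hc2.div (by fun_prop) (hne s hs hsr j))).intervalIntegrable _ _
  have hs2 : s2 ∈ Ioo a b := ⟨h2, by linarith⟩
  have hs1 : s1 ∈ Ioo a b := ⟨by linarith, h1⟩
  have e : ∀ j, CT (fun τ => par (γ j) τ s2) (fun τ => G (par (γ j) τ s2) * dpar (γ j) τ s2) z0 -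
      CT (fun τ => par (γ j) τ s1) (fun τ => G (par (γ j) τ s1) * dpar (γ j) τ s1) z0 =
      G z0 * (wds (γ j) s2 z0 - wds (γ j) s1 z0) := by
    intro j
    have h := collar_int_const (D.sc j) hV hd (hab j) hs2 hs1
    rw [key s2 hs2 h2r.ne j, key s1 hs1 hr1.ne' j] at h
    linear_combination h
  unfold lev
  rw [← Finset.sum_sub_distrib, Finset.sum_congr rfl (fun j _ => e j), Finset.sum_eq_single k]
  · rw [hz0, D.wds_pos k (by linarith) h2r (by linarith), D.wds_neg k (by linarith) hr1 (by linarith)]; ring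
  · intro j _ hjk
    rw [hz0, D.wds_other hjk.symm (abs_lt.2 ⟨by linarith, by linarith⟩) (abs_lt.2 ⟨by linarith, by linarith⟩),
      D.wds_other hjk.symm (abs_lt.2 ⟨by linarith, by linarith⟩) (abs_lt.2 ⟨by linarith, by linarith⟩)]; ring
  · simp

lemma entire_zero {E : ℂ → ℂ} (hE : Differentiable ℂ E) (h0 : Tendsto E (cobounded ℂ) (𝓝 0)) (z : ℂ) : E z = 0 := by
  rw [Metric.cobounded_eq_cocompact] at h0
  exact hE.apply_eq_of_tendsto_cocompact z h0

lemma CI_const (F : Fam γ s0 c) {G : ℂ → ℂ} {V : Set ℂ} (hV : IsOpen V) (hG : DifferentiableOn ℂ G V)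
    {a b : ℝ} (hab : ∀ j t, ∀ s ∈ Ioo a b, par (γ j) t s ∈ V) {s s' : ℝ} (hs : s ∈ Ioo a b) (hs' : s' ∈ Ioo a b) :
    CI γ G s = CI γ G s' :=
  Finset.sum_congr rfl fun j _ => collar_int_const (F.sc j) hV hG (hab j) hs hs'

lemma levelset_compact {γ : ℝ → ℂ} (h : SC γ) (a b : ℝ) :
    IsCompact ((fun p : ℝ × ℝ => par γ p.1 p.2) '' (univ ×ˢ Icc a b)) := by
  have : (fun p : ℝ × ℝ => par γ p.1 p.2) '' (univ ×ˢ Icc a b) = (fun p : ℝ × ℝ => par γ p.1 p.2) '' (Icc 0 1 ×ˢ Icc a b) := by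
    apply Subset.antisymm
    · rintro _ ⟨⟨t, s⟩, ⟨_, hs⟩, rfl⟩
      refine ⟨(Int.fract t, s), ⟨⟨Int.fract_nonneg t, (Int.fract_lt_one t).le⟩, hs⟩, (per_fract (h.par_per s) t).symm⟩
    · exact image_mono (prod_mono_left (subset_univ _))
  rw [this]
  exact (isCompact_Icc.prod isCompact_Icc).image h.par_cont

/-- Outer Cauchy theorem. -/
lemma Dom.outer (D : Dom K γ s0 c) {G : ℂ → ℂ} {V : Set ℂ} (hV : IsOpen V) (hG : DifferentiableOn ℂ G V)
    {b : ℝ} (hb0 : b ≤ 0) (hVout : ∀ z ∈ Kᶜ, (∀ j t s, b ≤ s → s < 0 → par (γ j) t s ≠ z) → z ∈ V)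
    {w : ℂ} (hw : Tendsto (fun z => z * G z) (cobounded ℂ) (𝓝 w)) {s : ℝ} (hs : -s0 < s) (hsb : s < b) :
    CI γ G s = 2 * Real.pi * I * w := by
  have h0 := D.s0pos
  have hab : ∀ j t, ∀ s ∈ Ioo (-s0) b, par (γ j) t s ∈ V := by
    intro j t s hs
    apply hVout _ (D.neg j t s (by linarith [hs.2]) hs.1.le)
    intro j' t' s' h1 h2 e
    have := (D.par_inj (abs_le.2 ⟨by linarith [hs.1], by linarith⟩) (abs_le.2 ⟨by linarith [hs.1], by linarith [hs.2]⟩) e).2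
    linarith [hs.2]
  obtain ⟨sm, hsm1, hsm2⟩ := exists_between hs
  obtain ⟨s2, hs21, hs22⟩ := exists_between hsm1
  set R : Set ℂ := K ∪ ⋃ j, (fun p : ℝ × ℝ => par (γ j) p.1 p.2) '' (univ ×ˢ Icc sm 0) with hR
  have hRc : IsClosed R := by
    apply D.comp.isClosed.union
    exact isClosed_iUnion_of_finite fun j => (levelset_compact (D.sc j) _ _).isClosed
  have hfr : ∀ z ∈ K, z ∈ interior K ∨ ∃ j t, par (γ j) t 0 = z := by
    intro z hz
    by_cases h : z ∈ interior K
    · exact Or.inl h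
    · right
      have : z ∈ frontier K := by rw [D.comp.isClosed.frontier_eq]; exact ⟨hz, h⟩
      rw [← D.bd] at this
      obtain ⟨j, t, ht⟩ := mem_iUnion.1 this
      exact ⟨j, t, by rw [par_zero]; exact ht⟩
  have hcont := hG.continuousOn
  have hV2 : ∀ j t, par (γ j) t s2 ∈ V := fun j t => hab j t s2 ⟨hs21, by linarith⟩
  have hV1 : ∀ j t, par (γ j) t s ∈ V := fun j t => hab j t s ⟨hs, by linarith⟩
  classical
  set E : ℂ → ℂ := fun z => if z ∈ R then lev γ G s2 z else lev γ G s z + 2 * Real.pi * I * G z with hE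
  have hout : ∀ z ∉ R, z ∈ Kᶜ ∧ z ∈ V ∧ ∀ j t, par (γ j) t s ≠ z := by
    intro z hz
    have hz' : z ∈ Kᶜ := fun h => hz (Or.inl h)
    have hz2 : ∀ j t s, sm ≤ s → s ≤ 0 → par (γ j) t s ≠ z := by
      intro j t s h1 h2 e
      exact hz (Or.inr (mem_iUnion.2 ⟨j, (t, s), ⟨mem_univ _, h1, h2⟩, e⟩))
    exact ⟨hz', hVout z hz' fun j t s h1 h2 => hz2 j t s (by linarith) h2.le, fun j t => hz2 j t s hsm2.le (by linarith)⟩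
  have hEd : Differentiable ℂ E := by
    have caseband : ∀ k t r, s2 < r → r < s → DifferentiableAt ℂ E (par (γ k) t r) := by
      intro k t r h1 h2
      have hd : DifferentiableAt ℂ (lev γ G s2) (par (γ k) t r) := by
        apply lev_diff D.toFam hcont hV2
        intro j t' e
        have := (D.par_inj (abs_le.2 ⟨by linarith, by linarith⟩) (abs_le.2 ⟨by linarith, by linarith⟩) e).2
        linarith
      refine hd.congr_of_eventuallyEq ?_
      have hm : band (γ k) s2 s ∈ 𝓝 (par (γ k) t r) :=
        (D.band_open k hs21.le (by linarith)).mem_nhds (mem_band.2 ⟨t, r, h1, h2, rfl⟩)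
      filter_upwards [hm] with z hz
      obtain ⟨t', r', q1, q2, rfl⟩ := mem_band.1 hz
      simp only [hE]
      split_ifs with hif
      · rfl
      · rw [← D.overlap hV hG le_rfl (by linarith) hab hs21 q1 q2 (by linarith)]; ring
    intro z
    by_cases hz : z ∈ R
    · have : (∃ j t r, s2 < r ∧ r < s ∧ par (γ j) t r = z) ∨ (∃ O, IsOpen O ∧ z ∈ O ∧ O ⊆ R ∧ ∀ j t, par (γ j) t s2 ≠ z) := by
        have hside : ∀ j t r, sm < r → r ≤ 0 → par (γ j) t r = z →
            (∃ O, IsOpen O ∧ z ∈ O ∧ O ⊆ R ∧ ∀ j t, par (γ j) t s2 ≠ z) := by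
          rintro j t r h1 h2 rfl
          refine ⟨band (γ j) sm s0, D.band_open j (by linarith) le_rfl, mem_band.2 ⟨t, r, h1, by linarith, rfl⟩, ?_, ?_⟩
          · intro x hx
            obtain ⟨t', r', q1, q2, rfl⟩ := mem_band.1 hx
            by_cases hr' : 0 < r'
            · exact Or.inl (interior_subset (D.pos j t' r' hr' q2.le))
            · exact Or.inr (mem_iUnion.2 ⟨j, (t', r'), ⟨mem_univ _, q1.le, not_lt.1 hr'⟩, rfl⟩)
          · intro j' t' e
            have := (D.par_inj (abs_le.2 ⟨by linarith, by linarith⟩) (abs_le.2 ⟨by linarith, by linarith⟩) e).2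
            linarith
        rcases hz with hz | hz
        · rcases hfr z hz with hz | ⟨j, t, e⟩
          · right
            refine ⟨interior K, isOpen_interior, hz, interior_subset.trans subset_union_left, ?_⟩
            rintro j t rfl
            exact D.neg j t s2 (by linarith) hs21.le (interior_subset hz)
          · exact Or.inr (hside j t 0 (by linarith) le_rfl e)
        · obtain ⟨j, ⟨t, r⟩, ⟨_, hr⟩, e⟩ := mem_iUnion.1 hz
          by_cases hrs : r < s
          · exact Or.inl ⟨j, t, r, by linarith [hr.1], hrs, e⟩
          · exact Or.inr (hside j t r (by linarith) hr.2 e)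
      rcases this with ⟨j, t, r, h1, h2, rfl⟩ | ⟨O, hO, hzO, hOR, hne⟩
      · exact caseband j t r h1 h2
      · refine (lev_diff D.toFam hcont hV2 hne).congr_of_eventuallyEq ?_
        filter_upwards [hO.mem_nhds hzO] with x hx
        simp only [hE, if_pos (hOR hx)]
    · obtain ⟨h1, h2, h3⟩ := hout z hz
      have hd : DifferentiableAt ℂ (fun z => lev γ G s z + 2 * Real.pi * I * G z) z :=
        (lev_diff D.toFam hcont hV1 h3).add ((hG.differentiableAt (hV.mem_nhds h2)).const_mul _)
      refine hd.congr_of_eventuallyEq ?_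
      filter_upwards [hRc.isOpen_compl.mem_nhds hz] with x hx
      simp only [hE, if_neg hx]
  have hRb : Rᶜ ∈ cobounded ℂ := by
    apply isBounded_def.1
    refine D.comp.isBounded.union ?_
    exact (isBounded_iUnion.2 fun j => (levelset_compact (D.sc j) _ _).isBounded)
  have hlim : Tendsto (fun z => z * E z) (cobounded ℂ) (𝓝 (- CI γ G s + 2 * Real.pi * I * w)) := by
    have := (lev_infty D.toFam hcont hV1).add (hw.const_mul (2 * Real.pi * I))
    refine this.congr' ?_
    filter_upwards [hRb] with z hz
    simp only [hE, if_neg hz]; ring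
  have hz := entire_zero hEd (tendsto_zero_of_mul le_rfl hlim)
  have hz2 : Tendsto (fun z => z * E z) (cobounded ℂ) (𝓝 0) := by
    simp only [hz, mul_zero]; exact tendsto_const_nhds
  have := tendsto_nhds_unique hlim hz2
  linear_combination -this

/-- Inner Cauchy theorem. -/
lemma Dom.inner (D : Dom K γ s0 c) {G : ℂ → ℂ} (hG : DifferentiableOn ℂ G (interior K)) {s : ℝ} (hs : 0 < s) (hss : s < s0) :
    CI γ G s = 0 := by
  have hab : ∀ j t, ∀ s ∈ Ioo 0 s0, par (γ j) t s ∈ interior K := fun j t s hs => D.pos j t s hs.1 hs.2.le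
  obtain ⟨sm, hsm1, hsm2⟩ := exists_between hs
  obtain ⟨s2, hs21, hs22⟩ := exists_between hsm1
  have hV := isOpen_interior (s := K)
  have hcont := hG.continuousOn
  have hV2 : ∀ j t, par (γ j) t s2 ∈ interior K := fun j t => hab j t s2 ⟨hs21, by linarith⟩
  have hV1 : ∀ j t, par (γ j) t s ∈ interior K := fun j t => hab j t s ⟨hs, by linarith⟩
  set R : Set ℂ := K \ ⋃ j, band (γ j) (-s0) sm with hR
  have hRc : IsClosed R := by
    rw [hR, diff_eq]
    refine D.comp.isClosed.inter (isOpen_iUnion fun j => D.band_open j le_rfl (by linarith)).isClosed_compl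
  classical
  set E : ℂ → ℂ := fun z => if z ∈ R then lev γ G s2 z - 2 * Real.pi * I * G z else lev γ G s z with hE
  have hEd : Differentiable ℂ E := by
    have caseband : ∀ k t r, s2 < r → r < s → DifferentiableAt ℂ E (par (γ k) t r) := by
      intro k t r h1 h2
      have hd : DifferentiableAt ℂ (lev γ G s) (par (γ k) t r) := by
        apply lev_diff D.toFam hcont hV1
        intro j t' e
        have := (D.par_inj (abs_le.2 ⟨by linarith, by linarith⟩) (abs_le.2 ⟨by linarith, by linarith⟩) e).2
        linarith
      refine hd.congr_of_eventuallyEq ?_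
      have hm : band (γ k) s2 s ∈ 𝓝 (par (γ k) t r) :=
        (D.band_open k (by linarith) (by linarith)).mem_nhds (mem_band.2 ⟨t, r, h1, h2, rfl⟩)
      filter_upwards [hm] with z hz
      obtain ⟨t', r', q1, q2, rfl⟩ := mem_band.1 hz
      simp only [hE]
      split_ifs with hif
      · rw [← D.overlap hV hG (by linarith) le_rfl hab hs21 q1 q2 (by linarith)]; ring
      · rfl
    intro z
    by_cases hb : ∃ j t r, s2 < r ∧ r < s ∧ par (γ j) t r = z
    · obtain ⟨j, t, r, h1, h2, rfl⟩ := hb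
      exact caseband j t r h1 h2
    by_cases hz : z ∈ R
    · have hzi : z ∈ interior K := by
        by_contra h
        have : z ∈ frontier K := by rw [D.comp.isClosed.frontier_eq]; exact ⟨hz.1, h⟩
        rw [← D.bd] at this
        obtain ⟨j, t, ht⟩ := mem_iUnion.1 this
        exact hz.2 (mem_iUnion.2 ⟨j, mem_band.2 ⟨t, 0, by linarith, by linarith, by rw [par_zero]; exact ht⟩⟩)
      set R2 : Set ℂ := interior K ∩ (⋃ j, (fun p : ℝ × ℝ => par (γ j) p.1 p.2) '' (univ ×ˢ Icc (-s0) sm))ᶜ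
      have hR2o : IsOpen R2 := hV.inter (isClosed_iUnion_of_finite fun j => (levelset_compact (D.sc j) _ _).isClosed).isOpen_compl
      have hR2 : R2 ⊆ R := by
        rintro x ⟨h1, h2⟩
        refine ⟨interior_subset h1, fun h => h2 ?_⟩
        obtain ⟨j, hj⟩ := mem_iUnion.1 h
        obtain ⟨t, r, q1, q2, e⟩ := mem_band.1 hj
        exact mem_iUnion.2 ⟨j, (t, r), ⟨mem_univ _, q1.le, q2.le⟩, e⟩
      have hzR2 : z ∈ R2 := by
        refine ⟨hzi, fun h => ?_⟩
        obtain ⟨j, ⟨t, r⟩, ⟨_, hr⟩, e⟩ := mem_iUnion.1 h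
        by_cases hrs : s2 < r
        · exact hb ⟨j, t, r, hrs, by linarith [hr.2], e⟩
        by_cases hr0 : r < 0
        · subst e
          exact D.neg j t r hr0 hr.1 hz.1
        · exact hz.2 (mem_iUnion.2 ⟨j, mem_band.2 ⟨t, r, by linarith, by linarith, e⟩⟩)
      have hne : ∀ j t, par (γ j) t s2 ≠ z := by
        intro j t e
        exact hz.2 (mem_iUnion.2 ⟨j, mem_band.2 ⟨t, s2, by linarith, by linarith, e⟩⟩)
      have hd : DifferentiableAt ℂ (fun z => lev γ G s2 z - 2 * Real.pi * I * G z) z :=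
        (lev_diff D.toFam hcont hV2 hne).sub ((hG.differentiableAt (hV.mem_nhds hzi)).const_mul _)
      refine hd.congr_of_eventuallyEq ?_
      filter_upwards [hR2o.mem_nhds hzR2] with x hx
      simp only [hE, if_pos (hR2 hx)]
    · have hne : ∀ j t, par (γ j) t s ≠ z := by
        rintro j t rfl
        refine hz ⟨interior_subset (hV1 j t), fun h => ?_⟩
        obtain ⟨j', hj⟩ := mem_iUnion.1 h
        obtain ⟨t', r, q1, q2, e⟩ := mem_band.1 hj
        have := (D.par_inj (abs_le.2 ⟨by linarith, by linarith⟩) (abs_le.2 ⟨by linarith, by linarith⟩) e).2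
        linarith
      refine (lev_diff D.toFam hcont hV1 hne).congr_of_eventuallyEq ?_
      filter_upwards [hRc.isOpen_compl.mem_nhds hz] with x hx
      simp only [hE, if_neg hx]
  have hRb : Rᶜ ∈ cobounded ℂ := isBounded_def.1 (D.comp.isBounded.subset diff_subset)
  have hlim : Tendsto (fun z => z * E z) (cobounded ℂ) (𝓝 (- CI γ G s)) := by
    refine (lev_infty D.toFam hcont hV1).congr' ?_
    filter_upwards [hRb] with z hz
    simp only [hE, if_neg hz]
  have hz := entire_zero hEd (tendsto_zero_of_mul le_rfl hlim)
  have hz2 : Tendsto (fun z => z * E z) (cobounded ℂ) (𝓝 0) := by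
    simp only [hz, mul_zero]; exact tendsto_const_nhds
  have := tendsto_nhds_unique hlim hz2
  linear_combination -this

/-- boundary version of `outer` -/
lemma Dom.outer_bd (D : Dom K γ s0 c) {G : ℂ → ℂ} (hG : DifferentiableOn ℂ G Kᶜ) (hGc : ContinuousOn G (interior K)ᶜ)
    {w : ℂ} (hw : Tendsto (fun z => z * G z) (cobounded ℂ) (𝓝 w)) :
    CI γ G 0 = 2 * Real.pi * I * w := by
  have h0 := D.s0pos
  have hmem : ∀ j t s, s ∈ Icc (-(s0/2)) 0 → par (γ j) t s ∈ (interior K)ᶜ := by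
    intro j t s hs
    rcases hs.2.lt_or_eq with h | h
    · exact fun h' => D.neg j t s h (by linarith [hs.1]) (interior_subset h')
    · subst h
      rw [par_zero]
      have : γ j t ∈ frontier K := by rw [← D.bd]; exact mem_iUnion.2 ⟨j, t, rfl⟩
      rw [D.comp.isClosed.frontier_eq] at this; exact this.2
  have hc : ContinuousOn (fun s => CI γ G s) (Icc (-(s0/2)) 0) := by
    unfold CI
    apply continuousOn_finsetSum
    intro j _
    apply param_cont isCompact_Icc
    refine ContinuousOn.mul ?_ ((D.sc j).dpar_cont.comp continuous_swap).continuousOn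
    exact hGc.comp ((D.sc j).par_cont.comp continuous_swap).continuousOn (fun p hp => hmem j p.2 p.1 hp.1)
  have h1 : Tendsto (fun s => CI γ G s) (𝓝[Ico (-(s0/2)) 0] 0) (𝓝 (CI γ G 0)) :=
    (hc 0 ⟨by linarith, le_rfl⟩).mono_left (nhdsWithin_mono _ Ico_subset_Icc_self)
  have h2 : Tendsto (fun s => CI γ G s) (𝓝[Ico (-(s0/2)) 0] 0) (𝓝 (2 * Real.pi * I * w)) := by
    refine tendsto_const_nhds.congr' ?_
    filter_upwards [self_mem_nhdsWithin] with s hs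
    exact (D.outer D.comp.isClosed.isOpen_compl hG le_rfl (fun z hz _ => hz) hw (by linarith [hs.1]) hs.2).symm
  have : (𝓝[Ico (-(s0/2)) 0] (0:ℝ)).NeBot := by
    rw [nhdsWithin_Ico_eq_nhdsLT (by linarith : -(s0/2) < 0)]; infer_instance
  exact tendsto_nhds_unique h1 h2

lemma Dom.inner_bd (D : Dom K γ s0 c) {G : ℂ → ℂ} (hG : DifferentiableOn ℂ G (interior K)) (hGc : ContinuousOn G K) :
    CI γ G 0 = 0 := by
  have h0 := D.s0pos
  have hmem : ∀ j t s, s ∈ Icc 0 (s0/2) → par (γ j) t s ∈ K := by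
    intro j t s hs
    rcases hs.1.lt_or_eq with h | h
    · exact interior_subset (D.pos j t s h (by linarith [hs.2]))
    · subst h
      rw [par_zero]
      have : γ j t ∈ frontier K := by rw [← D.bd]; exact mem_iUnion.2 ⟨j, t, rfl⟩
      rw [D.comp.isClosed.frontier_eq] at this; exact this.1
  have hc : ContinuousOn (fun s => CI γ G s) (Icc 0 (s0/2)) := by
    unfold CI
    apply continuousOn_finsetSum
    intro j _
    apply param_cont isCompact_Icc
    refine ContinuousOn.mul ?_ ((D.sc j).dpar_cont.comp continuous_swap).continuousOn
    exact hGc.comp ((D.sc j).par_cont.comp continuous_swap).continuousOn (fun p hp => hmem j p.2 p.1 hp.1)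
  have h1 : Tendsto (fun s => CI γ G s) (𝓝[Ioc 0 (s0/2)] 0) (𝓝 (CI γ G 0)) :=
    (hc 0 ⟨le_rfl, by linarith⟩).mono_left (nhdsWithin_mono _ Ioc_subset_Icc_self)
  have h2 : Tendsto (fun s => CI γ G s) (𝓝[Ioc 0 (s0/2)] 0) (𝓝 0) := by
    refine tendsto_const_nhds.congr' ?_
    filter_upwards [self_mem_nhdsWithin] with s hs
    exact (D.inner hG hs.1 (by linarith [hs.2])).symm
  have : (𝓝[Ioc 0 (s0/2)] (0:ℝ)).NeBot := by
    rw [nhdsWithin_Ioc_eq_nhdsGT (by linarith : 0 < s0/2)]; infer_instance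
  exact tendsto_nhds_unique h1 h2

end

section skew
variable {X : Type*} [MeasurableSpace X] {μ : Measure X} [IsFiniteMeasure μ]

lemma skew_int {k : X → X → ℂ} (hk : Measurable (Function.uncurry k)) {C : ℝ} (hC : ∀ x y, ‖k x y‖ ≤ C)
    {f : X → ℂ} (hf : Integrable f μ) (x : X) : Integrable (fun y => k x y * f y) μ := by
  refine hf.bdd_mul (c := C) ?_ (Eventually.of_forall fun y => hC x y)
  exact (hk.comp measurable_prodMk_left).aestronglyMeasurable

lemma skew_meas {k : X → X → ℂ} (hk : Measurable (Function.uncurry k)) 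
    {f : X → ℂ} (hf : StronglyMeasurable f) : StronglyMeasurable (fun x => ∫ y, k x y * f y ∂μ) := by
  have : StronglyMeasurable (fun p : X × X => k p.1 p.2 * f p.2) :=
    hk.stronglyMeasurable.mul (hf.comp_measurable measurable_snd)
  exact this.integral_prod_right'

lemma skew_bd {k : X → X → ℂ} {C : ℝ} (hC : ∀ x y, ‖k x y‖ ≤ C)
    {f : X → ℂ} (hf : Integrable f μ) (x : X) : ‖∫ y, k x y * f y ∂μ‖ ≤ C * ∫ y, ‖f y‖ ∂μ := by
  rw [← integral_const_mul]
  refine norm_integral_le_of_norm_le (hf.norm.const_mul C) (Eventually.of_forall fun y => ?_)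
  rw [norm_mul]; exact mul_le_mul_of_nonneg_right (hC x y) (norm_nonneg _)

lemma skew_memLp {k : X → X → ℂ} (hk : Measurable (Function.uncurry k)) {C : ℝ} (hC : ∀ x y, ‖k x y‖ ≤ C)
    (f : Lp ℂ 2 μ) : MemLp (fun x => ∫ y, k x y * f y ∂μ) 2 μ := by
  have hf : Integrable f μ := (Lp.memLp f).integrable (by norm_num)
  exact MemLp.of_bound (skew_meas hk (Lp.stronglyMeasurable f)).aestronglyMeasurable _
    (Eventually.of_forall fun x => skew_bd hC hf x)

lemma skew_solve (k : X → X → ℂ) (hk : Measurable (Function.uncurry k)) {C : ℝ} (hC : ∀ x y, ‖k x y‖ ≤ C)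
    (hs : ∀ x y, k y x = - (starRingEnd ℂ) (k x y)) (g : X → ℂ) (hg : Measurable g) {G : ℝ}
    (hG : ∀ x, ‖g x‖ ≤ G) :
    ∃ u : X → ℂ, Measurable u ∧ (∃ U, ∀ x, ‖u x‖ ≤ U) ∧ ∀ x, u x + ∫ y, k x y * u y ∂μ = g x := by
  have hIntg : ∀ f : Lp ℂ 2 μ, Integrable f μ := fun f => (Lp.memLp f).integrable (by norm_num)
  let A0 : Lp ℂ 2 μ →ₗ[ℂ] Lp ℂ 2 μ :=
    { toFun := fun f => (skew_memLp hk hC f).toLp _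
      map_add' := by
        intro f f'
        rw [← MemLp.toLp_add]
        refine MemLp.toLp_congr _ _ (Eventually.of_forall fun x => ?_)
        simp only [Pi.add_apply]
        rw [← integral_add (skew_int hk hC (hIntg f) x) (skew_int hk hC (hIntg f') x)]
        refine integral_congr_ae ?_
        filter_upwards [Lp.coeFn_add f f'] with y hy
        rw [hy, Pi.add_apply]; ring
      map_smul' := by
        intro c f
        rw [RingHom.id_apply, ← MemLp.toLp_const_smul]
        refine MemLp.toLp_congr _ _ (Eventually.of_forall fun x => ?_)
        simp only [Pi.smul_apply, smul_eq_mul]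
        rw [← integral_const_mul]
        refine integral_congr_ae ?_
        filter_upwards [Lp.coeFn_smul c f] with y hy
        rw [hy, Pi.smul_apply, smul_eq_mul]; ring }
  have hA0 : ∀ f, A0 f =ᵐ[μ] fun x => ∫ y, k x y * f y ∂μ := fun f => MemLp.coeFn_toLp (skew_memLp hk hC f)
  obtain ⟨D, hD0, hD⟩ : ∃ D : ℝ, 0 ≤ D ∧ ∀ f : Lp ℂ 2 μ, ∫ y, ‖f y‖ ∂μ ≤ D * ‖f‖ := by
    refine ⟨(μ univ ^ (1 / 2 : ℝ)).toReal, by positivity, fun f => ?_⟩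
    have h1 : eLpNorm f 1 μ ≤ eLpNorm f 2 μ * μ univ ^ (1 / (1:ENNReal).toReal - 1 / (2:ENNReal).toReal) :=
      eLpNorm_le_eLpNorm_mul_rpow_measure_univ (by norm_num) (Lp.aestronglyMeasurable f)
    rw [eLpNorm_one_eq_lintegral_enorm] at h1
    rw [integral_norm_eq_lintegral_enorm (Lp.aestronglyMeasurable f), Lp.norm_def, ← ENNReal.toReal_mul]
    refine ENNReal.toReal_mono ?_ ?_
    · refine ENNReal.mul_ne_top ?_ (Lp.eLpNorm_ne_top f)
      exact (ENNReal.rpow_lt_top_of_nonneg (by norm_num) (measure_ne_top _ _)).ne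
    · rw [mul_comm]; convert h1 using 3; norm_num
  have hC' : 0 ≤ |C| := abs_nonneg _
  obtain ⟨E, hE⟩ : ∃ E : ℝ, ∀ f, ‖A0 f‖ ≤ E * ‖f‖ := by
    refine ⟨(μ univ).toReal ^ ((2:ENNReal).toReal⁻¹) * (|C| * D), fun f => ?_⟩
    show ‖(skew_memLp hk hC f).toLp _‖ ≤ _
    rw [Lp.norm_toLp]
    have := eLpNorm_le_of_ae_bound (p := 2) (μ := μ) (f := fun x => ∫ y, k x y * f y ∂μ) (C := |C| * D * ‖f‖)
      (Eventually.of_forall fun x => (skew_bd (C := |C|) (fun x y => (hC x y).trans (le_abs_self _)) (hIntg f) x).trans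
        (by rw [mul_assoc]; exact mul_le_mul_of_nonneg_left (hD f) hC'))
    refine (ENNReal.toReal_mono ?_ this).trans ?_
    · refine ENNReal.mul_ne_top ?_ ENNReal.ofReal_ne_top
      exact (ENNReal.rpow_lt_top_of_nonneg (by norm_num) (measure_ne_top _ _)).ne
    · rw [ENNReal.toReal_mul, ENNReal.toReal_ofReal (by positivity), ENNReal.toReal_rpow]
      apply le_of_eq; ring
  let A : Lp ℂ 2 μ →L[ℂ] Lp ℂ 2 μ := A0.mkContinuous E hE
  have hAf : ∀ f, A f =ᵐ[μ] fun x => ∫ y, k x y * f y ∂μ := hA0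
  have hskew : ∀ f f' : Lp ℂ 2 μ, inner ℂ (A f) f' = - inner ℂ f (A f') := by
    intro f f'
    rw [L2.inner_def, L2.inner_def, ← integral_neg]
    have e1 : ∫ x, inner ℂ (A f x) (f' x) ∂μ
        = ∫ x, ∫ y, f' x * ((starRingEnd ℂ) (k x y) * (starRingEnd ℂ) (f y)) ∂μ ∂μ := by
      refine integral_congr_ae ?_
      filter_upwards [hAf f] with x hx
      rw [hx, RCLike.inner_apply, ← integral_conj, ← integral_const_mul]
      simp only [map_mul]
    have e2 : ∫ x, -inner ℂ (f x) (A f' x) ∂μ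
        = ∫ y, ∫ x, f' x * ((starRingEnd ℂ) (k x y) * (starRingEnd ℂ) (f y)) ∂μ ∂μ := by
      refine integral_congr_ae ?_
      filter_upwards [hAf f'] with y hy
      rw [hy, RCLike.inner_apply, ← integral_mul_const, ← integral_neg]
      refine integral_congr_ae (Eventually.of_forall fun x => ?_)
      simp only
      rw [hs x y]; ring
    rw [e1, e2]
    refine integral_integral_swap ?_
    have h1 : Integrable (fun p : X × X => f' p.1 * (starRingEnd ℂ) (f p.2)) (μ.prod μ) := by
      refine (hIntg f').mul_prod (f := fun x => f' x) (g := fun y => (starRingEnd ℂ) (f y)) ?_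
      exact (LinearIsometryEquiv.integrable_comp_iff (Complex.conjLIE)).2 (hIntg f)
    have h2 := h1.bdd_mul (c := C) (f := fun p : X × X => (starRingEnd ℂ) (k p.1 p.2))
      (Complex.continuous_conj.measurable.comp hk).aestronglyMeasurable
      (Eventually.of_forall fun p => by rw [RCLike.norm_conj]; exact hC _ _)
    refine h2.congr (Eventually.of_forall fun p => ?_)
    simp only [Function.uncurry]; ring
  have hsa : IsSelfAdjoint (Complex.I • A) := by
    rw [ContinuousLinearMap.isSelfAdjoint_iff_isSymmetric]
    intro f f'
    show inner ℂ (Complex.I • A f) f' = inner ℂ f (Complex.I • A f')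
    rw [inner_smul_left, inner_smul_right, hskew]; simp
  have hu : IsUnit (1 + A) := by
    have hns : -Complex.I ∉ spectrum ℂ (Complex.I • A) := by
      intro hmem
      have := hsa.im_eq_zero_of_mem_spectrum hmem
      simp at this
    rw [spectrum.notMem_iff] at hns
    have e : algebraMap ℂ (Lp ℂ 2 μ →L[ℂ] Lp ℂ 2 μ) (-Complex.I) - Complex.I • A = (-Complex.I) • (1 + A) := by
      rw [Algebra.algebraMap_eq_smul_one, smul_add]
      simp [sub_eq_add_neg]
    rw [e] at hns
    have := hns.smul (Units.mk0 Complex.I I_ne_zero)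
    rw [Units.smul_mk0, smul_smul] at this
    simpa using this
  obtain ⟨R, hR⟩ := hu
  have hgm : MemLp g 2 μ := MemLp.of_bound hg.aestronglyMeasurable G (Eventually.of_forall hG)
  let v : Lp ℂ 2 μ := (↑R⁻¹ : Lp ℂ 2 μ →L[ℂ] Lp ℂ 2 μ) hgm.toLp
  have hv : v + A v = hgm.toLp := by
    have : (↑R * ↑R⁻¹ : Lp ℂ 2 μ →L[ℂ] Lp ℂ 2 μ) hgm.toLp = hgm.toLp := by
      rw [Units.mul_inv]; rfl
    rw [hR] at this
    exact this
  have hva : ∀ᵐ x ∂μ, g x - ∫ y, k x y * v y ∂μ = v x := by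
    have h1 : (v + A v : Lp ℂ 2 μ) =ᵐ[μ] g := by rw [hv]; exact hgm.coeFn_toLp
    filter_upwards [h1, Lp.coeFn_add v (A v), hAf v] with x h1 h2 h3
    rw [← h3, ← h1, h2, Pi.add_apply]; ring
  refine ⟨fun x => g x - ∫ y, k x y * v y ∂μ, ?_, ?_, ?_⟩
  · exact hg.sub (skew_meas hk (Lp.stronglyMeasurable v)).measurable
  · exact ⟨G + C * ∫ y, ‖v y‖ ∂μ, fun x => (norm_sub_le _ _).trans (add_le_add (hG x) (skew_bd hC (hIntg v) x))⟩
  · intro x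
    have : ∫ y, k x y * (g y - ∫ z, k y z * v z ∂μ) ∂μ = ∫ y, k x y * v y ∂μ := by
      refine integral_congr_ae ?_
      filter_upwards [hva] with y hy
      rw [hy]
    simp only [this]; ring
end skew

def BL (R : ℝ → ℝ → Prop) (f : ℝ → ℝ → ℂ) : Prop :=
  ∃ B, 0 ≤ B ∧ (∀ t τ, R t τ → ‖f t τ‖ ≤ B) ∧
    ∀ t t' τ, R t τ → R t' τ → ‖f t τ - f t' τ‖ ≤ B * |t - t'|

namespace BL
variable {R : ℝ → ℝ → Prop} {f g : ℝ → ℝ → ℂ}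

lemma mk2 {B B' : ℝ} (h1 : ∀ t τ, R t τ → ‖f t τ‖ ≤ B)
    (h2 : ∀ t t' τ, R t τ → R t' τ → ‖f t τ - f t' τ‖ ≤ B' * |t - t'|) : BL R f := by
  refine ⟨|B| + |B'|, by positivity, fun t τ h => (h1 t τ h).trans ?_, fun t t' τ h h' => (h2 t t' τ h h').trans ?_⟩
  · linarith [le_abs_self B, abs_nonneg B']
  · gcongr; linarith [le_abs_self B', abs_nonneg B]

lemma sub (hf : BL R f) (hg : BL R g) : BL R (fun t τ => f t τ - g t τ) := by
  obtain ⟨B, hB, h1, h2⟩ := hf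
  obtain ⟨B', hB', h1', h2'⟩ := hg
  refine mk2 (B := B + B') (B' := B + B') (fun t τ h => (norm_sub_le _ _).trans (add_le_add (h1 t τ h) (h1' t τ h))) ?_
  intro t t' τ h h'
  have e : f t τ - g t τ - (f t' τ - g t' τ) = (f t τ - f t' τ) - (g t τ - g t' τ) := by ring
  rw [e, add_mul]
  exact (norm_sub_le _ _).trans (add_le_add (h2 _ _ _ h h') (h2' _ _ _ h h'))

lemma mul (hf : BL R f) (hg : BL R g) : BL R (fun t τ => f t τ * g t τ) := by
  obtain ⟨B, hB, h1, h2⟩ := hf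
  obtain ⟨B', hB', h1', h2'⟩ := hg
  refine mk2 (B := B * B') (B' := B * B' + B * B') ?_ ?_
  · intro t τ h
    rw [norm_mul]; exact mul_le_mul (h1 t τ h) (h1' t τ h) (norm_nonneg _) hB
  intro t t' τ h h'
  have e : f t τ * g t τ - f t' τ * g t' τ = f t τ * (g t τ - g t' τ) + (f t τ - f t' τ) * g t' τ := by ring
  rw [e]
  refine (norm_add_le _ _).trans ?_
  rw [norm_mul, norm_mul]
  have a := mul_le_mul (h1 t τ h) (h2' _ _ _ h h') (norm_nonneg _) hB
  have b := mul_le_mul (h2 _ _ _ h h') (h1' t' τ h') (norm_nonneg _) (by positivity)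
  nlinarith

lemma conj (hf : BL R f) : BL R (fun t τ => (starRingEnd ℂ) (f t τ)) := by
  obtain ⟨B, hB, h1, h2⟩ := hf
  refine ⟨B, hB, fun t τ h => by rw [RCLike.norm_conj]; exact h1 t τ h, fun t t' τ h h' => ?_⟩
  rw [← map_sub, RCLike.norm_conj]; exact h2 _ _ _ h h'

lemma inv (hf : BL R f) {c : ℝ} (hc : 0 < c) (hl : ∀ t τ, R t τ → c ≤ ‖f t τ‖) :
    BL R (fun t τ => (f t τ)⁻¹) := by
  obtain ⟨B, hB, h1, h2⟩ := hf
  refine mk2 (B := c⁻¹) (B' := B * c⁻¹ ^ 2) ?_ ?_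
  · intro t τ h
    rw [norm_inv]; exact inv_anti₀ hc (hl t τ h)
  intro t t' τ h h'
  have n1 : f t τ ≠ 0 := norm_pos_iff.1 (hc.trans_le (hl t τ h))
  have n2 : f t' τ ≠ 0 := norm_pos_iff.1 (hc.trans_le (hl t' τ h'))
  have e : (f t τ)⁻¹ - (f t' τ)⁻¹ = -(f t τ - f t' τ) * ((f t τ)⁻¹ * (f t' τ)⁻¹) := by
    field_simp; ring
  rw [e, norm_mul, norm_neg, norm_mul, norm_inv, norm_inv]
  have i1 := inv_anti₀ hc (hl t τ h)
  have i2 := inv_anti₀ hc (hl t' τ h')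
  have := mul_le_mul (h2 t t' τ h h') (mul_le_mul i1 i2 (by positivity) (by positivity)) (by positivity)
    (by positivity)
  refine this.trans (le_of_eq (by ring))

lemma congr (hf : BL R f) (h : ∀ t τ, R t τ → g t τ = f t τ) : BL R g := by
  obtain ⟨B, hB, h1, h2⟩ := hf
  refine ⟨B, hB, fun t τ hr => by rw [h t τ hr]; exact h1 t τ hr, fun t t' τ hr hr' => ?_⟩
  rw [h t τ hr, h t' τ hr']; exact h2 _ _ _ hr hr'
end BL

/-- unit tangent -/
def tg (γ : ℝ → ℂ) (t : ℝ) : ℂ := deriv γ t / (‖deriv γ t‖ : ℂ)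

lemma SC.tg_smooth {γ : ℝ → ℂ} (h : SC γ) : ContDiff ℝ 2 (tg γ) := by
  have h1 : ContDiff ℝ 2 (deriv γ) := contDiff_infty.1 h.smooth1 2
  have h2 : ContDiff ℝ 2 (fun t => (‖deriv γ t‖)⁻¹) :=
    (h1.norm ℝ h.reg).inv fun t => by simpa using h.reg t
  have h3 := h2.smul h1
  have e : tg γ = (fun t => (‖deriv γ t‖)⁻¹) • deriv γ := by
    ext t
    rw [tg, Pi.smul_apply', Complex.real_smul, div_eq_mul_inv, mul_comm]; push_cast; rfl
  rw [e]; exact h3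

lemma SC.tg_cont {γ : ℝ → ℂ} (h : SC γ) : Continuous (tg γ) := h.tg_smooth.continuous

lemma SC.tg_per {γ : ℝ → ℂ} (h : SC γ) : Function.Periodic (tg γ) 1 := fun t => by
  simp only [tg, h.per1 t]

lemma SC.tg_norm {γ : ℝ → ℂ} (h : SC γ) (t : ℝ) : ‖tg γ t‖ = 1 := by
  have := h.reg t
  rw [tg, norm_div, Complex.norm_real, norm_norm, div_self (by simpa using this)]

lemma SC.tg_conj {γ : ℝ → ℂ} (h : SC γ) (t : ℝ) : (starRingEnd ℂ) (tg γ t) * tg γ t = 1 := by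
  rw [mul_comm, Complex.mul_conj, Complex.normSq_eq_norm_sq, h.tg_norm]; simp

lemma SC.tg_eq {γ : ℝ → ℂ} (h : SC γ) (t : ℝ) : deriv γ t = tg γ t * (‖deriv γ t‖ : ℂ) := by
  have := h.reg t
  rw [tg, div_mul_cancel₀]; simpa using this

lemma SC.tg_eq' {γ : ℝ → ℂ} (h : SC γ) (t : ℝ) : (‖deriv γ t‖ : ℂ) = tg γ t * (starRingEnd ℂ) (deriv γ t) := by
  have h1 := h.tg_conj t
  conv_rhs => rw [h.tg_eq t]
  rw [map_mul, Complex.conj_ofReal]; linear_combination -(‖deriv γ t‖ : ℂ) * h1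

/-- Kerzman-Stein kernel without the factor `1/(2 π i)`. -/
def ks (γ₁ γ₂ : ℝ → ℂ) (t τ : ℝ) : ℂ :=
  deriv γ₂ τ / (γ₂ τ - γ₁ t) -
    (starRingEnd ℂ) (tg γ₁ t) * (‖deriv γ₂ τ‖ : ℂ) / (starRingEnd ℂ) (γ₂ τ - γ₁ t)

lemma ks_diag {γ : ℝ → ℂ} (h : SC γ) : BL (fun t τ => |τ - t| ≤ 3/4 ∧ τ ≠ t) (ks γ γ) := by
  obtain ⟨c, hc, hlow⟩ := h.sl_low
  have hc1 : ContDiff ℝ 1 γ := h.smooth.of_le (by simp)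
  have hc2 : ContDiff ℝ 1 (deriv γ) := h.smooth1.of_le (by simp)
  have hc3 : ContDiff ℝ 1 (deriv (deriv γ)) := h.smooth2.of_le (by simp)
  obtain ⟨L1, -, hL1⟩ := per_lip h.per1 hc2
  obtain ⟨L2, -, hL2⟩ := per_lip h.per2 hc3
  obtain ⟨B1, -, hB1⟩ := per_bdd h.per1 h.cont1
  obtain ⟨B2, -, hB2⟩ := per_bdd h.per2 h.cont2
  have ht1 : ContDiff ℝ 1 (tg γ) := h.tg_smooth.of_le (by norm_num)
  have ht2 : ContDiff ℝ 1 (deriv (tg γ)) := by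
    have := h.tg_smooth
    rw [show (2 : WithTop ℕ∞) = 1 + 1 by norm_num, contDiff_succ_iff_deriv] at this
    exact this.2.2
  obtain ⟨L3, -, hL3⟩ := per_lip (per_deriv h.tg_per) ht2
  obtain ⟨B3, -, hB3⟩ := per_bdd (per_deriv h.tg_per) ht2.continuous
  obtain ⟨L4, -, hL4⟩ := per_lip h.tg_per ht1
  let R : ℝ → ℝ → Prop := fun t τ => |τ - t| ≤ 3/4 ∧ τ ≠ t
  have bΔ : BL R (fun t τ => sl (deriv γ) t τ) :=
    BL.mk2 (B := B1) (B' := L1) (fun t τ _ => sl_bdd hB1 t τ) (fun t t' τ _ _ => sl_lip h.cont1 hL1 t t' τ)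
  have bΔ2 : BL R (fun t τ => sl2 (deriv (deriv γ)) t τ) :=
    BL.mk2 (B := B2) (B' := L2) (fun t τ _ => sl2_bdd hB2 t τ) (fun t t' τ _ _ => sl2_lip h.cont2 hL2 t t' τ)
  have bS : BL R (fun t τ => sl (deriv (tg γ)) t τ) :=
    BL.mk2 (B := B3) (B' := L3) (fun t τ _ => sl_bdd hB3 t τ) (fun t t' τ _ _ => sl_lip ht2.continuous hL3 t t' τ)
  have bT : BL R (fun t _ => tg γ t) :=
    BL.mk2 (B := 1) (B' := L4) (fun t τ _ => (h.tg_norm t).le) (fun t t' τ _ _ => hL4 t t')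
  have bTτ : BL R (fun _ τ => tg γ τ) :=
    BL.mk2 (B := 1) (B' := 0) (fun t τ _ => (h.tg_norm τ).le) (fun t t' τ _ _ => by simp)
  have bQ := bΔ2.mul (bΔ.inv hc (fun t τ hr => hlow t τ hr.1))
  refine ((bQ.sub (bT.conj.mul bS)).sub ((bT.conj.mul bTτ).mul bQ.conj)).congr ?_
  rintro t τ ⟨h1, h2⟩
  have e1 := sl_eq hc1 t τ
  have e2 := sl2_eq hc2 t τ
  have e3 := sl_eq ht1 t τ
  have hΔ0 : sl (deriv γ) t τ ≠ 0 := norm_pos_iff.1 (hc.trans_le (hlow t τ h1))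
  have hh : ((τ - t : ℝ) : ℂ) ≠ 0 := by
    rw [Complex.ofReal_ne_zero]; exact sub_ne_zero.2 h2
  have e4 := h.tg_eq' τ
  have e5 := h.tg_conj t
  unfold ks
  rw [e4, e1, e2]
  generalize hX : sl (deriv γ) t τ = X at *
  generalize sl2 (deriv (deriv γ)) t τ = Y at *
  generalize sl (deriv (tg γ)) t τ = S at *
  have e3' : tg γ τ = tg γ t + ((τ - t : ℝ) : ℂ) * S := by rw [← e3]; ring
  rw [e3']
  have hcX : (starRingEnd ℂ) X ≠ 0 := by simpa using hΔ0
  simp only [map_add, map_mul, map_inv₀, Complex.conj_ofReal]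
  generalize ((τ - t : ℝ) : ℂ) = d at *
  generalize (starRingEnd ℂ) X = X' at *
  generalize (starRingEnd ℂ) Y = Y' at *
  generalize (starRingEnd ℂ) (tg γ t) = T' at *
  generalize tg γ t = T at *
  field_simp
  have : T' * (T + d * S) = 1 + d * T' * S := by linear_combination e5
  linear_combination (-X * (X' + d * Y') + X * d * Y') * e5

lemma ks_off {γ₁ γ₂ : ℝ → ℂ} (h₁ : SC γ₁) (h₂ : SC γ₂) {c : ℝ} (hc : 0 < c)
    (far : ∀ t τ, c ≤ ‖γ₂ τ - γ₁ t‖) : BL (fun _ _ => True) (ks γ₁ γ₂) := by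
  obtain ⟨B1, -, hB1⟩ := per_bdd h₂.per1 h₂.cont1
  obtain ⟨B2, -, hB2⟩ := per_bdd h₁.per h₁.cont
  obtain ⟨B3, -, hB3⟩ := per_bdd h₂.per h₂.cont
  obtain ⟨L, -, hL⟩ := per_lip h₁.per (h₁.smooth.of_le (by simp))
  obtain ⟨L4, -, hL4⟩ := per_lip h₁.tg_per (h₁.tg_smooth.of_le (by norm_num))
  let R : ℝ → ℝ → Prop := fun _ _ => True
  have bd : BL R (fun t τ => γ₂ τ - γ₁ t) :=
    BL.mk2 (B := B3 + B2) (B' := L) (fun t τ _ => (norm_sub_le _ _).trans (add_le_add (hB3 τ) (hB2 t)))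
      (fun t t' τ _ _ => by rw [sub_sub_sub_cancel_left, norm_sub_rev]; exact hL t t')
  have bi := bd.inv hc (fun t τ _ => far t τ)
  have bT : BL R (fun t _ => tg γ₁ t) :=
    BL.mk2 (B := 1) (B' := L4) (fun t τ _ => (h₁.tg_norm t).le) (fun t t' τ _ _ => hL4 t t')
  have bg : BL R (fun _ τ => deriv γ₂ τ) :=
    BL.mk2 (B := B1) (B' := 0) (fun t τ _ => hB1 τ) (fun t t' τ _ _ => by simp)
  have bn : BL R (fun _ τ => (‖deriv γ₂ τ‖ : ℂ)) :=
    BL.mk2 (B := B1) (B' := 0) (fun t τ _ => by simpa using hB1 τ) (fun t t' τ _ _ => by simp)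
  refine ((bg.mul bi).sub ((bT.conj.mul bn).mul bi.conj)).congr ?_
  intro t τ _
  unfold ks
  rw [div_eq_mul_inv, div_eq_mul_inv, map_inv₀]

lemma bdd_ii {f : ℝ → ℂ} (hm : Measurable f) {B : ℝ} (hb : ∀ t, ‖f t‖ ≤ B) (a b : ℝ) :
    IntervalIntegrable f volume a b := by
  refine (intervalIntegrable_const (c := B)).mono_fun hm.aestronglyMeasurable ?_
  exact Eventually.of_forall fun t => (hb t).trans (le_abs_self B)

lemma ker_lip {f : ℝ → ℝ → ℂ} (hf : BL (fun t τ => |τ - t| ≤ 3/4 ∧ τ ≠ t) f)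
    (hp : ∀ t, Function.Periodic (f t) 1) (hm : ∀ t, Measurable (f t)) {B : ℝ} (hb : ∀ t τ, ‖f t τ‖ ≤ B)
    {w : ℝ → ℂ} (hw : Measurable w) (hwp : Function.Periodic w 1) {U : ℝ} (hU : ∀ t, ‖w t‖ ≤ U) :
    ∃ L, 0 ≤ L ∧ ∀ t t', |t - t'| ≤ 1/4 →
      ‖(∫ τ in (0:ℝ)..1, f t τ * w τ) - ∫ τ in (0:ℝ)..1, f t' τ * w τ‖ ≤ L * |t - t'| := by
  obtain ⟨A, hA, -, h2⟩ := hf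
  have hU0 : 0 ≤ U := (norm_nonneg _).trans (hU 0)
  refine ⟨A * U, by positivity, fun t t' htt => ?_⟩
  have hi : ∀ t a b, IntervalIntegrable (fun τ => f t τ * w τ) volume a b := fun t a b =>
    bdd_ii ((hm t).mul hw) (B := B * U) (fun τ => by
      rw [Pi.mul_apply, norm_mul]; exact mul_le_mul (hb _ _) (hU _) (norm_nonneg _) ((norm_nonneg _).trans (hb t τ))) a b
  rw [← intervalIntegral.integral_sub (hi _ _ _) (hi _ _ _)]
  have hper : Function.Periodic (fun τ => f t τ * w τ - f t' τ * w τ) 1 := fun τ => by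
    simp only [hp t τ, hp t' τ, hwp τ]
  have := hper.intervalIntegral_add_eq 0 (t - 1/2)
  rw [zero_add] at this
  rw [this]
  have e : A * U * |t - t'| = A * U * |t - t'| * |t - 1/2 + 1 - (t - 1/2)| := by
    rw [show t - 1/2 + 1 - (t - 1/2) = 1 by ring]; simp
  rw [e]
  refine intervalIntegral.norm_integral_le_of_norm_le_const_ae ?_
  have n1 : ∀ᵐ τ : ℝ, τ ≠ t := by simp [ae_iff, measure_singleton]
  have n2 : ∀ᵐ τ : ℝ, τ ≠ t' := by simp [ae_iff, measure_singleton]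
  filter_upwards [n1, n2] with τ h1 h2' hτ
  rw [uIoc_of_le (by linarith)] at hτ
  have a1 : |τ - t| ≤ 3/4 := by rw [abs_le]; constructor <;> linarith [hτ.1, hτ.2]
  have a2 : |τ - t'| ≤ 3/4 := by
    rw [abs_le] at htt ⊢; constructor <;> linarith [hτ.1, hτ.2, htt.1, htt.2]
  rw [← sub_mul, norm_mul]
  calc _ ≤ (A * |t - t'|) * U := mul_le_mul (h2 t t' τ ⟨a1, h1⟩ ⟨a2, h2'⟩) (hU τ) (norm_nonneg _) (by positivity)
    _ = _ := by ring

lemma lip_glob {f : ℝ → ℂ} {L U : ℝ} (hL : 0 ≤ L) (hU : ∀ t, ‖f t‖ ≤ U)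
    (h : ∀ t t', |t - t'| ≤ 1/4 → ‖f t - f t'‖ ≤ L * |t - t'|) (t t' : ℝ) :
    ‖f t - f t'‖ ≤ (L + 8 * U) * |t - t'| := by
  have hU0 : 0 ≤ U := (norm_nonneg _).trans (hU 0)
  rcases le_total |t - t'| (1/4) with h1 | h1
  · refine (h t t' h1).trans ?_
    gcongr; linarith
  · have := (norm_sub_le (f t) (f t')).trans (add_le_add (hU t) (hU t'))
    nlinarith [mul_nonneg hL (abs_nonneg (t - t'))]

section sol
variable {n : ℕ} {γ : Fin n → ℝ → ℂ} {s0 c : ℝ}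

lemma ks_per {γ₁ γ₂ : ℝ → ℂ} (h₂ : SC γ₂) (t : ℝ) : Function.Periodic (ks γ₁ γ₂ t) 1 := fun τ => by
  simp only [ks, h₂.per τ, h₂.per1 τ]

lemma ks_per' {γ₁ γ₂ : ℝ → ℂ} (h₁ : SC γ₁) (τ : ℝ) : Function.Periodic (fun t => ks γ₁ γ₂ t τ) 1 := fun t => by
  simp only [ks, h₁.per t, h₁.tg_per t]

lemma ks_meas {γ₁ γ₂ : ℝ → ℂ} (h₂ : SC γ₂) (t : ℝ) : Measurable (ks γ₁ γ₂ t) := by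
  have h := h₂.cont.measurable
  have h1 := h₂.cont1.measurable
  have h3 : Measurable fun τ => (starRingEnd ℂ) (γ₂ τ - γ₁ t) :=
    Complex.continuous_conj.measurable.comp (h.sub_const _)
  unfold ks
  exact (h1.div (h.sub_const _)).sub (((Complex.measurable_ofReal.comp h1.norm).const_mul _).div h3)

lemma Fam.ks_BL (F : Fam γ s0 c) (i j : Fin n) : BL (fun t τ => |τ - t| ≤ 3/4 ∧ τ ≠ t) (ks (γ i) (γ j)) := by
  by_cases e : i = j
  · subst e; exact ks_diag (F.sc i)
  · have hs : |(0:ℝ)| ≤ s0 := by simpa using F.s0pos.le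
    obtain ⟨B, hB, h1, h2⟩ := ks_off (F.sc i) (F.sc j) F.cpos (fun t τ => by
      simpa using F.far i j e t τ 0 0 hs hs)
    exact ⟨B, hB, fun t τ _ => h1 t τ trivial, fun t t' τ _ _ => h2 t t' τ trivial trivial⟩

lemma Fam.ks_bdd (F : Fam γ s0 c) : ∃ B, 0 ≤ B ∧ ∀ i j t τ, ‖ks (γ i) (γ j) t τ‖ ≤ B := by
  have h : ∀ i j, ∃ B, 0 ≤ B ∧ ∀ t τ, ‖ks (γ i) (γ j) t τ‖ ≤ B := by
    intro i j
    obtain ⟨B, hB, h1, h2⟩ := F.ks_BL i j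
    by_cases e : i = j
    swap
    · have hs : |(0:ℝ)| ≤ s0 := by simpa using F.s0pos.le
      obtain ⟨B, hB, h1, h2⟩ := ks_off (F.sc i) (F.sc j) F.cpos (fun t τ => by
        simpa using F.far i j e t τ 0 0 hs hs)
      exact ⟨B, hB, fun t τ => h1 t τ trivial⟩
    refine ⟨B, hB, fun t τ => ?_⟩
    obtain ⟨k, hk⟩ := round_shift t τ
    rw [← per_int (ks_per (F.sc j) t) τ k]
    by_cases e2 : τ + k = t
    · rw [e2, e]; simp [ks, hB]
    · exact h1 _ _ ⟨by linarith, e2⟩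
  choose B hB hb using h
  refine ⟨∑ i, ∑ j, B i j, Finset.sum_nonneg fun i _ => Finset.sum_nonneg fun j _ => hB i j, fun i j t τ => ?_⟩
  refine (hb i j t τ).trans ((Finset.single_le_sum (f := fun j => B i j) (fun j _ => hB i j) (Finset.mem_univ j)).trans ?_)
  exact Finset.single_le_sum (f := fun i => ∑ j, B i j) (fun i _ => Finset.sum_nonneg fun j _ => hB i j) (Finset.mem_univ i)

lemma ks_skew {γ₁ γ₂ : ℝ → ℂ} (h₁ : SC γ₁) (h₂ : SC γ₂) (t τ : ℝ) :
    ks γ₂ γ₁ τ t * (‖deriv γ₂ τ‖ : ℂ) = (starRingEnd ℂ) (ks γ₁ γ₂ t τ) * (‖deriv γ₁ t‖ : ℂ) := by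
  unfold ks
  rw [h₁.tg_eq t, h₂.tg_eq τ]
  simp only [map_sub, map_mul, map_div₀, Complex.conj_ofReal, Complex.conj_conj, norm_mul, h₁.tg_norm, h₂.tg_norm,
    one_mul, Complex.norm_real, norm_norm]
  by_cases e : γ₂ τ - γ₁ t = 0
  · have e' : γ₁ t - γ₂ τ = 0 := by linear_combination -e
    have e1 : (starRingEnd ℂ) (γ₂ τ) - (starRingEnd ℂ) (γ₁ t) = 0 := by rw [← map_sub, e, map_zero]
    have e2 : (starRingEnd ℂ) (γ₁ t) - (starRingEnd ℂ) (γ₂ τ) = 0 := by rw [← map_sub, e', map_zero]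
    rw [e, e', e1, e2]; simp
  · have e1 : (starRingEnd ℂ) (γ₂ τ) - (starRingEnd ℂ) (γ₁ t) ≠ 0 := by
      rw [← map_sub]; exact (map_ne_zero _).2 e
    have f1 : γ₁ t - γ₂ τ = -(γ₂ τ - γ₁ t) := by ring
    have f2 : (starRingEnd ℂ) (γ₁ t) - (starRingEnd ℂ) (γ₂ τ) = -((starRingEnd ℂ) (γ₂ τ) - (starRingEnd ℂ) (γ₁ t)) := by
      ring
    rw [f1, f2]
    generalize γ₂ τ - γ₁ t = d at *
    generalize (starRingEnd ℂ) (γ₂ τ) - (starRingEnd ℂ) (γ₁ t) = d' at *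
    field_simp
    ring

lemma Fam.ks_solution (F : Fam γ s0 c) : ∃ u : Fin n → ℝ → ℂ, (∀ i, Function.Periodic (u i) 1) ∧
    (∃ L, 0 ≤ L ∧ ∀ i t t', ‖u i t - u i t'‖ ≤ L * |t - t'|) ∧
    ∀ i t, u i t + (2 * Real.pi * I)⁻¹ * ∑ j, ∫ τ in (0:ℝ)..1, ks (γ i) (γ j) t τ * u j τ
      = I * (starRingEnd ℂ) (tg (γ i) t) := by
  obtain ⟨B, hB, hb⟩ := F.ks_bdd
  have hn : ∃ m M : ℝ, 0 < m ∧ ∀ i t, m ≤ ‖deriv (γ i) t‖ ∧ ‖deriv (γ i) t‖ ≤ M := by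
    have h1 : ∀ i, ∃ a, 0 < a ∧ ∀ t, a ≤ ‖deriv (γ i) t‖ := fun i =>
      per_low (F.sc i).per1 (F.sc i).cont1 (F.sc i).reg
    obtain ⟨m, hm, hm'⟩ := finite_min h1 (fun i a b _ hba h t => hba.trans (h t))
    have h2 : ∀ i, ∃ C, 0 < C ∧ ∀ t, ‖deriv (γ i) t‖ ≤ C := fun i => per_bdd (F.sc i).per1 (F.sc i).cont1
    choose C hC hC' using h2
    refine ⟨m, ∑ i, C i, hm, fun i t => ⟨hm' i t, (hC' i t).trans ?_⟩⟩
    exact Finset.single_le_sum (f := C) (fun i _ => (hC i).le) (Finset.mem_univ i)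
  obtain ⟨m, M, hm, hmM⟩ := hn
  let X := Fin n × ℝ
  let μ : Measure X := (Measure.count : Measure (Fin n)).prod (volume.restrict (Ioc (0:ℝ) 1))
  let N : X → ℝ := fun x => Real.sqrt ‖deriv (γ x.1) x.2‖
  have hNpos : ∀ x, 0 < N x := fun x => Real.sqrt_pos.2 (hm.trans_le (hmM _ _).1)
  have hNm : ∀ x, Real.sqrt m ≤ N x := fun x => Real.sqrt_le_sqrt (hmM _ _).1
  have hNM : ∀ x, N x ≤ Real.sqrt M := fun x => Real.sqrt_le_sqrt (hmM _ _).2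
  have hNsq : ∀ x, N x * N x = ‖deriv (γ x.1) x.2‖ := fun x => Real.mul_self_sqrt (norm_nonneg _)
  have hsm : 0 < Real.sqrt m := Real.sqrt_pos.2 hm
  let k : X → X → ℂ := fun x y => (2 * Real.pi * I)⁻¹ * ((N x / N y : ℝ) : ℂ) * ks (γ x.1) (γ y.1) x.2 y.2
  have mm : ∀ f : Fin n → ℝ → ℂ, (∀ i, Continuous (f i)) → Measurable (fun x : X => f x.1 x.2) := fun f hf =>
    measurable_from_prod_countable_right fun i => (hf i).measurable
  have mg := mm γ fun i => (F.sc i).cont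
  have mg1 := mm (fun i => deriv (γ i)) fun i => (F.sc i).cont1
  have mt := mm (fun i => tg (γ i)) fun i => (F.sc i).tg_cont
  have mN : Measurable N := Real.continuous_sqrt.measurable.comp mg1.norm
  have mconj := Complex.continuous_conj.measurable
  have hk : Measurable (Function.uncurry k) := by
    have a1 : Measurable fun p : X × X => deriv (γ p.2.1) p.2.2 := mg1.comp measurable_snd
    have a2 : Measurable fun p : X × X => γ p.2.1 p.2.2 - γ p.1.1 p.1.2 :=
      (mg.comp measurable_snd).sub (mg.comp measurable_fst)
    have a3 : Measurable fun p : X × X => (starRingEnd ℂ) (γ p.2.1 p.2.2 - γ p.1.1 p.1.2) := mconj.comp a2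
    have a4 : Measurable fun p : X × X => (starRingEnd ℂ) (tg (γ p.1.1) p.1.2) :=
      mconj.comp (mt.comp measurable_fst)
    have a5 : Measurable fun p : X × X => ((N p.1 / N p.2 : ℝ) : ℂ) :=
      Complex.measurable_ofReal.comp ((mN.comp measurable_fst).div (mN.comp measurable_snd))
    have a6 : Measurable fun p : X × X => ((‖deriv (γ p.2.1) p.2.2‖ : ℝ) : ℂ) :=
      Complex.measurable_ofReal.comp a1.norm
    exact (a5.const_mul _).mul ((a1.div a2).sub ((a4.mul a6).div a3))
  have hkb : ∀ x y, ‖k x y‖ ≤ ‖(2 * Real.pi * I : ℂ)⁻¹‖ * (Real.sqrt M / Real.sqrt m) * B := by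
    intro x y
    simp only [k]
    rw [norm_mul, norm_mul, Complex.norm_real, Real.norm_of_nonneg (div_nonneg (hNpos x).le (hNpos y).le)]
    have : N x / N y ≤ Real.sqrt M / Real.sqrt m := div_le_div₀ (Real.sqrt_nonneg _) (hNM x) hsm (hNm y)
    have := hb x.1 y.1 x.2 y.2
    gcongr
  have hks : ∀ x y, k y x = - (starRingEnd ℂ) (k x y) := by
    intro x y
    have e := ks_skew (F.sc x.1) (F.sc y.1) x.2 y.2
    have hx : (N x : ℂ) ≠ 0 := by exact_mod_cast (hNpos x).ne'
    have hy : (N y : ℂ) ≠ 0 := by exact_mod_cast (hNpos y).ne'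
    rw [← hNsq x, ← hNsq y] at e
    simp only [k, map_mul, map_inv₀, Complex.conj_ofReal, Complex.conj_I, map_ofNat]
    push_cast at e ⊢
    have hpi : (Real.pi : ℂ) ≠ 0 := by exact_mod_cast Real.pi_ne_zero
    field_simp
    linear_combination e
  let g : X → ℂ := fun x => (N x : ℂ) * (I * (starRingEnd ℂ) (tg (γ x.1) x.2))
  have hg : Measurable g := (Complex.measurable_ofReal.comp mN).mul ((mconj.comp mt).const_mul I)
  obtain ⟨v, hv, ⟨U, hU⟩, hsol⟩ := skew_solve (μ := μ) k hk hkb hks g hg (G := Real.sqrt M) (fun x => by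
    simp only [g]
    rw [norm_mul, norm_mul, RCLike.norm_conj, (F.sc x.1).tg_norm, Complex.norm_real, Real.norm_of_nonneg (hNpos x).le]
    simpa using hNM x)
  let u : Fin n → ℝ → ℂ := fun i t => v (i, t) / (N (i, t) : ℂ)
  have huv : ∀ i t, v (i, t) = (N (i,t) : ℂ) * u i t := fun i t => by
    have hx : (N (i,t) : ℂ) ≠ 0 := by exact_mod_cast (hNpos (i,t)).ne'
    simp only [u]; field_simp
  have hum : ∀ i, Measurable (u i) := fun i =>
    (hv.comp measurable_prodMk_left).div (Complex.measurable_ofReal.comp (mN.comp measurable_prodMk_left))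
  have huU : ∀ i t, ‖u i t‖ ≤ U / Real.sqrt m := by
    intro i t
    simp only [u]
    rw [norm_div, Complex.norm_real, Real.norm_of_nonneg (hNpos _).le]
    exact div_le_div₀ ((norm_nonneg _).trans (hU (i,t))) (hU _) hsm (hNm _)
  have heq : ∀ i t, u i t + (2 * Real.pi * I)⁻¹ * ∑ j, ∫ τ in (0:ℝ)..1, ks (γ i) (γ j) t τ * u j τ
      = I * (starRingEnd ℂ) (tg (γ i) t) := by
    intro i t
    have e := hsol (i, t)
    have hx : (N (i,t) : ℂ) ≠ 0 := by exact_mod_cast (hNpos (i,t)).ne'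
    have hIntg : Integrable (fun y => k (i,t) y * v y) μ := by
      refine Integrable.of_bound (C := ‖(2 * Real.pi * I : ℂ)⁻¹‖ * (Real.sqrt M / Real.sqrt m) * B * U) ?_
        (Eventually.of_forall fun y => ?_)
      · exact ((hk.comp measurable_prodMk_left).mul hv).aestronglyMeasurable
      · rw [norm_mul]; exact mul_le_mul (hkb _ _) (hU y) (norm_nonneg _) ((norm_nonneg _).trans (hkb y y))
    rw [integral_prod _ hIntg, integral_count] at e
    have e3 : ∀ j, ∫ τ in Ioc (0:ℝ) 1, k (i,t) (j,τ) * v (j,τ) =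
        (N (i,t) : ℂ) * ((2 * Real.pi * I)⁻¹ * ∫ τ in (0:ℝ)..1, ks (γ i) (γ j) t τ * u j τ) := by
      intro j
      rw [intervalIntegral.integral_of_le zero_le_one, ← integral_const_mul, ← integral_const_mul]
      refine integral_congr_ae (Eventually.of_forall fun τ => ?_)
      have hy : (N (j,τ) : ℂ) ≠ 0 := by exact_mod_cast (hNpos (j,τ)).ne'
      simp only [k, u]
      push_cast
      field_simp
    simp only [e3] at e
    rw [← Finset.mul_sum, ← Finset.mul_sum, huv, ← mul_add] at e
    exact mul_left_cancel₀ hx e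
  have hper : ∀ i, Function.Periodic (u i) 1 := by
    intro i t
    have e1 := heq i t
    have e2 := heq i (t+1)
    rw [(F.sc i).tg_per t] at e2
    have e3 : ∀ j τ, ks (γ i) (γ j) (t+1) τ = ks (γ i) (γ j) t τ := fun j τ => ks_per' (F.sc i) τ t
    simp only [e3] at e2
    exact add_right_cancel (e2.trans e1.symm)
  refine ⟨u, hper, ?_, heq⟩
  have hl : ∀ i, ∃ L, 0 ≤ L ∧ ∀ t t', ‖u i t - u i t'‖ ≤ L * |t - t'| := by
    intro i
    have h1 : ∀ j, ∃ L, 0 ≤ L ∧ ∀ t t', |t - t'| ≤ 1/4 →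
      ‖(∫ τ in (0:ℝ)..1, ks (γ i) (γ j) t τ * u j τ) - ∫ τ in (0:ℝ)..1, ks (γ i) (γ j) t' τ * u j τ‖ ≤ L * |t - t'| :=
      fun j => ker_lip (F.ks_BL i j) (fun t => ks_per (F.sc j) t) (fun t => ks_meas (F.sc j) t)
        (hb i j) (hum j) (hper j) (huU j)
    choose L hL hLL using h1
    obtain ⟨L4, hL4, hL4'⟩ := per_lip (F.sc i).tg_per ((F.sc i).tg_smooth.of_le (by norm_num))
    have hU0 : 0 ≤ U / Real.sqrt m := (norm_nonneg _).trans (huU i 0)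
    refine ⟨(L4 + ‖(2 * Real.pi * I : ℂ)⁻¹‖ * ∑ j, L j) + 8 * (U / Real.sqrt m), ?_, lip_glob ?_ (huU i) ?_⟩
    · have := Finset.sum_nonneg fun j (_ : j ∈ Finset.univ) => hL j
      positivity
    · have := Finset.sum_nonneg fun j (_ : j ∈ Finset.univ) => hL j
      positivity
    · intro t t' htt
      have e : u i t - u i t' = I * (starRingEnd ℂ) (tg (γ i) t - tg (γ i) t') - (2 * Real.pi * I)⁻¹ *
        ∑ j, ((∫ τ in (0:ℝ)..1, ks (γ i) (γ j) t τ * u j τ) - ∫ τ in (0:ℝ)..1, ks (γ i) (γ j) t' τ * u j τ) := by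
        rw [Finset.sum_sub_distrib, map_sub]
        linear_combination heq i t - heq i t'
      rw [e]
      refine (norm_sub_le _ _).trans ?_
      rw [add_mul]
      refine add_le_add ?_ ?_
      · rw [norm_mul, RCLike.norm_conj]; simpa using hL4' t t'
      · rw [norm_mul, mul_assoc ‖_‖, Finset.sum_mul]
        gcongr
        exact norm_sum_le_of_le _ fun j _ => hLL j t t' htt
  choose L hL hLL using hl
  refine ⟨∑ i, L i, Finset.sum_nonneg fun i _ => hL i, fun i t t' => (hLL i t t').trans ?_⟩
  gcongr
  exact Finset.single_le_sum (f := L) (fun i _ => hL i) (Finset.mem_univ i)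
end sol

section halfw
variable {n : ℕ} {γ : Fin n → ℝ → ℂ} {s0 c : ℝ} {K : Set ℂ}

lemma window_shift {f : ℝ → ℂ} (hf : Function.Periodic f 1) (t : ℝ) :
    ∫ τ in (0:ℝ)..1, f τ = ∫ h in (-(1/2):ℝ)..(1/2), f (t + h) := by
  rw [intervalIntegral.integral_comp_add_left]
  have := hf.intervalIntegral_add_eq 0 (t + -(1/2))
  rw [zero_add] at this
  rw [this]; congr 1; ring

lemma ae_ne_zero : ∀ᵐ h : ℝ, h ≠ 0 := by simp [ae_iff, measure_singleton]

lemma mem_win {h : ℝ} (hh : h ∈ uIoc (-(1/2):ℝ) (1/2)) : |h| ≤ 1/2 := by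
  rw [uIoc_of_le (by norm_num)] at hh
  exact abs_le.2 ⟨hh.1.le, hh.2⟩

lemma Fam.near0 (F : Fam γ s0 c) (i : Fin n) {t h s : ℝ} (hh : |h| ≤ 1/2) (hs : |s| ≤ s0) :
    c * (|h| + |s|) ≤ ‖γ i (t + h) - par (γ i) t s‖ := by
  have := F.near i t (t + h) s 0 (by rw [add_sub_cancel_left]; linarith) hs (by simpa using F.s0pos.le)
  simpa using this

/-- the symmetrised kernel -/
def sym (γ : ℝ → ℂ) (t s h : ℝ) : ℂ :=
  (deriv γ (t + h) / (γ (t + h) - par γ t s) + deriv γ (t + h) / (γ (t + h) - par γ t (-s))) / 2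

lemma Fam.sym_bdd (F : Fam γ s0 c) (i : Fin n) : ∃ C, ∀ t s h, |s| ≤ s0 → |h| ≤ 1/2 → h ≠ 0 →
    |(sym (γ i) t s h).im| ≤ C := by
  have S := F.sc i
  have hc := F.cpos
  obtain ⟨B1, hB10, hB1⟩ := per_bdd S.per1 S.cont1
  obtain ⟨B2, hB20, hB2⟩ := per_bdd S.per2 S.cont2
  obtain ⟨L, hL0, hL⟩ := per_lip S.per1 (S.smooth1.of_le (by simp))
  refine ⟨(2 * L * (2 * B1)) * B1 ^ 2 / c ^ 4 + B1 * B2 / c ^ 2, fun t s h hs hh h0 => ?_⟩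
  have d1 := F.near0 i (t := t) hh hs
  have d2 := F.near0 i (t := t) (s := -s) hh (by rwa [abs_neg])
  rw [abs_neg] at d2
  have e1 := sl_eq (S.smooth.of_le (by simp) : ContDiff ℝ 1 (γ i)) t (t + h)
  have e2 := sl2_eq (S.smooth1.of_le (by simp) : ContDiff ℝ 1 (deriv (γ i))) t (t + h)
  have l1 := sl_lip S.cont1 hL t (t + h) (t + h)
  rw [sl_self, show t - (t + h) = -h by ring, abs_neg] at l1
  have l2 := hL (t + h) t
  rw [add_sub_cancel_left] at e1 e2 l2
  have b1 := sl_bdd hB1 t (t + h)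
  have b2 := sl2_bdd hB2 t (t + h)
  have b3 := hB1 t
  unfold sym
  have p1 : γ i (t + h) - par (γ i) t s = h * sl (deriv (γ i)) t (t + h) - I * s * deriv (γ i) t := by
    rw [← e1, par]; ring
  have p2 : γ i (t + h) - par (γ i) t (-s) = h * sl (deriv (γ i)) t (t + h) + I * s * deriv (γ i) t := by
    rw [← e1, par]; push_cast; ring
  rw [p1] at d1 ⊢
  rw [p2] at d2 ⊢
  have l3 : ‖sl (deriv (γ i)) t (t + h) - deriv (γ i) t‖ ≤ 2 * L * |h| := by
    have := norm_sub_le_norm_sub_add_norm_sub (sl (deriv (γ i)) t (t + h)) (deriv (γ i) (t + h)) (deriv (γ i) t)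
    linarith
  rw [e2]
  generalize sl (deriv (γ i)) t (t + h) = X at *
  generalize sl2 (deriv (deriv (γ i))) t (t + h) = Y at *
  generalize deriv (γ i) t = g at *
  have hpos : 0 < c * (|h| + |s|) := by have := abs_pos.2 h0; positivity
  have n1 : (h:ℂ) * X - I * s * g ≠ 0 := norm_pos_iff.1 (hpos.trans_le d1)
  have n2 : (h:ℂ) * X + I * s * g ≠ 0 := norm_pos_iff.1 (hpos.trans_le d2)
  set Q : ℂ := h ^ 2 * X ^ 2 + s ^ 2 * g ^ 2 with hQ
  have hQ' : Q = ((h:ℂ) * X - I * s * g) * ((h:ℂ) * X + I * s * g) := by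
    rw [hQ]; ring_nf; rw [I_sq]; ring
  have hQn : c ^ 2 * (h ^ 2 + s ^ 2) ≤ ‖Q‖ := by
    rw [hQ', norm_mul]
    have := mul_le_mul d1 d2 hpos.le (norm_nonneg _)
    refine le_trans ?_ this
    have a1 := sq_abs h
    have a2 := sq_abs s
    have : 0 ≤ c ^ 2 * (2 * (|h| * |s|)) := by positivity
    nlinarith
  have hhs : 0 < h ^ 2 + s ^ 2 := by positivity
  have hQ0 : Q ≠ 0 := norm_pos_iff.1 (lt_of_lt_of_le (by positivity) hQn)
  have key : ((X + h * Y) / ((h:ℂ) * X - I * s * g) + (X + h * Y) / ((h:ℂ) * X + I * s * g)) / 2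
      = h * X ^ 2 / Q + h ^ 2 * X * Y / Q := by
    rw [hQ', div_add_div _ _ n1 n2, ← add_div, div_div, div_eq_div_iff (mul_ne_zero (mul_ne_zero n1 n2) two_ne_zero)
      (mul_ne_zero n1 n2)]
    ring
  rw [key, Complex.add_im]
  refine (abs_add_le _ _).trans (add_le_add ?_ ?_)
  · have e : h * X ^ 2 / Q = ((h / ‖Q‖ ^ 2 : ℝ) : ℂ) * (h ^ 2 * (‖X ^ 2‖ : ℂ) ^ 2 + s ^ 2 * (‖g ^ 2‖ : ℂ) ^ 2 +
        s ^ 2 * ((X ^ 2 - g ^ 2) * (starRingEnd ℂ) (g ^ 2))) := by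
      rw [← Complex.mul_conj', ← Complex.mul_conj']
      have hn : (‖Q‖ : ℂ) ^ 2 = Q * (starRingEnd ℂ) Q := (Complex.mul_conj' Q).symm
      have hcQ : (starRingEnd ℂ) Q ≠ 0 := (map_ne_zero _).2 hQ0
      push_cast
      rw [hn]
      have : (starRingEnd ℂ) Q = h ^ 2 * (starRingEnd ℂ) (X ^ 2) + s ^ 2 * (starRingEnd ℂ) (g ^ 2) := by
        simp [hQ]
      field_simp
      rw [this]; ring
    have e' : (h * X ^ 2 / Q).im = h * s ^ 2 / ‖Q‖ ^ 2 * ((X ^ 2 - g ^ 2) * (starRingEnd ℂ) (g ^ 2)).im := by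
      rw [e, Complex.im_ofReal_mul, Complex.add_im, Complex.add_im]
      have z1 : ((h:ℂ) ^ 2 * (‖X ^ 2‖ : ℂ) ^ 2).im = 0 := by
        rw [← Complex.ofReal_pow, ← Complex.ofReal_pow, ← Complex.ofReal_mul, Complex.ofReal_im]
      have z2 : ((s:ℂ) ^ 2 * (‖g ^ 2‖ : ℂ) ^ 2).im = 0 := by
        rw [← Complex.ofReal_pow, ← Complex.ofReal_pow, ← Complex.ofReal_mul, Complex.ofReal_im]
      rw [z1, z2, ← Complex.ofReal_pow, Complex.im_ofReal_mul]; ring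
    rw [e', abs_mul, abs_div, abs_mul, abs_of_nonneg (sq_nonneg s), abs_of_nonneg (sq_nonneg ‖Q‖)]
    have m1 : |((X ^ 2 - g ^ 2) * (starRingEnd ℂ) (g ^ 2)).im| ≤ (2 * L * |h|) * (2 * B1) * B1 ^ 2 := by
      refine (Complex.abs_im_le_norm _).trans ?_
      rw [norm_mul, RCLike.norm_conj, norm_pow, show X ^ 2 - g ^ 2 = (X - g) * (X + g) by ring, norm_mul]
      have : ‖X + g‖ ≤ 2 * B1 := (norm_add_le _ _).trans (by linarith)
      gcongr
    have m2 : |h| * s ^ 2 / ‖Q‖ ^ 2 * |h| ≤ 1 / c ^ 4 := by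
      rw [div_mul_eq_mul_div, div_le_div_iff₀ (by positivity) (by positivity)]
      have : (c ^ 2 * (h ^ 2 + s ^ 2)) ^ 2 ≤ ‖Q‖ ^ 2 := by gcongr
      have a1 := abs_mul_abs_self h
      have : |h| * s ^ 2 * |h| = h ^ 2 * s ^ 2 := by nlinarith
      rw [this]
      have : 0 ≤ c ^ 4 * (h ^ 4 + h ^ 2 * s ^ 2 + s ^ 4) := by positivity
      nlinarith
    calc _ ≤ |h| * s ^ 2 / ‖Q‖ ^ 2 * ((2 * L * |h|) * (2 * B1) * B1 ^ 2) := by gcongr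
      _ = (|h| * s ^ 2 / ‖Q‖ ^ 2 * |h|) * ((2 * L * (2 * B1)) * B1 ^ 2) := by ring
      _ ≤ 1 / c ^ 4 * ((2 * L * (2 * B1)) * B1 ^ 2) := by gcongr
      _ = _ := by ring
  · refine (Complex.abs_im_le_norm _).trans ?_
    rw [norm_div, norm_mul, norm_mul, norm_pow, Complex.norm_real, Real.norm_eq_abs, sq_abs]
    rw [div_le_div_iff₀ (norm_pos_iff.2 hQ0) (by positivity)]
    have : ‖X‖ * ‖Y‖ ≤ B1 * B2 := mul_le_mul b1 b2 (norm_nonneg _) hB10.le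
    have h2 : c ^ 2 * h ^ 2 ≤ ‖Q‖ := by nlinarith [sq_nonneg (c * s)]
    calc h ^ 2 * ‖X‖ * ‖Y‖ * c ^ 2 = (‖X‖ * ‖Y‖) * (c ^ 2 * h ^ 2) := by ring
      _ ≤ B1 * B2 * ‖Q‖ := by gcongr

lemma sym_zero (γ : ℝ → ℂ) (t h : ℝ) : sym γ t 0 h = deriv γ (t + h) / (γ (t + h) - γ t) := by
  simp [sym]

lemma SC.sym_meas {γ : ℝ → ℂ} (S : SC γ) (t s : ℝ) : Measurable (sym γ t s) := by
  have h1 : Measurable fun h => deriv γ (t + h) := S.cont1.measurable.comp (measurable_const_add t)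
  have h2 : Measurable fun h => γ (t + h) := S.cont.measurable.comp (measurable_const_add t)
  unfold sym
  exact ((h1.div (h2.sub_const _)).add (h1.div (h2.sub_const _))).div_const _

lemma Dom.half_wind (D : Dom K γ s0 c) (i : Fin n) (t : ℝ) :
    ∫ h in (-(1/2):ℝ)..(1/2), (deriv (γ i) (t + h) / (γ i (t + h) - γ i t)).im = Real.pi := by
  have S := D.sc i
  have hs0 := D.s0pos
  obtain ⟨C, hC⟩ := D.sym_bdd i
  have key : ∀ s, 0 < s → s ≤ s0 → ∫ h in (-(1/2):ℝ)..(1/2), (sym (γ i) t s h).im = Real.pi := by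
    intro s hs hs1
    have e1 := D.wpos i t s hs hs1
    have e2 := D.wout i _ (D.neg i t (-s) (by linarith) (by linarith))
    have pr : ∀ s, Function.Periodic (fun τ => deriv (γ i) τ / (γ i τ - par (γ i) t s)) 1 := fun s τ => by
      simp only [S.per τ, S.per1 τ]
    rw [wd, CT, window_shift (pr _) t] at e1 e2
    have hii : ∀ s, s ≠ 0 → |s| ≤ s0 → IntervalIntegrable (fun h => deriv (γ i) (t + h) / (γ i (t + h) - par (γ i) t s)) volume
        (-(1/2)) (1/2) := by
      intro s hs hs'
      apply ContinuousOn.intervalIntegrable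
      have c1 := S.cont
      have c2 := S.cont1
      refine ContinuousOn.div (by fun_prop) (by fun_prop) ?_
      intro h hh
      rw [uIcc_of_le (by norm_num)] at hh
      have := D.near0 i (t := t) (s := s) (h := h) (abs_le.2 ⟨hh.1, hh.2⟩) hs'
      have h1 : 0 < c * (|h| + |s|) := by have := abs_pos.2 hs; have := D.cpos; positivity
      exact norm_pos_iff.1 (h1.trans_le this)
    have hsa : |s| ≤ s0 := by rw [abs_of_pos hs]; exact hs1
    have i1 := hii s hs.ne' hsa
    have i2 := hii (-s) (by linarith) (by rwa [abs_neg])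
    have e3 : ∫ h in (-(1/2):ℝ)..(1/2), sym (γ i) t s h = Real.pi * I := by
      unfold sym
      rw [intervalIntegral.integral_div, intervalIntegral.integral_add i1 i2, e1, e2]; ring
    have e4 := Complex.imCLM.intervalIntegral_comp_comm (f := sym (γ i) t s) (μ := volume)
      (a := -(1/2)) (b := 1/2) ((i1.add i2).div_const 2)
    simp only [Complex.imCLM_apply] at e4
    rw [e4, e3]; simp
  have lim : Tendsto (fun s => ∫ h in (-(1/2):ℝ)..(1/2), (sym (γ i) t s h).im) (𝓝[>] 0)
      (𝓝 (∫ h in (-(1/2):ℝ)..(1/2), (sym (γ i) t 0 h).im)) := by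
    apply intervalIntegral.tendsto_integral_filter_of_dominated_convergence (fun _ => C)
    · exact Eventually.of_forall fun s => (Complex.measurable_im.comp (S.sym_meas t s)).aestronglyMeasurable
    · filter_upwards [Ioc_mem_nhdsGT hs0] with s hs
      filter_upwards [ae_ne_zero] with h h0 hh
      exact hC t s h (by rw [abs_of_pos hs.1]; exact hs.2) (mem_win hh) h0
    · exact intervalIntegrable_const
    · filter_upwards [ae_ne_zero] with h h0 hh
      have hne : γ i (t + h) - γ i t ≠ 0 := by
        have := D.near0 i (t := t) (s := 0) (mem_win hh) (by simpa using hs0.le)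
        rw [par_zero] at this
        have h1 : 0 < c * (|h| + |(0:ℝ)|) := by have := abs_pos.2 h0; have := D.cpos; positivity
        exact norm_pos_iff.1 (h1.trans_le this)
      have hca : ContinuousAt (fun s => sym (γ i) t s h) 0 := by
        unfold sym par
        refine ContinuousAt.div_const (ContinuousAt.add ?_ ?_) _
        · refine ContinuousAt.div (by fun_prop) (by fun_prop) (by simpa using hne)
        · refine ContinuousAt.div (by fun_prop) (by fun_prop) (by simpa using hne)
      exact ((Complex.continuous_im.continuousAt.comp hca).tendsto).mono_left nhdsWithin_le_nhds
  have hcon : Tendsto (fun s => ∫ h in (-(1/2):ℝ)..(1/2), (sym (γ i) t s h).im) (𝓝[>] 0) (𝓝 Real.pi) := by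
    refine tendsto_const_nhds.congr' ?_
    filter_upwards [Ioc_mem_nhdsGT hs0] with s hs
    exact (key s hs.1 hs.2).symm
  have := tendsto_nhds_unique lim hcon
  simpa only [sym_zero] using this
end halfw

section plem
variable {n : ℕ} {γ : Fin n → ℝ → ℂ} {s0 c : ℝ} {K : Set ℂ} {u : Fin n → ℝ → ℂ}

structure Dens {n : ℕ} (u : Fin n → ℝ → ℂ) : Prop where
  per : ∀ i, Function.Periodic (u i) 1
  lip : ∃ L, 0 ≤ L ∧ ∀ i t t', ‖u i t - u i t'‖ ≤ L * |t - t'|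

lemma Dens.cont (h : Dens u) (i : Fin n) : Continuous (u i) := by
  obtain ⟨L, hL, hl⟩ := h.lip
  have : LipschitzWith ⟨L, hL⟩ (u i) := LipschitzWith.of_dist_le_mul fun t t' => by
    rw [dist_eq_norm, Real.dist_eq]; exact hl i t t'
  exact this.continuous

lemma bdd_fin {f : Fin n → ℝ → ℂ} (h : ∀ i, ∃ C, 0 < C ∧ ∀ t, ‖f i t‖ ≤ C) : ∃ C, 0 ≤ C ∧ ∀ i t, ‖f i t‖ ≤ C := by
  choose C hC hC' using h
  refine ⟨∑ i, C i, Finset.sum_nonneg fun i _ => (hC i).le, fun i t => (hC' i t).trans ?_⟩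
  exact Finset.single_le_sum (f := C) (fun i _ => (hC i).le) (Finset.mem_univ i)

def hfi (γ : Fin n → ℝ → ℂ) (u : Fin n → ℝ → ℂ) (i j : Fin n) (t s h : ℝ) : ℂ :=
  (u j (t + h) - u i t) * deriv (γ j) (t + h) / (γ j (t + h) - par (γ i) t s)

lemma Fam.hfi_bdd (F : Fam γ s0 c) (U : Dens u) : ∃ B, 0 ≤ B ∧ ∀ i j t s h, |s| ≤ s0 → |h| ≤ 1/2 → h ≠ 0 →
    ‖hfi γ u i j t s h‖ ≤ B ∧ γ j (t + h) - par (γ i) t s ≠ 0 := by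
  obtain ⟨M, hM0, hM⟩ := bdd_fin fun i => per_bdd (F.sc i).per1 (F.sc i).cont1
  obtain ⟨W, hW0, hW⟩ := bdd_fin fun i => per_bdd (U.per i) (U.cont i)
  obtain ⟨L, hL0, hL⟩ := U.lip
  have hc := F.cpos
  refine ⟨L * M / c + 2 * W * M / c, by positivity, fun i j t s h hs hh h0 => ?_⟩
  unfold hfi
  by_cases e : i = j
  · subst e
    have d := F.near0 i (t := t) hh hs
    have hpos := abs_pos.2 h0
    have d' : c * |h| ≤ ‖γ i (t + h) - par (γ i) t s‖ := by nlinarith [mul_nonneg hc.le (abs_nonneg s)]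
    have hp : 0 < ‖γ i (t + h) - par (γ i) t s‖ := lt_of_lt_of_le (by positivity) d'
    refine ⟨?_, norm_pos_iff.1 hp⟩
    have l := hL i (t + h) t
    rw [add_sub_cancel_left] at l
    have : ‖(u i (t + h) - u i t) * deriv (γ i) (t + h) / (γ i (t + h) - par (γ i) t s)‖ ≤ L * M / c := by
      rw [norm_div, norm_mul, div_le_div_iff₀ hp hc]
      calc _ ≤ (L * |h|) * M * c := by gcongr; exact hM i _
        _ = L * M * (c * |h|) := by ring
        _ ≤ _ := by gcongr
    have : 0 ≤ 2 * W * M / c := by positivity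
    linarith
  · have d := F.far i j e t (t + h) s 0 hs (by simpa using F.s0pos.le)
    rw [par_zero] at d
    have hp : 0 < ‖γ j (t + h) - par (γ i) t s‖ := lt_of_lt_of_le hc d
    refine ⟨?_, norm_pos_iff.1 hp⟩
    have l : ‖u j (t + h) - u i t‖ ≤ 2 * W := (norm_sub_le _ _).trans (by linarith [hW j (t + h), hW i t])
    have : ‖(u j (t + h) - u i t) * deriv (γ j) (t + h) / (γ j (t + h) - par (γ i) t s)‖ ≤ 2 * W * M / c := by
      rw [norm_div, norm_mul]
      have := hM j (t + h)
      exact div_le_div₀ (by positivity) (mul_le_mul l this (norm_nonneg _) (by positivity)) hc d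
    have : 0 ≤ L * M / c := by positivity
    linarith

lemma Fam.hfi_meas (F : Fam γ s0 c) (U : Dens u) (i j : Fin n) (t s : ℝ) : Measurable (hfi γ u i j t s) := by
  have h1 : Measurable fun h => deriv (γ j) (t + h) := (F.sc j).cont1.measurable.comp (measurable_const_add t)
  have h2 : Measurable fun h => γ j (t + h) := (F.sc j).cont.measurable.comp (measurable_const_add t)
  have h3 : Measurable fun h => u j (t + h) := (U.cont j).measurable.comp (measurable_const_add t)
  unfold hfi
  exact ((h3.sub_const _).mul h1).div (h2.sub_const _)

lemma win_ii {f : ℝ → ℂ} (hm : Measurable f) {B : ℝ} (hb : ∀ h, |h| ≤ 1/2 → h ≠ 0 → ‖f h‖ ≤ B) :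
    IntervalIntegrable f volume (-(1/2)) (1/2) := by
  refine (intervalIntegrable_const (c := B)).mono_fun hm.aestronglyMeasurable ?_
  rw [EventuallyLE, ae_restrict_iff' measurableSet_uIoc]
  filter_upwards [ae_ne_zero] with h h0 hh
  exact (hb h (mem_win hh) h0).trans (le_abs_self B)

lemma Fam.hfi_ii (F : Fam γ s0 c) (U : Dens u) (i j : Fin n) (t : ℝ) {s : ℝ} (hs : |s| ≤ s0) :
    IntervalIntegrable (hfi γ u i j t s) volume (-(1/2)) (1/2) := by
  obtain ⟨B, -, hB⟩ := F.hfi_bdd U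
  exact win_ii (F.hfi_meas U i j t s) fun h hh h0 => (hB i j t s h hs hh h0).1

def Hf (γ : Fin n → ℝ → ℂ) (u : Fin n → ℝ → ℂ) (i : Fin n) (t s : ℝ) : ℂ :=
  ∑ j, ∫ h in (-(1/2):ℝ)..(1/2), hfi γ u i j t s h

lemma Fam.Hf_cont (F : Fam γ s0 c) (U : Dens u) (i : Fin n) :
    ContinuousOn (fun p : ℝ × ℝ => Hf γ u i p.1 p.2) {p | |p.2| ≤ s0} := by
  unfold Hf
  refine continuousOn_finsetSum _ fun j _ => ?_
  obtain ⟨B, -, hB⟩ := F.hfi_bdd U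
  intro p hp
  apply intervalIntegral.continuousWithinAt_of_dominated_interval (bound := fun _ => B)
  · exact Eventually.of_forall fun q => (F.hfi_meas U i j q.1 q.2).aestronglyMeasurable
  · filter_upwards [self_mem_nhdsWithin] with q hq
    filter_upwards [ae_ne_zero] with h h0 hh
    exact (hB i j q.1 q.2 h hq (mem_win hh) h0).1
  · exact intervalIntegrable_const
  · filter_upwards [ae_ne_zero] with h h0 hh
    have hne := (hB i j p.1 p.2 h hp (mem_win hh) h0).2
    have c1 := (F.sc j).cont
    have c2 := (F.sc j).cont1
    have c3 := U.cont i
    have c4 := U.cont j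
    have c5 := (F.sc i).par_cont
    have c6 : Continuous fun p : ℝ × ℝ => γ j (p.1 + h) - par (γ i) p.1 p.2 := by
      refine (by fun_prop : Continuous fun p : ℝ × ℝ => γ j (p.1 + h)).sub c5
    unfold hfi
    exact (ContinuousAt.div (by fun_prop) c6.continuousAt hne).continuousWithinAt

def cau (γ : Fin n → ℝ → ℂ) (u : Fin n → ℝ → ℂ) (z : ℂ) : ℂ :=
  (2 * Real.pi * I)⁻¹ * ∑ j, CT (γ j) (fun τ => u j τ * deriv (γ j) τ) z

lemma Fam.cau_eq (F : Fam γ s0 c) (U : Dens u) (i : Fin n) {t s : ℝ} (hs : |s| ≤ s0) (hs0 : s ≠ 0) :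
    ∑ j, CT (γ j) (fun τ => u j τ * deriv (γ j) τ) (par (γ i) t s) =
      Hf γ u i t s + u i t * ∑ j, wd (γ j) (par (γ i) t s) := by
  unfold Hf
  rw [Finset.mul_sum, ← Finset.sum_add_distrib]
  refine Finset.sum_congr rfl fun j _ => ?_
  have S := F.sc j
  have p1 : Function.Periodic (fun τ => u j τ * deriv (γ j) τ / (γ j τ - par (γ i) t s)) 1 := fun τ => by
    simp only [S.per τ, S.per1 τ, U.per j τ]
  have p2 : Function.Periodic (fun τ => deriv (γ j) τ / (γ j τ - par (γ i) t s)) 1 := fun τ => by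
    simp only [S.per τ, S.per1 τ]
  rw [wd, CT, CT, window_shift p1 t, window_shift p2 t, ← intervalIntegral.integral_const_mul,
    ← intervalIntegral.integral_add (F.hfi_ii U i j t hs)]
  · refine intervalIntegral.integral_congr fun h _ => ?_
    simp only [hfi]; ring
  · apply ContinuousOn.intervalIntegrable
    have c1 := S.cont
    have c2 := S.cont1
    refine ContinuousOn.mul (by fun_prop) (ContinuousOn.div (by fun_prop) (by fun_prop) ?_)
    intro h hh
    rw [uIcc_of_le (by norm_num)] at hh
    have hc := F.cpos
    by_cases e : i = j
    · subst e
      have := F.near0 i (t := t) (s := s) (h := h) (abs_le.2 ⟨hh.1, hh.2⟩) hs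
      have h1 : 0 < c * (|h| + |s|) := by have := abs_pos.2 hs0; positivity
      exact norm_pos_iff.1 (h1.trans_le this)
    · have d := F.far i j e t (t + h) s 0 hs (by simpa using F.s0pos.le)
      rw [par_zero] at d
      exact norm_pos_iff.1 (hc.trans_le d)

lemma two_pi_I_ne : (2 * Real.pi * I : ℂ) ≠ 0 := by
  have : (Real.pi : ℂ) ≠ 0 := by exact_mod_cast Real.pi_ne_zero
  simp [this]

lemma Dom.cau_pos (D : Dom K γ s0 c) (U : Dens u) (i : Fin n) {t s : ℝ} (hs : 0 < s) (hs0 : s ≤ s0) :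
    cau γ u (par (γ i) t s) = u i t + (2 * Real.pi * I)⁻¹ * Hf γ u i t s := by
  have ha : |s| ≤ s0 := by rwa [abs_of_pos hs]
  rw [cau, D.cau_eq U i ha hs.ne', Finset.sum_eq_single i (fun j _ hj => D.wother i j hj.symm t s ha) (by simp),
    D.wpos i t s hs hs0]
  have := two_pi_I_ne
  field_simp
  ring

lemma Dom.cau_neg (D : Dom K γ s0 c) (U : Dens u) (i : Fin n) {t s : ℝ} (hs : s < 0) (hs0 : -s0 ≤ s) :
    cau γ u (par (γ i) t s) = (2 * Real.pi * I)⁻¹ * Hf γ u i t s := by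
  have ha : |s| ≤ s0 := by rw [abs_of_neg hs]; linarith
  rw [cau, D.cau_eq U i ha hs.ne, Finset.sum_eq_zero (fun j _ => D.wout j _ (D.neg i t s hs hs0))]
  simp

/-- boundary value of the Cauchy integral from outside -/
def bout (γ : Fin n → ℝ → ℂ) (u : Fin n → ℝ → ℂ) (i : Fin n) (t : ℝ) : ℂ := (2 * Real.pi * I)⁻¹ * Hf γ u i t 0

lemma Dom.fr (D : Dom K γ s0 c) (i : Fin n) (t : ℝ) : γ i t ∈ frontier K := by
  rw [← D.bd]; exact mem_iUnion.2 ⟨i, t, rfl⟩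

lemma Dom.fr' (D : Dom K γ s0 c) {z : ℂ} (hz : z ∈ frontier K) : ∃ i t, γ i t = z := by
  rw [← D.bd] at hz; obtain ⟨i, t, h⟩ := mem_iUnion.1 hz; exact ⟨i, t, h⟩

lemma Dom.Hf_lim (D : Dom K γ s0 c) (U : Dens u) (i : Fin n) (t : ℝ) :
    Tendsto (fun p : ℝ × ℝ => Hf γ u i p.1 p.2) (𝓝 (t, 0)) (𝓝 (Hf γ u i t 0)) := by
  have h0 := D.s0pos
  have := (D.Hf_cont U i).continuousAt (x := (t, 0)) (by
    have : {p : ℝ × ℝ | |p.2| < s0} ∈ 𝓝 ((t, 0) : ℝ × ℝ) :=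
      (isOpen_lt (by fun_prop) continuous_const).mem_nhds (by simpa using h0)
    exact mem_of_superset this fun p (hp : |p.2| < s0) => (show |p.2| ≤ s0 from le_of_lt hp))
  exact this

lemma Dom.nhds_eq (D : Dom K γ s0 c) (i : Fin n) (t : ℝ) :
    𝓝 (γ i t) = Filter.map (fun p : ℝ × ℝ => par (γ i) p.1 p.2) (𝓝 (t, 0)) := by
  rw [D.opn i t 0 (by simpa using D.s0pos.le), par_zero]

lemma Dom.small (D : Dom K γ s0 c) (t : ℝ) : ∀ᶠ p : ℝ × ℝ in 𝓝 (t, 0), |p.2| ≤ s0 := by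
  have : {p : ℝ × ℝ | |p.2| < s0} ∈ 𝓝 ((t, 0) : ℝ × ℝ) :=
      (isOpen_lt (by fun_prop) continuous_const).mem_nhds (by simpa using D.s0pos)
  exact mem_of_superset this fun p (hp : |p.2| < s0) => (show |p.2| ≤ s0 from le_of_lt hp)

lemma Dom.lim_out (D : Dom K γ s0 c) (U : Dens u) (i : Fin n) (t : ℝ) :
    Tendsto (cau γ u) (𝓝[Kᶜ] (γ i t)) (𝓝 (bout γ u i t)) := by
  have h1 : Tendsto (fun p : ℝ × ℝ => (2 * Real.pi * I)⁻¹ * Hf γ u i p.1 p.2) (𝓝 (t, 0)) (𝓝 (bout γ u i t)) :=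
    (D.Hf_lim U i t).const_mul _
  intro V hV
  rw [mem_map, mem_nhdsWithin_iff_eventually, D.nhds_eq, eventually_map]
  filter_upwards [h1 hV, D.small t] with p hp hs hz
  rw [mem_preimage] at hp ⊢
  have hKc := D.comp.isClosed
  rcases lt_trichotomy p.2 0 with h | h | h
  · rwa [D.cau_neg U i h (by linarith [(abs_le.1 hs).1])]
  · rw [h, par_zero] at hz
    exact absurd (hKc.frontier_subset (D.fr i p.1)) hz
  · exact absurd (interior_subset (D.pos i p.1 p.2 h (abs_le.1 hs).2)) hz

lemma Dom.lim_in (D : Dom K γ s0 c) (U : Dens u) (i : Fin n) (t : ℝ) :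
    Tendsto (cau γ u) (𝓝[interior K] (γ i t)) (𝓝 (u i t + bout γ u i t)) := by
  have h1 : Tendsto (fun p : ℝ × ℝ => u i p.1 + (2 * Real.pi * I)⁻¹ * Hf γ u i p.1 p.2) (𝓝 (t, 0))
      (𝓝 (u i t + bout γ u i t)) := by
    refine Tendsto.add ?_ ((D.Hf_lim U i t).const_mul _)
    have := U.cont i
    exact (by fun_prop : Continuous fun p : ℝ × ℝ => u i p.1).continuousAt
  intro V hV
  rw [mem_map, mem_nhdsWithin_iff_eventually, D.nhds_eq, eventually_map]
  filter_upwards [h1 hV, D.small t] with p hp hs hz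
  rw [mem_preimage] at hp ⊢
  rcases lt_trichotomy p.2 0 with h | h | h
  · exact absurd (interior_subset hz) (D.neg i p.1 p.2 h (by linarith [(abs_le.1 hs).1]))
  · rw [h, par_zero] at hz
    exact absurd hz (D.fr i p.1).2
  · rwa [D.cau_pos U i h (abs_le.1 hs).2]

lemma Dom.par_lim (D : Dom K γ s0 c) (i : Fin n) (t : ℝ) :
    Tendsto (fun s => par (γ i) t s) (𝓝 0) (𝓝 (γ i t)) := by
  have := ((D.sc i).par_cont).comp (by fun_prop : Continuous fun s : ℝ => ((t, s) : ℝ × ℝ))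
  have h := this.tendsto 0
  simpa [Function.comp_def] using h

lemma Dom.neBot_out (D : Dom K γ s0 c) (i : Fin n) (t : ℝ) : (𝓝[Kᶜ] (γ i t)).NeBot := by
  have : Tendsto (fun s => par (γ i) t s) (𝓝[<] 0) (𝓝[Kᶜ] (γ i t)) := by
    refine tendsto_nhdsWithin_iff.2 ⟨(D.par_lim i t).mono_left nhdsWithin_le_nhds, ?_⟩
    have h0 := D.s0pos
    filter_upwards [Ioo_mem_nhdsLT (show -s0 < 0 by linarith)] with s hs
    exact D.neg i t s hs.2 hs.1.le
  exact this.neBot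

lemma Dom.neBot_in (D : Dom K γ s0 c) (i : Fin n) (t : ℝ) : (𝓝[interior K] (γ i t)).NeBot := by
  have : Tendsto (fun s => par (γ i) t s) (𝓝[>] 0) (𝓝[interior K] (γ i t)) := by
    refine tendsto_nhdsWithin_iff.2 ⟨(D.par_lim i t).mono_left nhdsWithin_le_nhds, ?_⟩
    filter_upwards [Ioo_mem_nhdsGT D.s0pos] with s hs
    exact D.pos i t s hs.1 hs.2.le
  exact this.neBot

lemma Dom.off (D : Dom K γ s0 c) {z : ℂ} (hz : z ∉ frontier K) (j : Fin n) : z ∈ (γ j '' Icc 0 1)ᶜ := by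
  rintro ⟨t, -, rfl⟩
  exact hz (D.fr j t)

lemma Dom.cau_diff (D : Dom K γ s0 c) (U : Dens u) : DifferentiableOn ℂ (cau γ u) (frontier K)ᶜ := by
  unfold cau
  refine DifferentiableOn.const_mul (DifferentiableOn.fun_sum fun j _ => ?_) _
  exact (CT_diffOn (D.sc j).cont ((U.cont j).mul (D.sc j).cont1)).mono fun z hz => D.off hz j

lemma Dom.cau_infty (D : Dom K γ s0 c) (U : Dens u) : ∃ w, Tendsto (fun z => z * cau γ u z) (cobounded ℂ) (𝓝 w) := by
  refine ⟨(2 * Real.pi * I)⁻¹ * ∑ j, -∫ τ in (0:ℝ)..1, u j τ * deriv (γ j) τ, ?_⟩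
  have := (tendsto_finsetSum Finset.univ fun j _ => CT_infty (D.sc j).cont ((U.cont j).mul (D.sc j).cont1)).const_mul (2 * Real.pi * I : ℂ)⁻¹
  refine this.congr fun z => ?_
  simp only [cau, Finset.mul_sum]
  refine Finset.sum_congr rfl fun j _ => ?_
  simp only [Pi.mul_def]; ring

lemma Dom.exists_out (D : Dom K γ s0 c) (U : Dens u) : ∃ F : ℂ → ℂ, ContinuousOn F (interior K)ᶜ ∧
    DifferentiableOn ℂ F Kᶜ ∧ (∃ w, Tendsto (fun z => z * F z) (cobounded ℂ) (𝓝 w)) ∧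
    ∀ i t, F (γ i t) = bout γ u i t := by
  have hKc := D.comp.isClosed
  have hd := (D.cau_diff U)
  have hsub : Kᶜ ⊆ (frontier K)ᶜ := compl_subset_compl.2 hKc.frontier_subset
  have hop : IsOpen (frontier K)ᶜ := isClosed_frontier.isOpen_compl
  have he : EqOn (extendFrom Kᶜ (cau γ u)) (cau γ u) Kᶜ := fun z hz =>
    extendFrom_eq (subset_closure hz) ((hd.continuousOn.continuousAt (hop.mem_nhds (hsub hz))).mono_left nhdsWithin_le_nhds)
  refine ⟨extendFrom Kᶜ (cau γ u), ?_, ?_, ?_, ?_⟩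
  · refine continuousOn_extendFrom ?_ ?_
    · rw [closure_compl]
    · intro z hz
      by_cases hk : z ∈ K
      · obtain ⟨i, t, rfl⟩ := D.fr' (z := z) ⟨subset_closure hk, hz⟩
        exact ⟨_, D.lim_out U i t⟩
      · exact ⟨_, (hd.continuousOn.continuousAt (hop.mem_nhds (hsub hk))).mono_left nhdsWithin_le_nhds⟩
  · exact (hd.mono hsub).congr he
  · obtain ⟨w, hw⟩ := D.cau_infty U
    refine ⟨w, hw.congr' ?_⟩
    filter_upwards [(isBounded_def.1 D.comp.isBounded : Kᶜ ∈ cobounded ℂ)] with z hz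
    rw [he hz]
  · intro i t
    have := D.neBot_out i t
    exact extendFrom_eq (mem_closure_iff_nhdsWithin_neBot.2 this) (D.lim_out U i t)

lemma Dom.exists_in (D : Dom K γ s0 c) (U : Dens u) : ∃ F : ℂ → ℂ, ContinuousOn F K ∧
    DifferentiableOn ℂ F (interior K) ∧ ∀ i t, F (γ i t) = u i t + bout γ u i t := by
  have hKc := D.comp.isClosed
  have hd := (D.cau_diff U)
  have hsub : interior K ⊆ (frontier K)ᶜ := fun z hz h => h.2 hz
  have hop : IsOpen (frontier K)ᶜ := isClosed_frontier.isOpen_compl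
  have he : EqOn (extendFrom (interior K) (cau γ u)) (cau γ u) (interior K) := fun z hz =>
    extendFrom_eq (subset_closure hz) ((hd.continuousOn.continuousAt (hop.mem_nhds (hsub hz))).mono_left nhdsWithin_le_nhds)
  refine ⟨extendFrom (interior K) (cau γ u), ?_, ?_, ?_⟩
  · refine continuousOn_extendFrom ?_ ?_
    · intro z hz
      by_cases hk : z ∈ interior K
      · exact subset_closure hk
      · obtain ⟨i, t, rfl⟩ := D.fr' (z := z) ⟨subset_closure hz, hk⟩
        exact mem_closure_iff_nhdsWithin_neBot.2 (D.neBot_in i t)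
    · intro z hz
      by_cases hk : z ∈ interior K
      · exact ⟨_, (hd.continuousOn.continuousAt (hop.mem_nhds (hsub hk))).mono_left nhdsWithin_le_nhds⟩
      · obtain ⟨i, t, rfl⟩ := D.fr' (z := z) ⟨subset_closure hz, hk⟩
        exact ⟨_, D.lim_in U i t⟩
  · exact (hd.mono hsub).congr he
  · intro i t
    have := D.neBot_in i t
    exact extendFrom_eq (mem_closure_iff_nhdsWithin_neBot.2 this) (D.lim_in U i t)

end plem

section hq
variable {n : ℕ} {γ : Fin n → ℝ → ℂ} {s0 c : ℝ} {K : Set ℂ} {u : Fin n → ℝ → ℂ}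

/-- the conjugate density -/
def jd (γ : Fin n → ℝ → ℂ) (u : Fin n → ℝ → ℂ) (i : Fin n) (t : ℝ) : ℂ :=
  I * (starRingEnd ℂ) (tg (γ i) t) * (starRingEnd ℂ) (u i t)

lemma Fam.jd_dens (F : Fam γ s0 c) (U : Dens u) : Dens (jd γ u) := by
  refine ⟨fun i t => by simp only [jd, (F.sc i).tg_per t, U.per i t], ?_⟩
  obtain ⟨W, hW0, hW⟩ := bdd_fin fun i => per_bdd (U.per i) (U.cont i)
  obtain ⟨L, hL0, hL⟩ := U.lip
  have h1 : ∀ i, ∃ L, 0 < L ∧ ∀ t t', ‖tg (γ i) t - tg (γ i) t'‖ ≤ L * |t - t'| := fun i =>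
    per_lip (F.sc i).tg_per ((F.sc i).tg_smooth.of_le (by norm_num))
  choose C hC hC' using h1
  have hC2 : ∀ i t t', ‖tg (γ i) t - tg (γ i) t'‖ ≤ (∑ i, C i) * |t - t'| := fun i t t' =>
    (hC' i t t').trans (mul_le_mul_of_nonneg_right
      (Finset.single_le_sum (f := C) (fun i _ => (hC i).le) (Finset.mem_univ i)) (abs_nonneg _))
  have hs : 0 ≤ ∑ i, C i := Finset.sum_nonneg fun i _ => (hC i).le
  refine ⟨(∑ i, C i) * W + L, by positivity, fun i t t' => ?_⟩
  have : jd γ u i t - jd γ u i t' = I * (starRingEnd ℂ) ((tg (γ i) t - tg (γ i) t') * u i t + tg (γ i) t' * (u i t - u i t')) := by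
    simp only [jd, map_add, map_mul, map_sub]; ring
  rw [this, norm_mul, norm_I, one_mul, RCLike.norm_conj]
  calc _ ≤ ‖tg (γ i) t - tg (γ i) t'‖ * ‖u i t‖ + ‖tg (γ i) t'‖ * ‖u i t - u i t'‖ := by
        refine (norm_add_le _ _).trans ?_
        rw [norm_mul, norm_mul]
    _ ≤ ((∑ i, C i) * |t - t'|) * W + 1 * (L * |t - t'|) := by
        rw [(F.sc i).tg_norm]
        have a := hC2 i t t'
        have b := hL i t t'
        have c := hW i t
        gcongr
    _ = _ := by ring

lemma conj_ii (f : ℝ → ℂ) (a b : ℝ) : (starRingEnd ℂ) (∫ h in a..b, f h) = ∫ h in a..b, (starRingEnd ℂ) (f h) := by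
  simp only [intervalIntegral, map_sub, integral_conj]

lemma Dom.ident (D : Dom K γ s0 c) (U : Dens u) (i j : Fin n) (t : ℝ) :
    (∫ h in (-(1/2):ℝ)..(1/2), hfi γ u i j t 0 h) -
      (I * (starRingEnd ℂ) (tg (γ i) t)) * (starRingEnd ℂ) (∫ h in (-(1/2):ℝ)..(1/2), hfi γ (jd γ u) i j t 0 h) =
    (∫ τ in (0:ℝ)..1, ks (γ i) (γ j) t τ * u j τ) - u i t * (2 * I * (if i = j then (Real.pi : ℂ) else 0)) := by
  have V := D.jd_dens U
  have S := D.sc j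
  have hs0 : |(0:ℝ)| ≤ s0 := by simpa using D.s0pos.le
  set W : ℝ → ℂ := fun h => deriv (γ j) (t + h) / (γ j (t + h) - γ i t) with hW
  have hWm : Measurable W := by
    have h1 : Measurable fun h => deriv (γ j) (t + h) := S.cont1.measurable.comp (measurable_const_add t)
    have h2 : Measurable fun h => γ j (t + h) := S.cont.measurable.comp (measurable_const_add t)
    exact h1.div (h2.sub_const _)
  have hWi : IntervalIntegrable (fun h => ((W h).im : ℂ)) volume (-(1/2)) (1/2) ∧
      ∫ h in (-(1/2):ℝ)..(1/2), ((W h).im : ℂ) = if i = j then (Real.pi : ℂ) else 0 := by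
    by_cases e : i = j
    · subst e
      obtain ⟨C, hC⟩ := D.sym_bdd i
      refine ⟨win_ii (B := C) (Complex.measurable_ofReal.comp (Complex.measurable_im.comp hWm)) fun h hh h0 => ?_, ?_⟩
      · have := hC t 0 h hs0 hh h0
        rw [sym_zero] at this
        simpa [hW] using this
      · rw [intervalIntegral.integral_ofReal, D.half_wind i t]; simp
    · have hc : Continuous W := by
        have c1 := S.cont
        have c2 := S.cont1
        refine Continuous.div (by fun_prop) (by fun_prop) fun h => ?_
        have d := D.far i j e t (t + h) 0 0 hs0 hs0
        simp only [par_zero] at d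
        exact norm_pos_iff.1 (D.cpos.trans_le d)
      have hci : Continuous fun h => (W h).im := Complex.continuous_im.comp hc
      refine ⟨(Complex.continuous_ofReal.comp hci).intervalIntegrable _ _, ?_⟩
      have := D.wother i j e t 0 hs0
      have p2 : Function.Periodic (fun τ => deriv (γ j) τ / (γ j τ - par (γ i) t 0)) 1 := fun τ => by
        simp only [S.per τ, S.per1 τ]
      rw [wd, CT, window_shift p2 t] at this
      simp only [par_zero] at this
      have h2 := ContinuousLinearMap.intervalIntegral_comp_comm (𝕜 := ℝ) (L := Complex.imCLM) (f := W) (μ := volume)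
        (a := -(1/2)) (b := 1/2) (hc.intervalIntegrable _ _)
      simp only [Complex.imCLM_apply] at h2
      rw [intervalIntegral.integral_ofReal, h2, this, if_neg e]; simp
  have pk : Function.Periodic (fun τ => ks (γ i) (γ j) t τ * u j τ) 1 := fun τ => by
    simp only [ks_per S t τ, U.per j τ]
  obtain ⟨B, hB0, hB⟩ := D.ks_bdd
  obtain ⟨Wu, hWu0, hWu⟩ := bdd_fin fun i => per_bdd (U.per i) (U.cont i)
  have hki : IntervalIntegrable (fun h => ks (γ i) (γ j) t (t + h) * u j (t + h)) volume (-(1/2)) (1/2) := by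
    refine bdd_ii (B := B * Wu) ?_ (fun h => ?_) _ _
    · exact ((ks_meas S t).mul (U.cont j).measurable).comp (measurable_const_add t)
    · rw [norm_mul]; exact mul_le_mul (hB i j _ _) (hWu _ _) (norm_nonneg _) hB0
  have i1 := D.hfi_ii U i j t hs0
  have i2 := D.hfi_ii V i j t hs0
  have i2' : IntervalIntegrable (fun h => (starRingEnd ℂ) (hfi γ (jd γ u) i j t 0 h)) volume (-(1/2)) (1/2) := by
    obtain ⟨B, -, hB⟩ := D.hfi_bdd V
    refine win_ii (B := B) (Complex.continuous_conj.measurable.comp (D.hfi_meas V i j t 0)) fun h hh h0 => ?_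
    rw [RCLike.norm_conj]; exact (hB i j t 0 h hs0 hh h0).1
  rw [window_shift pk t, conj_ii, ← hWi.2, ← intervalIntegral.integral_const_mul (2 * I),
    ← intervalIntegral.integral_const_mul, ← intervalIntegral.integral_const_mul,
    ← intervalIntegral.integral_sub i1 (i2'.const_mul _),
    ← intervalIntegral.integral_sub hki ((hWi.1.const_mul _).const_mul _)]
  refine intervalIntegral.integral_congr fun h _ => ?_
  have him : (2 * I * ((W h).im : ℂ)) = W h - (starRingEnd ℂ) (W h) := by
    rw [Complex.sub_conj]; push_cast; ring
  have e1 := S.tg_eq' (t + h)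
  have e2 := (D.sc i).tg_conj t
  simp only [him]
  simp only [hfi, par_zero, hW, ks, jd, e1, map_sub, map_mul, map_div₀, Complex.conj_I, Complex.conj_conj]
  have hI : I * I = -1 := Complex.I_mul_I
  simp only [div_eq_mul_inv]
  linear_combination (-(starRingEnd ℂ) (tg (γ i) t) * (starRingEnd ℂ) (deriv (γ j) (t + h)) * ((starRingEnd ℂ) (γ j (t + h)) - (starRingEnd ℂ) (γ i t))⁻¹ * (tg (γ j) (t+h) * u j (t+h) - tg (γ i) t * u i t)) * (-hI) + (u i t * (starRingEnd ℂ) (deriv (γ j) (t + h)) * ((starRingEnd ℂ) (γ j (t + h)) - (starRingEnd ℂ) (γ i t))⁻¹) * e2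

lemma Dom.bout_ident (D : Dom K γ s0 c) (U : Dens u) (i : Fin n) (t : ℝ) :
    bout γ u i t + I * (starRingEnd ℂ) (tg (γ i) t) * (starRingEnd ℂ) (bout γ (jd γ u) i t) =
    (2 * Real.pi * I)⁻¹ * (∑ j, ∫ τ in (0:ℝ)..1, ks (γ i) (γ j) t τ * u j τ) - u i t := by
  have h := Finset.sum_congr (rfl : (Finset.univ : Finset (Fin n)) = _) fun j _ => D.ident U i j t
  rw [Finset.sum_sub_distrib, Finset.sum_sub_distrib, ← Finset.mul_sum, ← Finset.mul_sum, ← Finset.mul_sum, ← map_sum,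
    Finset.sum_ite_eq] at h
  simp only [Finset.mem_univ, if_true] at h
  have hc : (starRingEnd ℂ) (2 * Real.pi * I : ℂ)⁻¹ = -(2 * Real.pi * I : ℂ)⁻¹ := by
    rw [map_inv₀, map_mul, map_mul, Complex.conj_I, Complex.conj_ofReal, Complex.conj_ofNat, mul_neg, inv_neg]
  rw [bout, bout, map_mul, hc]
  unfold Hf
  have h2 := two_pi_I_ne
  have h3 : (2 * Real.pi * I : ℂ)⁻¹ * (2 * I * Real.pi) = 1 := by
    rw [show (2 * I * Real.pi : ℂ) = 2 * Real.pi * I by ring, inv_mul_cancel₀ h2]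
  linear_combination (2 * Real.pi * I : ℂ)⁻¹ * h - u i t * h3

/-- Existence of the Szego and Garabedian functions. -/
lemma Dom.exists_hq (D : Dom K γ s0 c) : ∃ h q : ℂ → ℂ, ContinuousOn h (interior K)ᶜ ∧ DifferentiableOn ℂ h Kᶜ ∧
    ContinuousOn q (interior K)ᶜ ∧ DifferentiableOn ℂ q Kᶜ ∧
    (∃ w, Tendsto (fun z => z * h z) (cobounded ℂ) (𝓝 w)) ∧
    (∃ w, Tendsto (fun z => z * (q z - 1)) (cobounded ℂ) (𝓝 w)) ∧
    ∀ i t, q (γ i t) = I * (starRingEnd ℂ) (tg (γ i) t) * (starRingEnd ℂ) (h (γ i t)) := by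
  obtain ⟨u, up, ul, ue⟩ := D.ks_solution
  have U : Dens u := ⟨up, ul⟩
  have V := D.jd_dens U
  obtain ⟨P, P1, P2, P3⟩ := D.exists_in U
  obtain ⟨R, R1, R2, R3⟩ := D.exists_in V
  obtain ⟨H, H1, H2, ⟨wh, H3⟩, H4⟩ := D.exists_out U
  obtain ⟨Q, Q1, Q2, ⟨wq, Q3⟩, Q4⟩ := D.exists_out V
  -- relation between interior values
  have rel : ∀ i t, P (γ i t) = -(I * (starRingEnd ℂ) (tg (γ i) t) * (starRingEnd ℂ) (R (γ i t) - 1)) := by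
    intro i t
    have e := D.bout_ident U i t
    have e2 := ue i t
    rw [P3, R3]
    have e3 := (D.sc i).tg_conj t
    simp only [jd, map_sub, map_add, map_mul, map_one, Complex.conj_I, Complex.conj_conj]
    have hI : I * I = -1 := Complex.I_mul_I
    linear_combination e + e2 + u i t * e3 - (starRingEnd ℂ) (tg (γ i) t) * tg (γ i) t * u i t * hI
  have hci := D.inner_bd (G := fun z => P z * (R z - 1)) (P2.mul (R2.sub_const 1)) (P1.mul (R1.sub continuousOn_const))
  have hcont : ∀ i, Continuous fun t => R (γ i t) - 1 := by
    intro i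
    refine Continuous.sub ?_ continuous_const
    exact R1.comp_continuous (D.sc i).cont fun t => D.comp.isClosed.frontier_subset (D.fr i t)
  have hz : ∑ i, ∫ t in (0:ℝ)..1, ‖R (γ i t) - 1‖ ^ 2 * ‖deriv (γ i) t‖ = 0 := by
    unfold CI at hci
    have : ∀ i, ∫ τ in (0:ℝ)..1, (fun z => P z * (R z - 1)) (par (γ i) τ 0) * dpar (γ i) τ 0 =
        -I * ((∫ t in (0:ℝ)..1, ‖R (γ i t) - 1‖ ^ 2 * ‖deriv (γ i) t‖ : ℝ) : ℂ) := by
      intro i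
      rw [← intervalIntegral.integral_ofReal, ← intervalIntegral.integral_const_mul]
      refine intervalIntegral.integral_congr fun t _ => ?_
      simp only [par_zero, dpar_zero]
      rw [rel]
      push_cast
      rw [← Complex.mul_conj']
      have e1 := (D.sc i).tg_eq t
      have e3 := (D.sc i).tg_conj t
      linear_combination (-(I * (starRingEnd ℂ) (tg (γ i) t) * (starRingEnd ℂ) (R (γ i t) - 1)) * (R (γ i t) - 1)) * e1 -
        (I * (starRingEnd ℂ) (R (γ i t) - 1)) * (R (γ i t) - 1) * ‖deriv (γ i) t‖ * e3
    rw [Finset.sum_congr rfl fun i _ => this i, ← Finset.mul_sum] at hci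
    have := (mul_eq_zero.1 hci).resolve_left (by simp)
    exact_mod_cast this
  have hcn : ∀ i, Continuous fun t => ‖R (γ i t) - 1‖ ^ 2 * ‖deriv (γ i) t‖ := fun i =>
    ((hcont i).norm.pow 2).mul (D.sc i).cont1.norm
  have hR0 : ∀ i t, R (γ i t) - 1 = 0 := by
    intro i t
    have h1 : ∫ t in (0:ℝ)..1, ‖R (γ i t) - 1‖ ^ 2 * ‖deriv (γ i) t‖ = 0 :=
      (Finset.sum_eq_zero_iff_of_nonneg fun i _ => intervalIntegral.integral_nonneg zero_le_one
        fun t _ => by positivity).1 hz i (Finset.mem_univ i)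
    by_contra hne
    have hp : Function.Periodic (fun t => R (γ i t) - 1) 1 := fun t => by simp only [(D.sc i).per t]
    obtain ⟨t', ht', he⟩ := hp.exists_mem_Ico₀ one_pos t
    have : 0 < ∫ t in (0:ℝ)..1, ‖R (γ i t) - 1‖ ^ 2 * ‖deriv (γ i) t‖ := by
      refine intervalIntegral.integral_pos zero_lt_one (hcn i).continuousOn (fun t _ => by positivity) ⟨t', ⟨ht'.1, ht'.2.le⟩, ?_⟩
      have a : 0 < ‖R (γ i t') - 1‖ := norm_pos_iff.2 (by rw [← he]; exact hne)
      have b : 0 < ‖deriv (γ i) t'‖ := norm_pos_iff.2 ((D.sc i).reg t')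
      positivity
    linarith
  have hP0 : ∀ i t, P (γ i t) = 0 := fun i t => by rw [rel, hR0]; simp
  have hH : ∀ i t, -H (γ i t) = u i t := fun i t => by
    have := hP0 i t
    rw [P3] at this
    rw [H4]; linear_combination -this
  have hQ : ∀ i t, 1 - Q (γ i t) = jd γ u i t := fun i t => by
    have := hR0 i t
    rw [R3] at this
    rw [Q4]; linear_combination -this
  refine ⟨fun z => -H z, fun z => 1 - Q z, H1.neg, H2.neg, continuousOn_const.sub Q1, Q2.const_sub 1,
    ⟨-wh, ?_⟩, ⟨-wq, ?_⟩, fun i t => ?_⟩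
  · exact H3.neg.congr fun z => by ring
  · exact Q3.neg.congr fun z => by ring
  · simp only [hH, hQ]; rfl

end hq

lemma wind_int {Y Y' : ℝ → ℂ} (hY : ∀ t, HasDerivAt Y (Y' t) t) (hc : Continuous Y') (h0 : ∀ t, Y t ≠ 0)
    (hcl : Y 1 = Y 0) : ∃ m : ℤ, ∫ t in (0:ℝ)..1, Y' t / Y t = 2 * Real.pi * I * m := by
  have hYc : Continuous Y := continuous_iff_continuousAt.2 fun t => (hY t).continuousAt
  have hq : Continuous fun t => Y' t / Y t := hc.div hYc h0
  have hg : ∀ x, HasDerivAt (fun x => ∫ t in (0:ℝ)..x, Y' t / Y t) (Y' x / Y x) x := fun x =>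
    hq.integral_hasStrictDerivAt 0 x |>.hasDerivAt
  have hz : ∀ x, HasDerivAt (fun x => Y x * Complex.exp (-∫ t in (0:ℝ)..x, Y' t / Y t)) 0 x := by
    intro x
    have := (hY x).mul ((hg x).neg.cexp)
    have hx := h0 x
    have e : Y' x * cexp (-∫ t in (0:ℝ)..x, Y' t / Y t) +
      Y x * (cexp (-∫ t in (0:ℝ)..x, Y' t / Y t) * -(Y' x / Y x)) = 0 := by
      generalize cexp (-∫ t in (0:ℝ)..x, Y' t / Y t) = E
      field_simp; ring
    rw [← e]
    exact this
  have hk := is_const_of_deriv_eq_zero (fun x => (hz x).differentiableAt) (fun x => (hz x).deriv) 1 0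
  simp only [intervalIntegral.integral_same, neg_zero, Complex.exp_zero, mul_one] at hk
  rw [hcl] at hk
  have h1 : Complex.exp (-∫ t in (0:ℝ)..1, Y' t / Y t) = 1 := mul_left_cancel₀ (h0 0) (by rw [hk, mul_one])
  obtain ⟨m, hm⟩ := Complex.exp_eq_one_iff.1 h1
  refine ⟨-m, ?_⟩
  push_cast
  linear_combination -hm

lemma wind_zero {Y Y' : ℝ → ℂ} (hY : ∀ t, HasDerivAt Y (Y' t) t) (hc : Continuous Y') (h0 : ∀ t, 0 < (Y t).re)
    (hcl : Y 1 = Y 0) : ∫ t in (0:ℝ)..1, Y' t / Y t = 0 := by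
  have hs : ∀ t, Y t ∈ slitPlane := fun t => Or.inl (h0 t)
  have hYc : Continuous Y := continuous_iff_continuousAt.2 fun t => (hY t).continuousAt
  have hq : Continuous fun t => Y' t / Y t := hc.div hYc fun t => slitPlane_ne_zero (hs t)
  rw [intervalIntegral.integral_eq_sub_of_hasDerivAt (f := fun t => Complex.log (Y t))
    (fun t _ => (hY t).clog_real (hs t)) (hq.intervalIntegrable _ _), hcl, sub_self]

lemma int_const {f : ℝ → ℝ} {a b : ℝ} (hf : ContinuousOn f (Icc a b)) (hi : ∀ x ∈ Icc a b, ∃ m : ℤ, f x = m)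
    {x y : ℝ} (hx : x ∈ Icc a b) (hy : y ∈ Icc a b) : f x = f y := by
  have hT : IsDiscrete (range ((↑) : ℤ → ℝ)) := by
    rw [isDiscrete_iff_discreteTopology]
    exact Int.isClosedEmbedding_coe_real.isEmbedding.toHomeomorph.symm.isEmbedding.discreteTopology
  obtain ⟨z, -, hz⟩ := isPreconnected_Icc.eqOn_const_of_mapsTo hT hf (fun x hx => by
    obtain ⟨m, hm⟩ := hi x hx; exact ⟨m, hm.symm⟩) (range_nonempty _)
  rw [hz hx, hz hy]; rfl

section hopf
variable {n : ℕ} {γ : Fin n → ℝ → ℂ} {s0 c : ℝ} {K : Set ℂ}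

def aa (γ : ℝ → ℂ) (t h : ℝ) : ℝ := (deriv γ (t + h) / (γ (t + h) - γ t)).im

lemma Dom.aa_bdd (D : Dom K γ s0 c) (i : Fin n) : ∃ C, ∀ t h, |h| ≤ 1/2 → |aa (γ i) t h| ≤ C := by
  obtain ⟨C, hC⟩ := D.sym_bdd i
  refine ⟨|C|, fun t h hh => ?_⟩
  by_cases h0 : h = 0
  · subst h0; simp [aa]
  · have := hC t 0 h (by simpa using D.s0pos.le) hh h0
    rw [sym_zero] at this
    exact this.trans (le_abs_self C)

lemma SC.aa_meas {γ : ℝ → ℂ} (S : SC γ) : Measurable (Function.uncurry (aa γ)) := by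
  have c1 := S.cont
  have c2 := S.cont1
  have m1 : Measurable fun p : ℝ × ℝ => deriv γ (p.1 + p.2) := (by fun_prop : Continuous _).measurable
  have m2 : Measurable fun p : ℝ × ℝ => γ (p.1 + p.2) - γ p.1 := (by fun_prop : Continuous _).measurable
  exact Complex.measurable_im.comp (m1.div m2)

lemma Dom.aa_fub (D : Dom K γ s0 c) (i : Fin n) :
    ∫ h in (-(1/2):ℝ)..(1/2), ∫ t in (0:ℝ)..1, aa (γ i) t h = Real.pi := by
  obtain ⟨C, hC⟩ := D.aa_bdd i
  have h1 : ∫ t in (0:ℝ)..1, ∫ h in (-(1/2):ℝ)..(1/2), aa (γ i) t h = Real.pi := by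
    have : ∀ t, ∫ h in (-(1/2):ℝ)..(1/2), aa (γ i) t h = Real.pi := fun t => D.half_wind i t
    rw [intervalIntegral.integral_congr (g := fun _ => Real.pi) fun t _ => this t]
    simp
  rw [← h1]
  simp only [intervalIntegral.integral_of_le (zero_le_one (α := ℝ)),
    intervalIntegral.integral_of_le (show (-(1/2):ℝ) ≤ 1/2 by norm_num)]
  symm
  apply MeasureTheory.integral_integral_swap
  rw [Measure.prod_restrict]
  refine Measure.integrableOn_of_bounded (M := C) ?_ (D.sc i).aa_meas.aestronglyMeasurable ?_
  · rw [Measure.prod_prod]; simp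
  · rw [ae_restrict_iff' (measurableSet_Ioc.prod measurableSet_Ioc)]
    refine Eventually.of_forall fun p hp => hC p.1 p.2 ?_
    exact abs_le.2 ⟨hp.2.1.le, hp.2.2⟩

lemma Dom.hopf (D : Dom K γ s0 c) (i : Fin n) :
    ∫ t in (0:ℝ)..1, deriv (deriv (γ i)) t / deriv (γ i) t = 2 * Real.pi * I := by
  have S := D.sc i
  obtain ⟨cl, hcl, hlow⟩ := S.sl_low
  set Y : ℝ → ℝ → ℂ := fun h t => sl (deriv (γ i)) t (t + h) with hYdef
  set Y' : ℝ → ℝ → ℂ := fun h t => sl (deriv (deriv (γ i))) t (t + h) with hYdef'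
  have hc1 : ContDiff ℝ 1 (γ i) := S.smooth.of_le (by simp)
  have hc2 : ContDiff ℝ 1 (deriv (γ i)) := S.smooth1.of_le (by simp)
  have eY : ∀ h t, γ i (t + h) - γ i t = (h : ℂ) * Y h t := fun h t => by
    have := sl_eq hc1 t (t + h); rwa [add_sub_cancel_left] at this
  have eY' : ∀ h t, deriv (γ i) (t + h) - deriv (γ i) t = (h : ℂ) * Y' h t := fun h t => by
    have := sl_eq hc2 t (t + h); rwa [add_sub_cancel_left] at this
  have hne : ∀ h t, |h| ≤ 1/2 → Y h t ≠ 0 := fun h t hh => by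
    have := hlow t (t + h) (by rw [add_sub_cancel_left]; linarith)
    exact norm_pos_iff.1 (hcl.trans_le this)
  have hd : ∀ h t, HasDerivAt (Y h) (Y' h t) t := by
    intro h t
    by_cases h0 : h = 0
    · subst h0
      have : Y 0 = deriv (γ i) := by ext t; simp [hYdef, sl_self]
      rw [this]; simp only [hYdef', add_zero, sl_self]
      exact (hc2.differentiable one_ne_zero t).hasDerivAt
    · have h0' : (h : ℂ) ≠ 0 := by exact_mod_cast h0
      have e : Y h = fun t => (γ i (t + h) - γ i t) / h := by
        ext t; rw [eY]; field_simp
      have e' : Y' h t = (deriv (γ i) (t + h) - deriv (γ i) t) / h := by rw [eY']; field_simp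
      rw [e, e']
      have d1 := (hc1.differentiable one_ne_zero (t + h)).hasDerivAt.comp_add_const t h
      have d2 := (hc1.differentiable one_ne_zero t).hasDerivAt
      exact (d1.sub d2).div_const _
  have cY : Continuous fun p : ℝ × ℝ => Y p.1 p.2 :=
    (sl_cont S.cont1).comp (by fun_prop : Continuous fun p : ℝ × ℝ => ((p.2, p.2 + p.1) : ℝ × ℝ))
  have cY' : Continuous fun p : ℝ × ℝ => Y' p.1 p.2 :=
    (sl_cont S.cont2).comp (by fun_prop : Continuous fun p : ℝ × ℝ => ((p.2, p.2 + p.1) : ℝ × ℝ))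
  have cY1 : ∀ h, Continuous (Y' h) := fun h => cY'.comp (by fun_prop : Continuous fun t : ℝ => ((h, t) : ℝ × ℝ))
  have cY0 : ∀ h, Continuous (Y h) := fun h => cY.comp (by fun_prop : Continuous fun t : ℝ => ((h, t) : ℝ × ℝ))
  have hper : ∀ h t, Y h (t + 1) = Y h t := fun h t => by
    simp only [hYdef]; rw [← sl_per S.per1 t (t + h)]; congr 1; ring
  set J : ℝ → ℂ := fun h => ∫ t in (0:ℝ)..1, Y' h t / Y h t with hJ
  have Jint : ∀ h, |h| ≤ 1/2 → ∃ m : ℤ, J h = 2 * Real.pi * I * m := fun h hh =>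
    wind_int (hd h) (cY1 h) (fun t => hne h t hh) (by simpa using hper h 0)
  have Jc : ContinuousOn J (Icc (-(1/2)) (1/2)) := by
    refine param_cont isCompact_Icc ?_
    exact (cY'.continuousOn).div cY.continuousOn fun p hp => hne p.1 p.2 (abs_le.2 ⟨hp.1.1, hp.1.2⟩)
  have hpi := Real.pi_pos
  have Jconst : ∀ h ∈ Icc (-(1/2):ℝ) (1/2), (J h).im = (J 0).im := by
    intro h hh
    have := int_const (f := fun h => (J h).im / (2 * Real.pi)) (a := -(1/2)) (b := 1/2)
      ((Complex.continuous_im.comp_continuousOn Jc).div_const _) (fun x hx => by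
        obtain ⟨m, hm⟩ := Jint x (abs_le.2 ⟨hx.1, hx.2⟩)
        refine ⟨m, ?_⟩
        rw [hm]
        have : (2 * Real.pi * I * m : ℂ).im = 2 * Real.pi * m := by simp
        rw [this]; field_simp) hh (y := 0) ⟨by norm_num, by norm_num⟩
    field_simp at this
    exact this
  -- average over h
  have Jim : ∀ h, |h| ≤ 1/2 → h ≠ 0 → (J h).im = (∫ t in (0:ℝ)..1, aa (γ i) t h) + ∫ t in (0:ℝ)..1, aa (γ i) t (-h) := by
    intro h hh h0
    have h0' : (h : ℂ) ≠ 0 := by exact_mod_cast h0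
    have hquot : Continuous fun t => Y' h t / Y h t := (cY1 h).div (cY0 h) fun t => hne h t hh
    have e1 := ContinuousLinearMap.intervalIntegral_comp_comm (𝕜 := ℝ) (L := Complex.imCLM) (f := fun t => Y' h t / Y h t) (μ := volume)
        (a := 0) (b := 1) (hquot.intervalIntegrable _ _)
    simp only [Complex.imCLM_apply] at e1
    have hp : Function.Periodic (fun t => aa (γ i) t (-h)) 1 := fun t => by
      simp only [aa]
      rw [show t + 1 + -h = (t + -h) + 1 by ring, S.per, S.per1, S.per]
    have e2 : ∫ t in (0:ℝ)..1, aa (γ i) t (-h) = ∫ t in (0:ℝ)..1, aa (γ i) (t + h) (-h) := by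
      rw [intervalIntegral.integral_comp_add_right (fun t => aa (γ i) t (-h))]
      have := hp.intervalIntegral_add_eq 0 (0 + h)
      rw [zero_add] at this
      rw [this]; congr 1; ring
    have hne2 : ∀ t, γ i (t + h) - γ i t ≠ 0 := fun t => by rw [eY]; exact mul_ne_zero h0' (hne h t hh)
    have c1 := S.cont
    have c2 := S.cont1
    have i1 : Continuous fun t => aa (γ i) t h := by
      unfold aa
      exact Complex.continuous_im.comp (Continuous.div (by fun_prop) (by fun_prop) hne2)
    have ea : ∀ t, aa (γ i) (t + h) (-h) = (deriv (γ i) t / (γ i t - γ i (t + h))).im := fun t => by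
      unfold aa; rw [add_neg_cancel_right]
    have i2 : Continuous fun t => aa (γ i) (t + h) (-h) := by
      simp only [ea]
      refine Complex.continuous_im.comp (Continuous.div (by fun_prop) (by fun_prop) fun t => ?_)
      rw [← neg_sub]; exact neg_ne_zero.2 (hne2 t)
    rw [e2, ← intervalIntegral.integral_add (i1.intervalIntegrable _ _) (i2.intervalIntegrable _ _), hJ]
    simp only
    rw [← e1]
    refine intervalIntegral.integral_congr fun t _ => ?_
    simp only [aa, add_neg_cancel_right]
    rw [← Complex.add_im]
    congr 1
    have h3 := hne2 t
    have : Y' h t / Y h t = (deriv (γ i) (t + h) - deriv (γ i) t) / (γ i (t + h) - γ i t) := by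
      rw [eY, eY', mul_div_mul_left _ _ h0']
    rw [this, ← neg_sub (γ i (t + h)) (γ i t), div_neg, sub_div, sub_eq_add_neg]
  have hav : ∫ h in (-(1/2):ℝ)..(1/2), (J h).im = (J 0).im := by
    rw [intervalIntegral.integral_congr (g := fun _ => (J 0).im) (fun h hh => by
      rw [uIcc_of_le (by norm_num)] at hh; exact Jconst h hh)]
    simp; norm_num
  have hA := D.aa_fub i
  set A : ℝ → ℝ := fun h => ∫ t in (0:ℝ)..1, aa (γ i) t h with hAdef
  have hAi : IntervalIntegrable A volume (-(1/2)) (1/2) := by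
    by_contra hn
    rw [intervalIntegral.integral_undef hn] at hA
    linarith
  have hAi' : IntervalIntegrable (fun h => A (-h)) volume (-(1/2)) (1/2) := by
    have := ((IntervalIntegrable.iff_comp_neg (f := A) (a := -(1/2)) (b := 1/2)).1 hAi).symm
    simpa using this
  have hA' : ∫ h in (-(1/2):ℝ)..(1/2), A (-h) = Real.pi := by
    rw [intervalIntegral.integral_comp_neg, neg_neg, hA]
  have h2 : ∫ h in (-(1/2):ℝ)..(1/2), (J h).im = 2 * Real.pi := by
    rw [intervalIntegral.integral_congr_ae (g := fun h => A h + A (-h)), intervalIntegral.integral_add hAi hAi', hA, hA']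
    · ring
    · filter_upwards [ae_ne_zero] with h h0 hh
      exact Jim h (mem_win hh) h0
  rw [hav] at h2
  have J0 : J 0 = ∫ t in (0:ℝ)..1, deriv (deriv (γ i)) t / deriv (γ i) t := by
    simp [hJ, hYdef, hYdef', sl_self]
  rw [← J0]
  obtain ⟨m, hm⟩ := Jint 0 (by norm_num)
  rw [hm] at h2 ⊢
  have : (2 * Real.pi * I * m : ℂ).im = 2 * Real.pi * m := by simp
  rw [this] at h2
  have : (m : ℝ) = 1 := by nlinarith
  have : m = 1 := by exact_mod_cast this
  rw [this]; simp

end hopf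

lemma iso_of_conn {V : Set ℂ} {G : ℂ → ℂ} (hV : IsOpen V) (hc : IsPreconnected V) (hG : DifferentiableOn ℂ G V)
    {x : ℂ} (hx : x ∈ V) (h0 : G x ≠ 0) : ∀ z ∈ V, ∀ᶠ w in 𝓝[≠] z, G w ≠ 0 := by
  intro z hz
  have ha := hG.analyticOnNhd hV
  rcases (ha z hz).eventually_eq_zero_or_eventually_ne_zero with h | h
  · exact absurd (ha.eqOn_zero_of_preconnected_of_eventuallyEq_zero hc hz h hx) h0
  · exact h

lemma fin_zeros {C : Set ℂ} {G : ℂ → ℂ} (hC : IsCompact C) (h : ∀ z ∈ C, ∀ᶠ w in 𝓝[≠] z, G w ≠ 0) :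
    {z | z ∈ C ∧ G z = 0}.Finite := by
  by_contra hinf
  obtain ⟨x, hx, hacc⟩ := Set.Infinite.exists_accPt_of_subset_isCompact hinf hC (fun z hz => hz.1)
  rw [accPt_iff_frequently_nhdsNE] at hacc
  exact hacc ((h x hx).mono fun w hw hw2 => hw hw2.2)

lemma factor_aux {V C : Set ℂ} (hV : IsOpen V) (hCV : C ⊆ V) (S : Finset ℂ) :
    ∀ G : ℂ → ℂ, DifferentiableOn ℂ G V → (↑S ⊆ V) → (∀ z ∈ S, ∀ᶠ w in 𝓝[≠] z, G w ≠ 0) →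
    (∀ z ∈ C, G z = 0 → z ∈ S) →
    ∃ (m : ℂ → ℕ) (G1 : ℂ → ℂ), DifferentiableOn ℂ G1 V ∧ (∀ z ∈ V, G z = (∏ b ∈ S, (z - b) ^ m b) * G1 z) ∧
      ∀ z ∈ C, G1 z ≠ 0 := by
  classical
  induction S using Finset.induction_on with
  | empty =>
    intro G hG _ _ h0
    exact ⟨fun _ => 0, G, hG, fun z _ => by simp, fun z hz h => by simpa using h0 z hz h⟩
  | insert b S hb ih =>
    intro G hG hSV hne h0
    have hbV : b ∈ V := hSV (by simp)
    have ha := hG.analyticOnNhd hV b hbV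
    have hn : ¬ ∀ᶠ z in 𝓝 b, G z = 0 := by
      intro h
      have h1 := hne b (by simp)
      obtain ⟨w, hw⟩ := (h1.and (h.filter_mono nhdsWithin_le_nhds)).exists
      exact hw.1 hw.2
    obtain ⟨k, g, hga, hgb, hge⟩ := (ha.exists_eventuallyEq_pow_smul_nonzero_iff).2 hn
    set G2 : ℂ → ℂ := Function.update (fun z => G z / (z - b) ^ k) b (g b) with hG2
    have h2 : ∀ z, z ≠ b → G2 z = G z / (z - b) ^ k := fun z hz => by simp [hG2, hz]
    have h2b : G2 b = g b := by simp [hG2]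
    have hloc : G2 =ᶠ[𝓝 b] g := by
      filter_upwards [hge] with z hz
      by_cases hzb : z = b
      · rw [hzb, h2b]
      · rw [h2 z hzb, hz, smul_eq_mul, mul_div_cancel_left₀ _ (pow_ne_zero _ (sub_ne_zero.2 hzb))]
    have hnear : ∀ z, z ≠ b → G2 =ᶠ[𝓝 z] fun z => G z / (z - b) ^ k := fun z hz => by
      filter_upwards [isOpen_ne.mem_nhds hz] with w hw using h2 w hw
    have hG2d : DifferentiableOn ℂ G2 V := by
      intro z hz
      by_cases hzb : z = b
      · subst hzb
        exact (hga.differentiableAt.congr_of_eventuallyEq hloc).differentiableWithinAt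
      · refine (DifferentiableAt.congr_of_eventuallyEq ?_ (hnear z hzb)).differentiableWithinAt
        exact (hG.differentiableAt (hV.mem_nhds hz)).div (by fun_prop) (pow_ne_zero _ (sub_ne_zero.2 hzb))
    have hG2e : ∀ z ∈ V, G z = (z - b) ^ k * G2 z := by
      intro z hz
      by_cases hzb : z = b
      · rw [hzb, h2b]; exact hge.self_of_nhds
      · rw [h2 z hzb, mul_div_cancel₀ _ (pow_ne_zero _ (sub_ne_zero.2 hzb))]
    obtain ⟨m, G1, d1, e1, n1⟩ := ih G2 hG2d (fun z hz => hSV (by simp at hz; simp [hz])) (by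
        intro z hz
        have hzb : z ≠ b := fun h => hb (h ▸ hz)
        filter_upwards [hne z (by simp [hz]), nhdsWithin_le_nhds (isOpen_ne.mem_nhds hzb)] with w hw hwb
        rw [h2 w hwb]
        exact div_ne_zero hw (pow_ne_zero _ (sub_ne_zero.2 hwb))) (by
        intro z hz h
        by_cases hzb : z = b
        · rw [hzb, h2b] at h; exact absurd h hgb
        · have := h0 z hz (by rw [hG2e z (hCV hz), h, mul_zero])
          simpa [hzb] using this)
    refine ⟨Function.update m b k, G1, d1, fun z hz => ?_, n1⟩
    rw [Finset.prod_insert hb, hG2e z hz, e1 z hz, Function.update_self, mul_assoc]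
    congr 2
    apply Finset.prod_congr rfl
    intro x hx
    rw [Function.update_of_ne]
    exact fun h => hb (h ▸ hx)

lemma factor {V C : Set ℂ} {G : ℂ → ℂ} (hV : IsOpen V) (hCV : C ⊆ V) (hC : IsCompact C) (hG : DifferentiableOn ℂ G V)
    (hne : ∀ z ∈ V, ∀ᶠ w in 𝓝[≠] z, G w ≠ 0) :
    ∃ (S : Finset ℂ) (m : ℂ → ℕ) (G1 : ℂ → ℂ), (∀ b ∈ S, b ∈ C ∧ G b = 0) ∧ DifferentiableOn ℂ G1 V ∧
      (∀ z ∈ V, G z = (∏ b ∈ S, (z - b) ^ m b) * G1 z) ∧ (∀ z ∈ C, G1 z ≠ 0) ∧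
      (∀ z ∈ V, G z ≠ 0 → deriv G z / G z = (∑ b ∈ S, (m b : ℂ) / (z - b)) + deriv G1 z / G1 z) := by
  have hfin := fin_zeros hC (fun z hz => hne z (hCV hz))
  have hS : ∀ b ∈ hfin.toFinset, b ∈ C ∧ G b = 0 := fun b hb => by simpa using hb
  obtain ⟨m, G1, h1, h2, h3⟩ := factor_aux hV hCV hfin.toFinset G hG (fun z hz => hCV (hS z hz).1)
    (fun z hz => hne z (hCV (hS z hz).1)) (fun z hz h => by simp [hz, h])
  refine ⟨hfin.toFinset, m, G1, hS, h1, h2, h3, fun z hz hGz => ?_⟩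
  have e : G =ᶠ[𝓝 z] fun z => (∏ b ∈ hfin.toFinset, (z - b) ^ m b) * G1 z := by
    filter_upwards [hV.mem_nhds hz] with w hw using h2 w hw
  have hz2 := h2 z hz
  have hp : (∏ b ∈ hfin.toFinset, (z - b) ^ m b) ≠ 0 := fun h => hGz (by rw [hz2, h, zero_mul])
  have hg1 : G1 z ≠ 0 := fun h => hGz (by rw [hz2, h, mul_zero])
  have := logDeriv_congr_nhds e
  rw [← logDeriv_apply, this.self_of_nhds, logDeriv_mul z hp hg1 (by fun_prop) (h1.differentiableAt (hV.mem_nhds hz)),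
    logDeriv_apply G1, logDeriv_prod (fun b hb => Finset.prod_ne_zero_iff.1 hp b hb) (fun b _ => by fun_prop)]
  congr 1
  apply Finset.sum_congr rfl
  intro b hb
  rw [logDeriv_fun_pow (by fun_prop), logDeriv_apply]
  simp [div_eq_mul_inv]

/-- logarithmic integral along a parallel curve -/
def lw (γ : ℝ → ℂ) (G : ℂ → ℂ) (s : ℝ) : ℂ := ∫ t in (0:ℝ)..1, logDeriv G (par γ t s) * dpar γ t s

section lw
variable {γ : ℝ → ℂ} {G H : ℂ → ℂ} {V : Set ℂ} {s : ℝ}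

lemma SC.comp_hasD (h : SC γ) (hV : IsOpen V) (hG : DifferentiableOn ℂ G V) (hs : ∀ t, par γ t s ∈ V) (t : ℝ) :
    HasDerivAt (fun t => G (par γ t s)) (deriv G (par γ t s) * dpar γ t s) t :=
  (hG.differentiableAt (hV.mem_nhds (hs t))).hasDerivAt.comp t (h.par_hasD t s)

lemma SC.comp_cont (h : SC γ) (hG : ContinuousOn G V) (hs : ∀ t, par γ t s ∈ V) :
    Continuous (fun t => G (par γ t s)) :=
  hG.comp_continuous (h.par_cont' s) hs

lemma SC.ld_cont (h : SC γ) (hV : IsOpen V) (hG : DifferentiableOn ℂ G V) (hs : ∀ t, par γ t s ∈ V)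
    (h0 : ∀ t, G (par γ t s) ≠ 0) : Continuous (fun t => logDeriv G (par γ t s) * dpar γ t s) := by
  have h1 := h.comp_cont hG.continuousOn hs
  have h2 := h.comp_cont (hG.deriv hV).continuousOn hs
  simp only [logDeriv_apply]
  exact (h2.div h1 h0).mul (h.dpar_cont' s)

lemma SC.par_one (h : SC γ) (s : ℝ) : par γ 1 s = par γ 0 s := by
  have := h.par_per s 0
  simpa using this

lemma SC.lw_mul (h : SC γ) (hV : IsOpen V) (hG : DifferentiableOn ℂ G V) (hH : DifferentiableOn ℂ H V)
    (hs : ∀ t, par γ t s ∈ V) (h0 : ∀ t, G (par γ t s) ≠ 0) (h1 : ∀ t, H (par γ t s) ≠ 0) :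
    lw γ (fun z => G z * H z) s = lw γ G s + lw γ H s := by
  unfold lw
  rw [← intervalIntegral.integral_add ((h.ld_cont hV hG hs h0).intervalIntegrable _ _)
    ((h.ld_cont hV hH hs h1).intervalIntegrable _ _)]
  congr 1; ext t
  rw [logDeriv_mul _ (h0 t) (h1 t) (hG.differentiableAt (hV.mem_nhds (hs t))) (hH.differentiableAt (hV.mem_nhds (hs t)))]
  ring

lemma lw_congr (hV : IsOpen V) (hs : ∀ t, par γ t s ∈ V) (e : ∀ z ∈ V, G z = H z) : lw γ G s = lw γ H s := by
  unfold lw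
  congr 1; ext t
  rw [(logDeriv_congr_nhds (f := G) (g := H) ?_).self_of_nhds]
  filter_upwards [hV.mem_nhds (hs t)] with w hw using e w hw

lemma SC.lw_int (h : SC γ) (hV : IsOpen V) (hG : DifferentiableOn ℂ G V)
    (hs : ∀ t, par γ t s ∈ V) (h0 : ∀ t, G (par γ t s) ≠ 0) : ∃ m : ℤ, lw γ G s = 2 * Real.pi * I * m := by
  have h2 := h.comp_cont (hG.deriv hV).continuousOn hs
  obtain ⟨m, hm⟩ := wind_int (fun t => h.comp_hasD hV hG hs t) (h2.mul (h.dpar_cont' s)) h0 (by rw [h.par_one])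
  refine ⟨m, ?_⟩
  rw [← hm]; unfold lw
  congr 1; ext t; rw [logDeriv_apply]; ring

lemma SC.lw_zero (h : SC γ) (hV : IsOpen V) (hG : DifferentiableOn ℂ G V)
    (hs : ∀ t, par γ t s ∈ V) (h0 : ∀ t, 0 < (G (par γ t s)).re) : lw γ G s = 0 := by
  have h2 := h.comp_cont (hG.deriv hV).continuousOn hs
  have hm := wind_zero (fun t => h.comp_hasD hV hG hs t) (h2.mul (h.dpar_cont' s)) h0 (by rw [h.par_one])
  rw [← hm]; unfold lw
  congr 1; ext t; rw [logDeriv_apply]; ring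

lemma SC.lw_hopf (h : SC γ) (hV : IsOpen V) (hG : DifferentiableOn ℂ G V)
    (hh : ∫ t in (0:ℝ)..1, deriv (deriv γ) t / deriv γ t = 2 * Real.pi * I) {κ : ℂ}
    (hs : ∀ t, par γ t s ∈ V) (h0 : ∀ t, 0 < (G (par γ t s) * deriv γ t / κ).re) : lw γ G s = - (2 * Real.pi * I) := by
  have h2 := h.comp_cont (hG.deriv hV).continuousOn hs
  have h1 := h.comp_cont hG.continuousOn hs
  have hne : ∀ t, G (par γ t s) ≠ 0 ∧ deriv γ t ≠ 0 ∧ κ ≠ 0 := by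
    intro t
    refine ⟨fun e => ?_, h.reg t, fun e => ?_⟩ <;> have := h0 t <;> simp [e] at this
  have hm := wind_zero (fun t => ((h.comp_hasD hV hG hs t).mul (h.hasD1 t)).div_const κ)
    ((((h2.mul (h.dpar_cont' s)).mul h.cont1).add (h1.mul h.cont2)).div_const κ) h0 (by
      have := h.per1 0; simp only [zero_add] at this
      simp only [Pi.mul_apply]
      rw [h.par_one, this])
  have e : ∀ t, (deriv G (par γ t s) * dpar γ t s * deriv γ t + G (par γ t s) * deriv (deriv γ) t) / κ /
     (G (par γ t s) * deriv γ t / κ) = logDeriv G (par γ t s) * dpar γ t s + deriv (deriv γ) t / deriv γ t := by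
    intro t
    obtain ⟨a, b, d⟩ := hne t
    rw [logDeriv_apply]; field_simp
  simp only [Pi.mul_apply, e] at hm
  have i2 : IntervalIntegrable (fun t => deriv (deriv γ) t / deriv γ t) volume 0 1 :=
    (h.cont2.div h.cont1 h.reg).intervalIntegrable _ _
  rw [intervalIntegral.integral_add ((h.ld_cont hV hG hs fun t => (hne t).1).intervalIntegrable _ _) i2, hh] at hm
  unfold lw
  linear_combination hm

lemma SC.lw_factor (h : SC γ) (hV : IsOpen V) {G1 : ℂ → ℂ} (hG1 : DifferentiableOn ℂ G1 V) {S : Finset ℂ} {m : ℂ → ℕ}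
    (hs : ∀ t, par γ t s ∈ V) (h0 : ∀ t, G (par γ t s) ≠ 0) (h1 : ∀ t, G1 (par γ t s) ≠ 0)
    (hb : ∀ b ∈ S, G b = 0)
    (e : ∀ z ∈ V, G z ≠ 0 → deriv G z / G z = (∑ b ∈ S, (m b : ℂ) / (z - b)) + deriv G1 z / G1 z) :
    lw γ G s = (∑ b ∈ S, (m b : ℂ) * wds γ s b) + lw γ G1 s := by
  unfold lw
  have hne : ∀ b ∈ S, ∀ t, par γ t s - b ≠ 0 := by
    intro b hbS t h; apply h0 t; rw [sub_eq_zero.1 h]; exact hb b hbS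
  have hcont : ∀ b ∈ S, Continuous (fun t => (m b : ℂ) * (dpar γ t s / (par γ t s - b))) := by
    intro b hbS
    exact continuous_const.mul ((h.dpar_cont' s).div ((h.par_cont' s).sub continuous_const) (hne b hbS))
  have : ∀ t, logDeriv G (par γ t s) * dpar γ t s = (∑ b ∈ S, (m b : ℂ) * (dpar γ t s / (par γ t s - b))) +
      logDeriv G1 (par γ t s) * dpar γ t s := by
    intro t
    rw [logDeriv_apply, e _ (hs t) (h0 t), add_mul, Finset.sum_mul, logDeriv_apply]
    congr 1
    apply Finset.sum_congr rfl; intro b _; ring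
  simp only [this]
  rw [intervalIntegral.integral_add (Continuous.intervalIntegrable (continuous_finsetSum _ hcont) _ _)
    ((h.ld_cont hV hG1 hs h1).intervalIntegrable _ _),
    intervalIntegral.integral_finsetSum (fun b hb => (hcont b hb).intervalIntegrable _ _)]
  congr 1
  apply Finset.sum_congr rfl; intro b _
  rw [intervalIntegral.integral_const_mul]; rfl

end lw

section coll
variable {n : ℕ} {γ : Fin n → ℝ → ℂ} {s0 c : ℝ} {K : Set ℂ}

lemma Dom.collar_count (D : Dom K γ s0 c) (i : Fin n) {V : Set ℂ} {G : ℂ → ℂ} (hV : IsOpen V) (hG : DifferentiableOn ℂ G V)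
    (hne : ∀ z ∈ V, ∀ᶠ w in 𝓝[≠] z, G w ≠ 0) {a b s r : ℝ} (ha : -s0 < a) (has : a < s) (hsr : s < r) (hrb : r < b)
    (hb : b < s0) (hab : ∀ t, ∀ s ∈ Icc a b, par (γ i) t s ∈ V) (hs0 : ∀ t, G (par (γ i) t s) ≠ 0)
    (hr0 : ∀ t, G (par (γ i) t r) ≠ 0) : ∃ N : ℕ, lw (γ i) G s - lw (γ i) G r = 2 * Real.pi * I * N := by
  have S := D.sc i
  set C := (fun p : ℝ × ℝ => par (γ i) p.1 p.2) '' (univ ×ˢ Icc a b) with hC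
  have hCV : C ⊆ V := by
    rintro _ ⟨⟨t, s⟩, ⟨_, h⟩, rfl⟩; exact hab t s h
  have hmem : ∀ t, ∀ s ∈ Icc a b, par (γ i) t s ∈ C := fun t s h => ⟨(t, s), ⟨mem_univ _, h⟩, rfl⟩
  obtain ⟨Z, m, G1, hZ, hG1, _, hG10, he⟩ := factor hV hCV (levelset_compact S a b) hG hne
  have ms : s ∈ Icc a b := ⟨has.le, by linarith⟩
  have mr : r ∈ Icc a b := ⟨by linarith, hrb.le⟩
  rw [S.lw_factor hV hG1 (fun t => hab t s ms) hs0 (fun t => hG10 _ (hmem t s ms)) (fun b hb => (hZ b hb).2) he,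
    S.lw_factor hV hG1 (fun t => hab t r mr) hr0 (fun t => hG10 _ (hmem t r mr)) (fun b hb => (hZ b hb).2) he]
  have hc : lw (γ i) G1 s = lw (γ i) G1 r := by
    unfold lw
    have hVo : IsOpen (V ∩ {z | G1 z ≠ 0}) := hG1.continuousOn.isOpen_inter_preimage hV isOpen_ne
    refine collar_int_const S hVo (G := logDeriv G1) (a := a) (b := b) ?_ ?_ ⟨has, by linarith⟩ ⟨by linarith, hrb⟩
    · intro z hz
      have d1 := (hG1.deriv hV).differentiableAt (hV.mem_nhds hz.1)
      have d2 := hG1.differentiableAt (hV.mem_nhds hz.1)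
      exact (d1.div d2 hz.2).differentiableWithinAt
    · intro t s h
      have h' : s ∈ Icc a b := ⟨h.1.le, h.2.le⟩
      exact ⟨hab t s h', hG10 _ (hmem t s h')⟩
  rw [hc]
  have key : ∀ z ∈ Z, ∃ N : ℕ, (m z : ℂ) * wds (γ i) s z - (m z : ℂ) * wds (γ i) r z = 2 * Real.pi * I * N := by
    intro z hz
    obtain ⟨⟨⟨t, σ⟩, ⟨_, hσ⟩, rfl⟩, h0⟩ := hZ z hz
    simp only at h0 ⊢
    have h1 : σ ≠ s := by rintro rfl; exact hs0 t h0
    have h2 : σ ≠ r := by rintro rfl; exact hr0 t h0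
    obtain ⟨h3, h4⟩ := hσ
    simp only at h3 h4
    rcases lt_or_gt_of_ne h1 with h1 | h1
    · rw [D.wds_neg i (by linarith) h1 (by linarith), D.wds_neg i (by linarith) (by linarith) (by linarith)]
      exact ⟨0, by simp⟩
    · rcases lt_or_gt_of_ne h2 with h2 | h2
      · rw [D.wds_pos i (by linarith) h1 (by linarith), D.wds_neg i (by linarith) h2 (by linarith)]
        exact ⟨m (par (γ i) t σ), by ring⟩
      · rw [D.wds_pos i (by linarith) h1 (by linarith), D.wds_pos i (by linarith) h2 (by linarith)]
        exact ⟨0, by simp⟩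
  choose! N hN using key
  refine ⟨∑ z ∈ Z, N z, ?_⟩
  push_cast
  rw [Finset.mul_sum, ← Finset.sum_congr rfl hN, Finset.sum_sub_distrib]
  ring

lemma Fam.k_exists (F : Fam γ s0 c) (i : Fin n) : ∃ (σ : ℝ) (k : ℂ → ℂ), 0 < σ ∧ σ ≤ s0 ∧
    DifferentiableOn ℂ k (band (γ i) (-σ) σ) ∧ ∀ t, 0 < (k (γ i t) * deriv (γ i) t).re := by
  have h := F.sc i
  obtain ⟨δ, C, hδ, hδ2, hC, hP⟩ := h.poisson F.cpos (F.near i)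
  have hs0 := F.s0pos
  obtain ⟨s, hs, hss⟩ : ∃ s, 0 < s ∧ s ≤ min s0 (min δ (1/(64*C))) := ⟨_, by positivity, le_rfl⟩
  have hs1 : s ≤ s0 := hss.trans (min_le_left _ _)
  have hs2 : s ≤ δ := (hss.trans (min_le_right _ _)).trans (min_le_left _ _)
  have hs3 : C * s < 1/32 := by
    have : s ≤ 1/(64*C) := (hss.trans (min_le_right _ _)).trans (min_le_right _ _)
    calc C * s ≤ C * (1/(64*C)) := by gcongr
      _ = 1/64 := by field_simp
      _ < _ := by norm_num
  have habs : |s| ≤ s0 := by rwa [abs_of_pos hs]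
  refine ⟨s, fun z => (CT (fun t => par (γ i) t (-s)) (fun _ => 1) z - CT (fun t => par (γ i) t s) (fun _ => 1) z) / I,
    hs, hs1, ?_, fun t => ?_⟩
  · have key : ∀ r, |r| = s → DifferentiableOn ℂ (CT (fun t => par (γ i) t r) (fun _ => 1)) (band (γ i) (-s) s) := by
      intro r hr
      refine (CT_diffOn (h.par_cont' r) continuous_const).mono ?_
      rintro z hz ⟨t, _, e⟩
      obtain ⟨t', s', h1, h2, e'⟩ := mem_band.1 hz
      have := (F.par_inj (hr.le.trans hs1) (abs_le.2 ⟨by linarith, by linarith⟩) (e.trans e'.symm)).2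
      rw [this] at hr
      have := abs_lt.2 ⟨h1, h2⟩
      linarith
    exact ((key (-s) (by rw [abs_neg, abs_of_pos hs])).sub (key s (abs_of_pos hs))).div_const _
  have ne1 : ∀ τ, par (γ i) τ s - γ i t ≠ 0 := by
    intro τ h0
    rw [← par_zero (γ i) t, sub_eq_zero] at h0
    have := (F.par_inj habs (by simpa using hs0.le) h0).2; linarith
  have ne2 : ∀ τ, par (γ i) τ (-s) - γ i t ≠ 0 := by
    intro τ h0
    rw [← par_zero (γ i) t, sub_eq_zero] at h0
    have := (F.par_inj (by rwa [abs_neg]) (by simpa using hs0.le) h0).2; linarith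
  have hc := h.cont
  have hc1 := h.cont1
  have e0 : ∀ τ, (γ i t - γ i τ)^2 + s^2 * deriv (γ i) τ ^2 = (par (γ i) τ (-s) - γ i t) * (par (γ i) τ s - γ i t) := by
    intro τ
    simp only [par]; push_cast; ring_nf; simp only [I_sq]; ring
  have hPKc : Continuous (fun τ => PK (γ i) τ t s) := by
    unfold PK
    refine Continuous.div (by fun_prop) (by fun_prop) ?_
    intro τ; rw [e0]; exact mul_ne_zero (ne2 τ) (ne1 τ)
  have e1 : (CT (fun t => par (γ i) t (-s)) (fun _ => 1) (γ i t) - CT (fun t => par (γ i) t s) (fun _ => 1) (γ i t)) / I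
     * deriv (γ i) t = ∫ τ in (0:ℝ)..1, PK (γ i) τ t s := by
    unfold CT
    rw [← intervalIntegral.integral_sub, ← intervalIntegral.integral_div, ← intervalIntegral.integral_mul_const]
    · congr 1; ext τ
      unfold PK
      rw [e0, div_sub_div _ _ (ne2 τ) (ne1 τ), div_div, mul_comm _ I, ← div_div, div_mul_eq_mul_div]
      congr 1
      simp only [par]; push_cast
      rw [div_mul_eq_mul_div, div_eq_iff I_ne_zero]; ring
    · exact (Continuous.div continuous_const ((h.par_cont' (-s)).sub continuous_const) ne2).intervalIntegrable _ _
    · exact (Continuous.div continuous_const ((h.par_cont' s).sub continuous_const) ne1).intervalIntegrable _ _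
  have e2 : (∫ τ in (0:ℝ)..1, PK (γ i) τ t s).re = ∫ τ in (0:ℝ)..1, (PK (γ i) τ t s).re := by
    have := Complex.reCLM.intervalIntegral_comp_comm (hPKc.intervalIntegrable (μ := volume) 0 1)
    exact this.symm
  rw [e1, e2]
  refine int_pos_of_poisson (t := t) (Complex.continuous_re.comp hPKc) ?_ hδ2 hC hs hs2 hs3 (fun τ hτ => ?_)
    (fun τ hτ hτ2 => (Complex.abs_re_le_norm _).trans ?_)
  · intro τ
    simp only [PK, h.per τ, h.per1 τ]
  · have := (hP τ t s hs hs1).1 (by rwa [abs_sub_comm])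
    rwa [sub_sq_comm]
  · exact (hP τ t s hs hs1).2 (by rwa [abs_sub_comm]) (by rwa [abs_sub_comm])

lemma tube {f : ℝ → ℝ → ℝ} (hp : ∀ t s, f (t + 1) s = f t s)
    (hc : ∀ t, ContinuousWithinAt (fun p : ℝ × ℝ => f p.1 p.2) (univ ×ˢ Iic 0) (t, 0)) (h0 : ∀ t, 0 < f t 0) :
    ∃ ε, 0 < ε ∧ ∀ t s, -ε ≤ s → s ≤ 0 → 0 < f t s := by
  have h1 : ∀ t ∈ Icc (0:ℝ) 1, ∀ᶠ z : ℝ × ℝ in 𝓝 (0, t), z.1 ≤ 0 → 0 < f z.2 z.1 := by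
    intro t _
    have := (hc t).eventually (lt_mem_nhds (h0 t))
    rw [eventually_nhdsWithin_iff] at this
    have h2 : Tendsto (fun z : ℝ × ℝ => (z.2, z.1)) (𝓝 (0, t)) (𝓝 (t, 0)) := by
      exact (continuous_swap.tendsto ((0:ℝ), t))
    filter_upwards [h2.eventually this] with z hz hz0 using hz ⟨mem_univ _, hz0⟩
  have h2 := isCompact_Icc.eventually_forall_of_forall_eventually
    (P := fun s t : ℝ => s ≤ 0 → 0 < f t s) h1
  obtain ⟨ε, hε, hb⟩ := Metric.eventually_nhds_iff.1 h2
  refine ⟨ε/2, by positivity, fun t s h3 h4 => ?_⟩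
  have h5 := hb (y := s) (by rw [Real.dist_eq, sub_zero, abs_lt]; constructor <;> linarith) (Int.fract t)
    ⟨Int.fract_nonneg t, (Int.fract_lt_one t).le⟩ h4
  have : Function.Periodic (fun t => f t s) 1 := fun t => hp t s
  have e : f t s = f (Int.fract t) s := by
    have := this.sub_int_mul_eq (x := t) ⌊t⌋
    simp only [mul_one] at this
    exact this.symm
  rw [e]; exact h5
end coll

section wn
variable {n : ℕ} {γ : Fin n → ℝ → ℂ} {s0 c : ℝ} {K : Set ℂ}

lemma Dom.nint (D : Dom K γ s0 c) (i : Fin n) {t s : ℝ} (h1 : -s0 ≤ s) (h2 : s ≤ 0) : par (γ i) t s ∈ (interior K)ᶜ := by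
  rcases h2.lt_or_eq with h | h
  · exact fun hm => D.neg i t s h h1 (interior_subset hm)
  · rw [h, par_zero]
    have := D.fr i t
    rw [D.comp.isClosed.frontier_eq] at this
    exact this.2

lemma Dom.p_cont (D : Dom K γ s0 c) (i : Fin n) {p : ℂ → ℂ} (hpc : ContinuousOn p (interior K)ᶜ) (t : ℝ) :
    ContinuousWithinAt (fun q : ℝ × ℝ => p (par (γ i) q.1 q.2)) (univ ×ˢ Iic 0) (t, 0) := by
  have h1 := hpc (par (γ i) t 0) (D.nint i (by linarith [D.s0pos]) le_rfl)
  refine Tendsto.comp (y := 𝓝[(interior K)ᶜ] (par (γ i) t 0)) h1 (tendsto_nhdsWithin_iff.2 ⟨?_, ?_⟩)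
  · exact ((D.sc i).par_cont.tendsto (t, (0:ℝ))).mono_left nhdsWithin_le_nhds
  · have h2 : ∀ᶠ q : ℝ × ℝ in 𝓝 (t, (0:ℝ)), -s0 < q.2 :=
      (continuous_snd.tendsto (t, (0:ℝ))).eventually (lt_mem_nhds (by simpa using D.s0pos))
    filter_upwards [nhdsWithin_le_nhds h2, self_mem_nhdsWithin] with q hq1 hq2
    exact D.nint i hq1.le hq2.2

lemma Dom.wind_nonneg (D : Dom K γ s0 c) (i : Fin n) {p : ℂ → ℂ} {κ : ℂ} (hp : DifferentiableOn ℂ p Kᶜ)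
    (hpc : ContinuousOn p (interior K)ᶜ) (hκ : κ ≠ 0)
    (hb : ∀ t, ∃ ρ : ℝ, 0 ≤ ρ ∧ p (γ i t) ^ 2 * deriv (γ i) t = κ * ρ) :
    ∃ σ, 0 < σ ∧ σ ≤ s0 ∧ ∀ s, -σ < s → s < 0 → (∀ t, p (par (γ i) t s) ≠ 0) →
      ∃ m : ℕ, lw (γ i) p s = 2 * Real.pi * I * m := by
  obtain ⟨σ, k, hσ, hσ0, hk, hkp⟩ := D.k_exists i
  have S := D.sc i
  refine ⟨σ, hσ, hσ0, fun s hs hs0 hps => ?_⟩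
  set V := band (γ i) (-σ) 0 with hVd
  have hV : IsOpen V := D.band_open i (by linarith) (by linarith [D.s0pos])
  have hVK : V ⊆ Kᶜ := by
    intro z hz
    obtain ⟨t, s, h1, h2, rfl⟩ := mem_band.1 hz
    exact D.neg i t s h2 (by linarith)
  have hkV : DifferentiableOn ℂ k V := hk.mono (by
    intro z hz
    obtain ⟨t, s, h1, h2, rfl⟩ := mem_band.1 hz
    exact mem_band.2 ⟨t, s, h1, by linarith, rfl⟩)
  have hpV := hp.mono hVK
  have hmV : ∀ t s, -σ < s → s < 0 → par (γ i) t s ∈ V := fun t s h1 h2 => mem_band.2 ⟨t, s, h1, h2, rfl⟩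
  have hsV := fun t => hmV t s hs hs0
  have hpcs := S.comp_cont hpV.continuousOn hsV
  have hkcs := S.comp_cont hkV.continuousOn hsV
  obtain ⟨C, hC, hCb⟩ := per_bdd (f := fun t => κ * k (par (γ i) t s) / p (par (γ i) t s) ^ 2) (by
    intro t; simp only [S.par_per s t]) (by
    exact (continuous_const.mul hkcs).div (hpcs.pow 2) (fun t => pow_ne_zero _ (hps t)))
  set ε : ℝ := 1 / (2 * C) with hε
  have hεp : 0 < ε := by positivity
  set P : ℂ → ℂ := fun z => p z ^ 2 + ε * κ * k z with hP
  have hPV : DifferentiableOn ℂ P V := (hpV.pow 2).add (hkV.const_mul _)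
  set f : ℝ → ℝ → ℝ := fun t s => (P (par (γ i) t s) * deriv (γ i) t / κ).re with hf
  obtain ⟨η, hη, hηf⟩ := tube (f := f) (by intro t s; simp only [hf, S.par_per s t, S.per1 t]) (by
    intro t
    have h1 := D.p_cont i hpc t
    have h2 : ContinuousWithinAt (fun q : ℝ × ℝ => k (par (γ i) q.1 q.2)) (univ ×ˢ Iic 0) (t, 0) := by
      have hko : IsOpen (band (γ i) (-σ) σ) := D.band_open i (by linarith) hσ0
      have : ContinuousAt k (par (γ i) t 0) := (hk.differentiableAt (hko.mem_nhds
        (mem_band.2 ⟨t, 0, by linarith, hσ, rfl⟩))).continuousAt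
      exact (Tendsto.comp this (S.par_cont.tendsto (t, (0:ℝ)))).mono_left nhdsWithin_le_nhds
    have h3 : ContinuousWithinAt (fun q : ℝ × ℝ => deriv (γ i) q.1) (univ ×ˢ Iic 0) (t, 0) :=
      (S.cont1.comp continuous_fst).continuousWithinAt
    exact (Complex.continuous_re.tendsto _).comp ((((h1.pow 2).add (continuousWithinAt_const.mul h2)).mul h3).div_const κ))
    (by
    intro t
    obtain ⟨ρ, hρ, e⟩ := hb t
    have : P (par (γ i) t 0) * deriv (γ i) t / κ = ρ + ε * (k (γ i t) * deriv (γ i) t) := by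
      simp only [hP, par_zero]
      rw [add_mul, e]; field_simp
    simp only [hf, this]
    rw [add_re, ofReal_re, re_ofReal_mul]
    have := hkp t
    positivity)
  obtain ⟨r, hr1, hr2, hr3⟩ : ∃ r, s < r ∧ r < 0 ∧ -η ≤ r := ⟨max (s/2) (-η), by
    rw [lt_max_iff]; left; linarith, max_lt (by linarith) (by linarith), le_max_right _ _⟩
  have hrp : ∀ t, 0 < (P (par (γ i) t r) * deriv (γ i) t / κ).re := fun t => hηf t r hr3 hr2.le
  have hrV := fun t => hmV t r (by linarith) hr2
  have hr0 : ∀ t, P (par (γ i) t r) ≠ 0 := fun t h => by have := hrp t; rw [h] at this; simp at this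
  have hlr := S.lw_hopf hV hPV (D.hopf i) hrV hrp
  set Y : ℂ → ℂ := fun z => 1 + ε * (κ * k z / p z ^ 2) with hY
  have hYre : ∀ t, 0 < (Y (par (γ i) t s)).re := by
    intro t
    have h1 := hCb t
    have h2 : ‖(ε:ℂ) * (κ * k (par (γ i) t s) / p (par (γ i) t s) ^ 2)‖ ≤ 1/2 := by
      rw [norm_mul, Complex.norm_real, Real.norm_of_nonneg hεp.le]
      calc _ ≤ ε * C := by gcongr
        _ = 1/2 := by rw [hε]; field_simp
    have h3 := (abs_le.1 (Complex.abs_re_le_norm ((ε:ℂ) * (κ * k (par (γ i) t s) / p (par (γ i) t s) ^ 2)))).1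
    simp only [hY, add_re, one_re]
    linarith
  have hYne : ∀ t, Y (par (γ i) t s) ≠ 0 := fun t h => by have := hYre t; rw [h] at this; simp at this
  set W := V ∩ {z | p z ≠ 0} with hW
  have hWo : IsOpen W := hpV.continuousOn.isOpen_inter_preimage hV isOpen_ne
  have hWV : W ⊆ V := inter_subset_left
  have hsW : ∀ t, par (γ i) t s ∈ W := fun t => ⟨hsV t, hps t⟩
  have hYW : DifferentiableOn ℂ Y W := by
    refine (((hkV.mono hWV).const_mul κ).div ((hpV.mono hWV).pow 2) ?_).const_mul _ |>.const_add _
    intro z hz; exact pow_ne_zero _ hz.2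
  have hpW := hpV.mono hWV
  have e1 : ∀ z ∈ W, P z = p z * p z * Y z := by
    intro z hz
    have : p z ≠ 0 := hz.2
    simp only [hP, hY]; field_simp
  have hs0' : ∀ t, P (par (γ i) t s) ≠ 0 := fun t => by
    rw [e1 _ (hsW t)]; exact mul_ne_zero (mul_ne_zero (hps t) (hps t)) (hYne t)
  obtain ⟨m, hm⟩ := S.lw_int hV hpV hsV hps
  have hls : lw (γ i) P s = 2 * (2 * Real.pi * I * m) := by
    rw [lw_congr hWo hsW e1, S.lw_mul (G := fun z => p z * p z) hWo (hpW.mul hpW) hYW hsW (fun t => mul_ne_zero (hps t) (hps t)) hYne,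
      S.lw_mul hWo hpW hpW hsW hps hps, S.lw_zero hWo hYW hsW hYre, hm]
    ring
  obtain ⟨N, hN⟩ := D.collar_count i hV hPV (iso_of_conn hV (D.band_conn i) hPV (hrV 0) (hr0 0))
    (a := (s - σ)/2) (b := r/2) (s := s) (r := r) (by linarith) (by linarith) hr1 (by linarith) (by linarith [D.s0pos])
    (fun t x hx => hmV t x (by linarith [hx.1]) (by linarith [hx.2])) hs0' hr0
  rw [hls, hlr] at hN
  have h2 : (2 * m + 1 : ℂ) = N := by
    apply mul_left_cancel₀ two_pi_I_ne
    linear_combination hN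
  have h3 : 2 * m + 1 = (N : ℤ) := by exact_mod_cast h2
  have h4 : 0 ≤ m := by omega
  refine ⟨m.toNat, ?_⟩
  rw [hm]
  congr 1
  exact_mod_cast (Int.toNat_of_nonneg h4).symm
end wn

section nz
variable {n : ℕ} {γ : Fin n → ℝ → ℂ} {s0 c : ℝ} {K : Set ℂ}

lemma deriv_infty (hK : IsCompact K) {p : ℂ → ℂ} {l : ℂ} (hp : DifferentiableOn ℂ p Kᶜ)
    (hl : Tendsto p (cobounded ℂ) (𝓝 l)) : Tendsto (fun z => z * deriv p z) (cobounded ℂ) (𝓝 0) := by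
  rw [Metric.tendsto_nhds]
  intro ε hε
  have h1 : ∀ᶠ z in cobounded ℂ, ‖p z - l‖ < ε / 4 ∧ z ∈ Kᶜ := by
    have := Metric.tendsto_nhds.1 hl (ε/4) (by positivity)
    simp only [dist_eq_norm] at this
    exact this.and (isBounded_def.1 hK.isBounded)
  obtain ⟨R, -, hR⟩ := (hasBasis_cobounded_compl_closedBall (0:ℂ)).eventually_iff.1 h1
  have h2 : ∀ᶠ z : ℂ in cobounded ℂ, 2 * |R| + 1 < ‖z‖ := (tendsto_norm_cobounded_atTop (E := ℂ)).eventually (eventually_gt_atTop _)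
  filter_upwards [h2] with z hz
  have hr : 0 < ‖z‖ / 2 := by have := abs_nonneg R; linarith
  have hb : ∀ w, dist w z ≤ ‖z‖ / 2 → ‖p w - l‖ < ε / 4 ∧ w ∈ Kᶜ := by
    intro w hw
    apply hR
    rw [mem_compl_iff, mem_closedBall, dist_zero_right, not_le]
    have h3 : ‖z‖ ≤ ‖w‖ + dist w z := by
      rw [dist_eq_norm, ← norm_neg (w - z)]
      calc ‖z‖ = ‖w + -(w - z)‖ := by congr 1; ring
        _ ≤ _ := norm_add_le _ _
    have := le_abs_self R
    linarith
  have hd : DiffContOnCl ℂ (fun w => p w - l) (ball z (‖z‖/2)) := by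
    apply DifferentiableOn.diffContOnCl
    rw [closure_ball _ hr.ne']
    exact (hp.mono fun w hw => (hb w hw).2).sub_const l
  have h4 := Complex.norm_deriv_le_of_forall_mem_sphere_norm_le hr hd (C := ε/4)
    (fun w hw => (hb w (le_of_eq hw)).1.le)
  rw [deriv_sub_const] at h4
  rw [dist_zero_right, norm_mul]
  have h5 : ‖z‖ * ‖deriv p z‖ ≤ ‖z‖ * (ε / 4 / (‖z‖/2)) := by gcongr
  have h6 : ‖z‖ * (ε / 4 / (‖z‖/2)) = ε / 2 := by
    have : ‖z‖ ≠ 0 := by linarith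
    field_simp; norm_num
  linarith

lemma Fam.levels_finite (F : Fam γ s0 c) {p : ℂ → ℂ} {a b : ℝ} (ha : -s0 ≤ a) (hb : b ≤ s0)
    (hne : ∀ j t, ∀ s ∈ Icc a b, ∀ᶠ w in 𝓝[≠] (par (γ j) t s), p w ≠ 0) :
    {s | s ∈ Icc a b ∧ ∃ j t, p (par (γ j) t s) = 0}.Finite := by
  set C := ⋃ j, (fun q : ℝ × ℝ => par (γ j) q.1 q.2) '' (univ ×ˢ Icc a b) with hC
  have hCc : IsCompact C := isCompact_iUnion fun j => levelset_compact (F.sc j) a b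
  have hfin := fin_zeros (G := p) hCc (by
    intro z hz
    obtain ⟨j, ⟨t, s⟩, ⟨_, hs⟩, rfl⟩ := mem_iUnion.1 hz
    exact hne j t s hs)
  have h2 : (⋃ z ∈ {z | z ∈ C ∧ p z = 0}, {s | s ∈ Icc a b ∧ ∃ j t, par (γ j) t s = z}).Finite := by
    refine hfin.biUnion fun z _ => Set.Subsingleton.finite ?_
    rintro s ⟨hs, j, t, e⟩ s' ⟨hs', j', t', e'⟩
    exact (F.par_inj (abs_le.2 ⟨by linarith [hs.1], by linarith [hs.2]⟩)
      (abs_le.2 ⟨by linarith [hs'.1], by linarith [hs'.2]⟩) (e.trans e'.symm)).2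
  refine h2.subset ?_
  rintro s ⟨hs, j, t, e⟩
  exact mem_biUnion (show par (γ j) t s ∈ {z | z ∈ C ∧ p z = 0} from
    ⟨mem_iUnion.2 ⟨j, (t, s), ⟨mem_univ _, hs⟩, rfl⟩, e⟩) ⟨hs, j, t, rfl⟩

lemma Dom.no_zeros (D : Dom K γ s0 c) {p : ℂ → ℂ} {κ l : ℂ} (hp : DifferentiableOn ℂ p Kᶜ)
    (hpc : ContinuousOn p (interior K)ᶜ) (hκ : κ ≠ 0)
    (hb : ∀ i t, ∃ ρ : ℝ, 0 ≤ ρ ∧ p (γ i t) ^ 2 * deriv (γ i) t = κ * ρ) (hl0 : l ≠ 0)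
    (hl : Tendsto p (cobounded ℂ) (𝓝 l)) : ∀ z ∈ Kᶜ, p z ≠ 0 := by
  intro b hbK hb0
  have hs0 := D.s0pos
  have hKo : IsOpen Kᶜ := D.comp.isClosed.isOpen_compl
  -- large radius
  have hlne : ∀ᶠ z in cobounded ℂ, p z ≠ 0 ∧ z ∈ Kᶜ :=
    (hl.eventually_ne hl0).and (isBounded_def.1 D.comp.isBounded)
  obtain ⟨R0, -, hR0⟩ := (hasBasis_cobounded_compl_closedBall (0:ℂ)).eventually_iff.1 hlne
  set R := max R0 ‖b‖ with hR
  have hRne : ∀ z : ℂ, R < ‖z‖ → p z ≠ 0 := by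
    intro z hz
    refine (hR0 ?_).1
    rw [mem_compl_iff, mem_closedBall, dist_zero_right, not_le]
    exact lt_of_le_of_lt (le_max_left _ _) hz
  obtain ⟨x, hx⟩ := hlne.exists
  have hiso := iso_of_conn hKo D.conn.isPreconnected hp hx.2 hx.1
  -- nonnegativity threshold
  obtain ⟨σ, hσ, hσm⟩ := finite_min (ι := Fin n) (P := fun i σ => ∀ s, -σ < s → s < 0 → (∀ t, p (par (γ i) t s) ≠ 0) →
      ∃ m : ℕ, lw (γ i) p s = 2 * Real.pi * I * m) (fun i => by
      obtain ⟨σ, h1, -, h2⟩ := D.wind_nonneg i hp hpc hκ (hb i)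
      exact ⟨σ, h1, h2⟩) (fun i a b hb hba h s h1 h2 h3 => h s (by linarith) h2 h3)
  obtain ⟨β, hβ, hβb⟩ : ∃ β, β < 0 ∧ ∀ j t s, β ≤ s → s ≤ 0 → par (γ j) t s ≠ b := by
    by_cases h : ∃ j t s, -s0 ≤ s ∧ s ≤ 0 ∧ par (γ j) t s = b
    · obtain ⟨j, t, s, h1, h2, e⟩ := h
      have hs : s < 0 := by
        rcases h2.lt_or_eq with h | h
        · exact h
        · rw [h, par_zero] at e
          have := D.fr j t
          rw [D.comp.isClosed.frontier_eq, e] at this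
          exact absurd this.1 hbK
      refine ⟨s/2, by linarith, fun j' t' s' h3 h4 e' => ?_⟩
      have := (D.par_inj (abs_le.2 ⟨by linarith, by linarith⟩) (abs_le.2 ⟨by linarith, by linarith⟩) (e.trans e'.symm)).2
      linarith
    · push Not at h
      exact ⟨-s0, by linarith, fun j t s h1 h2 => h j t s h1 h2⟩
  obtain ⟨a0, ha0, ha1, ha2, ha3⟩ : ∃ a0, a0 < 0 ∧ -s0 < a0 ∧ -σ < a0 ∧ β < a0 := by
    refine ⟨max (-s0/2) (max (-σ/2) (β/2)), max_lt (by linarith) (max_lt (by linarith) (by linarith)), ?_, ?_, ?_⟩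
    · exact lt_max_of_lt_left (by linarith)
    · exact lt_max_of_lt_right (lt_max_of_lt_left (by linarith))
    · exact lt_max_of_lt_right (lt_max_of_lt_right (by linarith))
  set L := {s | s ∈ Icc a0 (a0/2) ∧ ∃ j t, p (par (γ j) t s) = 0} with hL
  have hLf : L.Finite := D.levels_finite ha1.le (by linarith) (fun j t s hs =>
    hiso _ (D.neg j t s (by linarith [hs.2]) (by linarith [hs.1])))
  obtain ⟨s1, hs1, hs1L⟩ : ∃ s1 ∈ Ioo a0 (a0/2), s1 ∉ L := by
    obtain ⟨s1, h1, h2⟩ := ((Ioo_infinite (show a0 < a0/2 by linarith)).sdiff hLf).nonempty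
    exact ⟨s1, h1, h2⟩
  have hopen : IsOpen (Ioo a0 (a0/2) ∩ Lᶜ) := isOpen_Ioo.inter hLf.isClosed.isOpen_compl
  obtain ⟨ε, hε, hεb⟩ := Metric.isOpen_iff.1 hopen s1 ⟨hs1, hs1L⟩
  have hIntg : ∀ s, |s - s1| < ε → (a0 < s ∧ s < a0/2) ∧ ∀ j t, p (par (γ j) t s) ≠ 0 := by
    intro s h
    have := hεb (show s ∈ ball s1 ε from by rwa [mem_ball, Real.dist_eq])
    exact ⟨this.1, fun j t e => this.2 ⟨⟨this.1.1.le, this.1.2.le⟩, j, t, e⟩⟩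
  set s2 := s1 + ε/2 with hs2
  have hs2i := (hIntg s2 (by rw [hs2, add_sub_cancel_left, abs_of_pos (by positivity)]; linarith)).1
  have hsai := (hIntg (s1 - ε/2) (by rw [abs_lt]; constructor <;> linarith)).1
  -- compact outer set
  set R' := interior K ∪ ⋃ j, band (γ j) s2 s0 with hR'
  have hR'o : IsOpen R' := isOpen_interior.union (isOpen_iUnion fun j => D.band_open j (by linarith) le_rfl)
  set C := closedBall (0:ℂ) R ∩ R'ᶜ with hCd
  have hCc : IsCompact C := (isCompact_closedBall _ _).inter_right hR'o.isClosed_compl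
  have hCK : C ⊆ Kᶜ := by
    rintro z ⟨-, h⟩ hz
    apply h
    by_cases hi : z ∈ interior K
    · exact Or.inl hi
    · have hf : z ∈ frontier K := by rw [D.comp.isClosed.frontier_eq]; exact ⟨hz, hi⟩
      obtain ⟨j, t, e⟩ := D.fr' hf
      exact Or.inr (mem_iUnion.2 ⟨j, mem_band.2 ⟨t, 0, by linarith, hs0, by rw [par_zero]; exact e⟩⟩)
  have hbK' : ∀ z ∈ Kᶜ, ∀ j t s, 0 ≤ s → s ≤ s0 → par (γ j) t s ≠ z := by
    intro z hz j t s h1 h2 e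
    apply hz
    rcases h1.lt_or_eq with h | h
    · exact interior_subset (e ▸ D.pos j t s h h2)
    · rw [← h, par_zero] at e
      have := D.fr j t
      rw [D.comp.isClosed.frontier_eq, e] at this
      exact this.1
  have hCmem : ∀ z ∈ Kᶜ, (∀ j t s, s2 ≤ s → s < 0 → par (γ j) t s ≠ z) → ‖z‖ ≤ R → z ∈ C := by
    intro z hz h hzR
    refine ⟨by simpa using hzR, ?_⟩
    rintro (hz' | hz')
    · exact hz (interior_subset hz')
    · obtain ⟨j, hj⟩ := mem_iUnion.1 hz'
      obtain ⟨t, s, h1, h2, e⟩ := mem_band.1 hj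
      by_cases hs : s < 0
      · exact h j t s h1.le hs e
      · exact hbK' z hz j t s (not_lt.1 hs) h2.le e
  have hbC : b ∈ C := hCmem b hbK (fun j t s h1 h2 => hβb j t s (by linarith) h2.le) (le_max_right _ _)
  obtain ⟨Z, m, p1, hZ, hp1, hfac, hp10, he⟩ := factor hKo hCK hCc hp hiso
  have hp1ne : ∀ z ∈ Kᶜ, p z ≠ 0 → p1 z ≠ 0 := fun z hz h h' => h (by rw [hfac z hz, h', mul_zero])
  have hs1n : ∀ j t, p (par (γ j) t s1) ≠ 0 := (hIntg s1 (by simpa using hε)).2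
  have hs1K : ∀ j t, par (γ j) t s1 ∈ Kᶜ := fun j t => D.neg j t s1 (by linarith [hs1.2]) (by linarith [hs1.1])
  have hw0 : ∀ j, ∀ z ∈ Z, wds (γ j) s1 z = 0 := by
    intro j z hz
    obtain ⟨hzC, hz0⟩ := hZ z hz
    rw [wds_eq D.toFam j (a := s1 - ε/2) (b := s0) (s' := 0) ?_ ⟨by linarith, by linarith [hs1.2]⟩
      ⟨by linarith [hs1.2], hs0⟩, wds_zero]
    · exact D.wout j z (hCK hzC)
    · intro hm
      obtain ⟨t, s, h1, h2, e⟩ := mem_band.1 hm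
      by_cases hs : s2 < s
      · exact hzC.2 (Or.inr (mem_iUnion.2 ⟨j, mem_band.2 ⟨t, s, hs, h2, e⟩⟩))
      · exact (hIntg s (by rw [abs_lt]; constructor <;> linarith)).2 j t (e ▸ hz0)
  have hlw : ∀ j, lw (γ j) p s1 = lw (γ j) p1 s1 := by
    intro j
    rw [(D.sc j).lw_factor hKo hp1 (hs1K j) (hs1n j) (fun t => hp1ne _ (hs1K j t) (hs1n j t))
      (fun b hb => (hZ b hb).2) he, Finset.sum_eq_zero, zero_add]
    intro z hz; rw [hw0 j z hz, mul_zero]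
  -- outer Cauchy theorem
  have hinf : Tendsto (fun z => z * logDeriv p1 z) (cobounded ℂ) (𝓝 (-∑ z ∈ Z, (m z : ℂ))) := by
    have h1 : Tendsto (fun z => z * deriv p z / p z) (cobounded ℂ) (𝓝 (0 / l)) := (deriv_infty D.comp hp hl).div hl hl0
    have h2 : ∀ b : ℂ, Tendsto (fun z : ℂ => z / (z - b)) (cobounded ℂ) (𝓝 1) := by
      intro b
      have h3 : Tendsto (fun z : ℂ => (1 - b * z⁻¹)⁻¹) (cobounded ℂ) (𝓝 (1 - b * 0)⁻¹) :=
        ((tendsto_const_nhds.sub (tendsto_inv₀_cobounded.const_mul b))).inv₀ (by simp)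
      simp only [mul_zero, sub_zero, inv_one] at h3
      refine h3.congr' ?_
      filter_upwards [eventually_ne_cobounded (0:ℂ)] with z hz
      rw [← one_div, ← mul_div_mul_left _ _ hz]
      congr 1
      · ring
      · rw [mul_sub, mul_one, mul_left_comm, mul_inv_cancel₀ hz, mul_one]
    have h4 : Tendsto (fun z => z * deriv p z / p z - ∑ b ∈ Z, (m b : ℂ) * (z / (z - b))) (cobounded ℂ)
        (𝓝 (0 / l - ∑ b ∈ Z, (m b : ℂ) * 1)) :=
      h1.sub (tendsto_finsetSum _ fun b _ => (h2 b).const_mul _)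
    simp only [zero_div, zero_sub, mul_one] at h4
    refine h4.congr' ?_
    filter_upwards [hlne] with z hz
    have := he z hz.2 hz.1
    rw [logDeriv_apply, mul_div_assoc, this, mul_add, Finset.mul_sum]
    have e : ∑ b ∈ Z, (m b : ℂ) * (z / (z - b)) = ∑ i ∈ Z, z * ((m i : ℂ) / (z - i)) :=
      Finset.sum_congr rfl fun b _ => by ring
    rw [e]; ring
  have hVo : IsOpen (Kᶜ ∩ {z | p1 z ≠ 0}) := hp1.continuousOn.isOpen_inter_preimage hKo isOpen_ne
  have hout := D.outer (G := logDeriv p1) hVo (by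
      intro z hz
      have d1 := (hp1.deriv hKo).differentiableAt (hKo.mem_nhds hz.1)
      have d2 := hp1.differentiableAt (hKo.mem_nhds hz.1)
      exact (d1.div d2 hz.2).differentiableWithinAt) (b := s2) (by linarith) (by
      intro z hz h
      refine ⟨hz, ?_⟩
      by_cases hzR : ‖z‖ ≤ R
      · exact hp10 z (hCmem z hz h hzR)
      · exact hp1ne z hz (hRne z (not_le.1 hzR))) hinf (s := s1) (by linarith) (by linarith)
  have hcount : ∀ j, ∃ k : ℕ, lw (γ j) p s1 = 2 * Real.pi * I * k := fun j =>
    hσm j s1 (by linarith [hs1.1]) (by linarith [hs1.2]) (hs1n j)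
  choose k hk using hcount
  have hCI : CI γ (logDeriv p1) s1 = 2 * Real.pi * I * ∑ j, (k j : ℂ) := by
    rw [Finset.mul_sum]
    exact Finset.sum_congr rfl fun j _ => by rw [← hk j, hlw j]; rfl
  rw [hCI] at hout
  have h5 := mul_left_cancel₀ two_pi_I_ne hout
  have h6 : ∑ j, k j + ∑ z ∈ Z, m z = 0 := by
    have : ((∑ j, k j + ∑ z ∈ Z, m z : ℕ) : ℂ) = 0 := by push_cast; rw [h5]; ring
    exact_mod_cast this
  have h7 : ∀ z ∈ Z, m z = 0 := by
    have : ∑ z ∈ Z, m z = 0 := by omega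
    exact fun z hz => (Finset.sum_eq_zero_iff.1 this) z hz
  have h8 := hfac b hbK
  rw [hb0, Finset.prod_eq_one (fun z hz => by rw [h7 z hz, pow_zero]), one_mul] at h8
  exact hp10 b hbC h8.symm
end nz

section fin
variable {n : ℕ} {K : Set ℂ} {γ : Fin n → ℝ → ℂ} {s0 c : ℝ}

lemma Dom.lt_of_hq (D : Dom K γ s0 c) {h q : ℂ → ℂ}
    (hc : ContinuousOn h (interior K)ᶜ) (hd : DifferentiableOn ℂ h Kᶜ)
    (qc : ContinuousOn q (interior K)ᶜ) (qd : DifferentiableOn ℂ q Kᶜ)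
    (h0 : Tendsto h (cobounded ℂ) (𝓝 0)) (q1 : Tendsto q (cobounded ℂ) (𝓝 1))
    (hb : ∀ i t, q (γ i t) = I * (starRingEnd ℂ) (tg (γ i) t) * (starRingEnd ℂ) (h (γ i t))) :
    ∀ z ∈ Kᶜ, ‖h z‖ < ‖q z‖ := by
  have key : ∀ ω : ℂ, ‖ω‖ = 1 → ∀ z ∈ Kᶜ, h z - ω * q z ≠ 0 := by
    intro ω hω
    have hω0 : ω ≠ 0 := by intro e; simp [e] at hω
    have hωc : (starRingEnd ℂ) ω * ω = 1 := by
      rw [mul_comm, Complex.mul_conj, Complex.normSq_eq_norm_sq, hω]; simp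
    refine D.no_zeros (p := fun z => h z - ω * q z) (κ := -I * ω) (l := -ω) (hd.sub (qd.const_mul ω))
      (hc.sub (continuousOn_const.mul qc)) (by simp [hω0]) ?_ (by simpa using hω0) ?_
    · intro i t
      refine ⟨‖h (γ i t) - ω * q (γ i t)‖ ^ 2 * ‖deriv (γ i) t‖, by positivity, ?_⟩
      have e1 := hb i t
      have e2 := congrArg (starRingEnd ℂ) e1
      have e3 := (D.sc i).tg_conj t
      rw [map_mul, map_mul, Complex.conj_conj, Complex.conj_conj, Complex.conj_I] at e2
      push_cast
      rw [(D.sc i).tg_eq t, norm_mul, (D.sc i).tg_norm, one_mul, Complex.norm_real, norm_norm,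
        ← Complex.ofReal_pow, ← Complex.normSq_eq_norm_sq, ← Complex.mul_conj, map_sub, map_mul, e2, e1]
      have hI := Complex.I_sq
      generalize (starRingEnd ℂ) (tg (γ i) t) = Tc at *
      generalize (starRingEnd ℂ) (h (γ i t)) = H' at *
      generalize tg (γ i) t = T at *
      generalize h (γ i t) = H at *
      generalize (starRingEnd ℂ) ω = ω' at *
      generalize (‖deriv (γ i) t‖ : ℂ) = N at *
      linear_combination ((H - ω * (I * Tc * H')) * T * N * H) * (ω' * ω * (Tc * T) * hI - Tc * T * hωc - e3)
        - ω * I * (H - ω * (I * Tc * H')) * (H' - ω' * (-I * T * H)) * N * e3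
    · simpa using h0.sub (q1.const_mul ω)
  have hne : ∀ z ∈ Kᶜ, ‖h z‖ - ‖q z‖ ≠ 0 := by
    intro z hz e
    by_cases hq : q z = 0
    · have : h z = 0 := by simpa [hq] using e
      exact key 1 (by simp) z hz (by simp [hq, this])
    · refine key (h z / q z) ?_ z hz (by field_simp; simp)
      rw [norm_div, sub_eq_zero.1 e, div_self (by simpa using hq)]
  have hcont : ContinuousOn (fun z => ‖h z‖ - ‖q z‖) Kᶜ := hd.continuousOn.norm.sub qd.continuousOn.norm
  have hev : ∀ᶠ z in cobounded ℂ, z ∈ Kᶜ ∧ ‖h z‖ - ‖q z‖ < 0 := by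
    have : Tendsto (fun z => ‖h z‖ - ‖q z‖) (cobounded ℂ) (𝓝 (‖(0:ℂ)‖ - ‖(1:ℂ)‖)) := h0.norm.sub q1.norm
    filter_upwards [this.eventually_lt_const (u := 0) (by simp), (isBounded_def.1 D.comp.isBounded : Kᶜ ∈ cobounded ℂ)] with z h1 h2
    exact ⟨h2, h1⟩
  obtain ⟨z0, hz0, hz0'⟩ := hev.exists
  intro z hz
  by_contra hcon
  have : (0:ℝ) ∈ (fun z => ‖h z‖ - ‖q z‖) '' Kᶜ :=
    D.conn.isPreconnected.intermediate_value hz0 hz hcont ⟨hz0'.le, by simpa using hcon⟩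
  obtain ⟨y, hy, e⟩ := this
  exact hne y hy e

lemma Dom.bd_nint (D : Dom K γ s0 c) (i : Fin n) (t : ℝ) : γ i t ∈ (interior K)ᶜ := fun h' => (D.fr i t).2 h'

lemma Dom.arc_cont (D : Dom K γ s0 c) {X : Type*} [TopologicalSpace X] {F : ℂ → X} (hF : ContinuousOn F (interior K)ᶜ) (i : Fin n) :
    Continuous (fun t => F (γ i t)) :=
  hF.comp_continuous (D.sc i).cont (D.bd_nint i)

/-- pairing formula -/
lemma Dom.pair (D : Dom K γ s0 c) {h q g : ℂ → ℂ} {w : ℂ}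
    (qc : ContinuousOn q (interior K)ᶜ) (qd : DifferentiableOn ℂ q Kᶜ)
    (gc : ContinuousOn g (interior K)ᶜ) (gd : DifferentiableOn ℂ g Kᶜ)
    (q1 : Tendsto q (cobounded ℂ) (𝓝 1))
    (hb : ∀ i t, q (γ i t) = I * (starRingEnd ℂ) (tg (γ i) t) * (starRingEnd ℂ) (h (γ i t)))
    (hw : Tendsto (fun z => z * g z) (cobounded ℂ) (𝓝 w)) :
    ∑ i, ∫ t in (0:ℝ)..1, g (γ i t) * (starRingEnd ℂ) (h (γ i t)) * (‖deriv (γ i) t‖ : ℂ) = 2 * Real.pi * w := by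
  have h1 := D.outer_bd (G := fun z => g z * q z) (w := w) (gd.mul qd) (gc.mul qc) (by
    simpa [mul_assoc] using hw.mul q1)
  have h2 : CI γ (fun z => g z * q z) 0 = I * ∑ i, ∫ t in (0:ℝ)..1, g (γ i t) * (starRingEnd ℂ) (h (γ i t)) * (‖deriv (γ i) t‖ : ℂ) := by
    unfold CI
    rw [Finset.mul_sum]
    refine Finset.sum_congr rfl fun i _ => ?_
    rw [← intervalIntegral.integral_const_mul]
    congr 1; ext t
    rw [par_zero, dpar_zero]
    change g (γ i t) * q (γ i t) * _ = _
    rw [hb]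
    conv_lhs => rw [(D.sc i).tg_eq t]
    linear_combination (I * g (γ i t) * (starRingEnd ℂ) (h (γ i t)) * (‖deriv (γ i) t‖ : ℂ)) * (D.sc i).tg_conj t
  rw [h2] at h1
  apply mul_left_cancel₀ I_ne_zero
  rw [h1]; ring

lemma Dom.arc_eq (D : Dom K γ s0 c) {h q : ℂ → ℂ} {w : ℂ}
    (hc : ContinuousOn h (interior K)ᶜ) (hd : DifferentiableOn ℂ h Kᶜ)
    (qc : ContinuousOn q (interior K)ᶜ) (qd : DifferentiableOn ℂ q Kᶜ)
    (q1 : Tendsto q (cobounded ℂ) (𝓝 1))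
    (hb : ∀ i t, q (γ i t) = I * (starRingEnd ℂ) (tg (γ i) t) * (starRingEnd ℂ) (h (γ i t)))
    (hw : Tendsto (fun z => z * h z) (cobounded ℂ) (𝓝 w)) :
    w = ((1 / (2 * Real.pi) * arcIntegralOf γ (fun z => ‖h z‖ ^ 2) : ℝ) : ℂ) := by
  have h1 := D.pair qc qd hc hd q1 hb hw
  have h2 : ((arcIntegralOf γ (fun z => ‖h z‖ ^ 2) : ℝ) : ℂ) = 2 * Real.pi * w := by
    rw [← h1, arcIntegralOf, Complex.ofReal_sum]
    refine Finset.sum_congr rfl fun i _ => ?_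
    rw [← intervalIntegral.integral_ofReal]
    congr 1; ext t
    rw [Complex.mul_conj, Complex.normSq_eq_norm_sq]; push_cast; rfl
  push_cast; rw [h2]
  have : (Real.pi : ℂ) ≠ 0 := by exact_mod_cast Real.pi_ne_zero
  field_simp

lemma Dom.le_max (D : Dom K γ s0 c) {h q g : ℂ → ℂ} {w : ℂ}
    (hc : ContinuousOn h (interior K)ᶜ)
    (qc : ContinuousOn q (interior K)ᶜ) (qd : DifferentiableOn ℂ q Kᶜ)
    (q1 : Tendsto q (cobounded ℂ) (𝓝 1))
    (hb : ∀ i t, q (γ i t) = I * (starRingEnd ℂ) (tg (γ i) t) * (starRingEnd ℂ) (h (γ i t)))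
    (gc : ContinuousOn g (interior K)ᶜ) (gd : DifferentiableOn ℂ g Kᶜ)
    (hw : Tendsto (fun z => z * g z) (cobounded ℂ) (𝓝 w)) :
    2 * w.re - 1 / (2 * Real.pi) * arcIntegralOf γ (fun z => ‖g z‖ ^ 2) ≤
      1 / (2 * Real.pi) * arcIntegralOf γ (fun z => ‖h z‖ ^ 2) := by
  have h1 := D.pair qc qd gc gd q1 hb hw
  have hpi := Real.pi_pos
  have h2 : ∑ i, ∫ t in (0:ℝ)..1, (g (γ i t) * (starRingEnd ℂ) (h (γ i t))).re * ‖deriv (γ i) t‖ = 2 * Real.pi * w.re := by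
    have := congrArg Complex.re h1
    rw [Complex.re_sum] at this
    have e : ((2 * Real.pi * w : ℂ)).re = 2 * Real.pi * w.re := by
      rw [show (2 * Real.pi * w : ℂ) = ((2 * Real.pi : ℝ) : ℂ) * w by push_cast; ring, Complex.re_ofReal_mul]
    rw [← e, ← this]
    refine Finset.sum_congr rfl fun i _ => ?_
    have hcc : Continuous fun t => g (γ i t) * (starRingEnd ℂ) (h (γ i t)) * (‖deriv (γ i) t‖ : ℂ) :=
      ((D.arc_cont gc i).mul (Complex.continuous_conj.comp (D.arc_cont hc i))).mul
        (Complex.continuous_ofReal.comp (D.sc i).cont1.norm)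
    have := Complex.reCLM.intervalIntegral_comp_comm (hcc.intervalIntegrable (μ := volume) 0 1)
    simp only [Complex.reCLM_apply] at this
    rw [← this]
    congr 1; ext t
    rw [mul_comm (_ * _) (Complex.ofReal _), Complex.re_ofReal_mul, mul_comm]
  have h3 : 0 ≤ ∑ i, ∫ t in (0:ℝ)..1, (‖g (γ i t) - h (γ i t)‖ ^ 2 * ‖deriv (γ i) t‖) :=
    Finset.sum_nonneg fun i _ => intervalIntegral.integral_nonneg zero_le_one fun t _ => by positivity
  have h4 : ∑ i, ∫ t in (0:ℝ)..1, (‖g (γ i t) - h (γ i t)‖ ^ 2 * ‖deriv (γ i) t‖) =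
      arcIntegralOf γ (fun z => ‖g z‖ ^ 2) + arcIntegralOf γ (fun z => ‖h z‖ ^ 2)
      - 2 * ∑ i, ∫ t in (0:ℝ)..1, (g (γ i t) * (starRingEnd ℂ) (h (γ i t))).re * ‖deriv (γ i) t‖ := by
    unfold arcIntegralOf
    rw [Finset.mul_sum, ← Finset.sum_add_distrib, ← Finset.sum_sub_distrib]
    refine Finset.sum_congr rfl fun i _ => ?_
    have cg := D.arc_cont gc i
    have ch := D.arc_cont hc i
    have cd := (D.sc i).cont1
    have chc : Continuous fun t => (starRingEnd ℂ) (h (γ i t)) := Complex.continuous_conj.comp ch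
    have c1 : Continuous fun t => ‖g (γ i t)‖ ^ 2 * ‖deriv (γ i) t‖ := (cg.norm.pow 2).mul cd.norm
    have c2 : Continuous fun t => ‖h (γ i t)‖ ^ 2 * ‖deriv (γ i) t‖ := (ch.norm.pow 2).mul cd.norm
    have c3 : Continuous fun t => (g (γ i t) * (starRingEnd ℂ) (h (γ i t))).re * ‖deriv (γ i) t‖ :=
      (Complex.continuous_re.comp (cg.mul chc)).mul cd.norm
    have c4 : Continuous fun t => ‖g (γ i t)‖ ^ 2 * ‖deriv (γ i) t‖ + ‖h (γ i t)‖ ^ 2 * ‖deriv (γ i) t‖ := c1.add c2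
    have c5 : Continuous fun t => 2 * ((g (γ i t) * (starRingEnd ℂ) (h (γ i t))).re * ‖deriv (γ i) t‖) :=
      continuous_const.mul c3
    rw [← intervalIntegral.integral_const_mul, ← intervalIntegral.integral_add (c1.intervalIntegrable _ _) (c2.intervalIntegrable _ _),
      ← intervalIntegral.integral_sub (c4.intervalIntegrable _ _) (c5.intervalIntegrable _ _)]
    congr 1; ext t
    have : ‖g (γ i t) - h (γ i t)‖ ^ 2 = ‖g (γ i t)‖ ^ 2 + ‖h (γ i t)‖ ^ 2 - 2 * (g (γ i t) * (starRingEnd ℂ) (h (γ i t))).re := by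
      rw [← Complex.normSq_eq_norm_sq, ← Complex.normSq_eq_norm_sq, ← Complex.normSq_eq_norm_sq, Complex.normSq_sub]
    rw [this]; ring
  rw [h4, h2] at h3
  have h5 : 0 ≤ 1 / (2 * Real.pi) * (arcIntegralOf γ (fun z => ‖g z‖ ^ 2) + arcIntegralOf γ (fun z => ‖h z‖ ^ 2)
      - 2 * (2 * Real.pi * w.re)) := mul_nonneg (by positivity) h3
  have h6 : 1 / (2 * Real.pi) * (2 * (2 * Real.pi * w.re)) = 2 * w.re := by field_simp
  linarith [mul_add (1 / (2 * Real.pi)) (arcIntegralOf γ (fun z => ‖g z‖ ^ 2)) (arcIntegralOf γ (fun z => ‖h z‖ ^ 2)),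
    mul_sub (1 / (2 * Real.pi)) (arcIntegralOf γ (fun z => ‖g z‖ ^ 2) + arcIntegralOf γ (fun z => ‖h z‖ ^ 2)) (2 * (2 * Real.pi * w.re))]
end fin

section fin2
variable {n : ℕ} {K : Set ℂ} {γ : Fin n → ℝ → ℂ} {s0 c : ℝ}

lemma Dom.phi_le (D : Dom K γ s0 c) {q φ : ℂ → ℂ} {v : ℂ}
    (qc : ContinuousOn q (interior K)ᶜ) (qd : DifferentiableOn ℂ q Kᶜ)
    (q1 : Tendsto q (cobounded ℂ) (𝓝 1))
    (φd : DifferentiableOn ℂ φ Kᶜ) (φ1 : ∀ z ∈ Kᶜ, ‖φ z‖ ≤ 1)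
    (hv : Tendsto (fun z => z * φ z) (cobounded ℂ) (𝓝 v)) :
    2 * Real.pi * ‖v‖ ≤ arcIntegralOf γ (fun z => ‖q z‖ ^ 2) := by
  have h0 := D.s0pos
  have hmem : ∀ j t s, s ∈ Icc (-(s0/2)) 0 → par (γ j) t s ∈ (interior K)ᶜ := fun j t s hs =>
    D.nint j (by linarith [hs.1]) hs.2
  set N : ℝ → ℝ := fun s => ∑ j, ∫ t in (0:ℝ)..1, ‖q (par (γ j) t s)‖ ^ 2 * ‖dpar (γ j) t s‖ with hN
  have hc : ContinuousOn N (Icc (-(s0/2)) 0) := by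
    have h1 : ContinuousOn (fun s => ∑ j, ∫ t in (0:ℝ)..1, ((‖q (par (γ j) t s)‖ ^ 2 * ‖dpar (γ j) t s‖ : ℝ) : ℂ))
        (Icc (-(s0/2)) 0) := by
      apply continuousOn_finsetSum
      intro j _
      apply param_cont isCompact_Icc
      refine Complex.continuous_ofReal.comp_continuousOn ?_
      refine ContinuousOn.mul ?_ ((D.sc j).dpar_cont.comp continuous_swap).norm.continuousOn
      exact ((qc.comp ((D.sc j).par_cont.comp continuous_swap).continuousOn (fun p hp => hmem j p.2 p.1 hp.1)).norm).pow 2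
    refine (Complex.continuous_re.comp_continuousOn h1).congr ?_
    intro s hs
    simp only [hN, Function.comp, intervalIntegral.integral_ofReal, ← Complex.ofReal_sum, Complex.ofReal_re]
  have h1 : Tendsto N (𝓝[Ico (-(s0/2)) 0] 0) (𝓝 (N 0)) :=
    (hc 0 ⟨by linarith, le_rfl⟩).mono_left (nhdsWithin_mono _ Ico_subset_Icc_self)
  have hN0 : N 0 = arcIntegralOf γ (fun z => ‖q z‖ ^ 2) := by
    simp only [hN, arcIntegralOf, par_zero, dpar_zero]
  have : (𝓝[Ico (-(s0/2)) 0] (0:ℝ)).NeBot := by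
    rw [nhdsWithin_Ico_eq_nhdsLT (by linarith : -(s0/2) < 0)]; infer_instance
  rw [← hN0]
  refine ge_of_tendsto h1 ?_
  filter_upwards [self_mem_nhdsWithin] with s hs
  have hlim : Tendsto (fun z => z * (φ z * q z ^ 2)) (cobounded ℂ) (𝓝 v) := by
    simpa [mul_assoc] using hv.mul (q1.pow 2)
  have hout := D.outer D.comp.isClosed.isOpen_compl (G := fun z => φ z * q z ^ 2) (φd.mul (qd.pow 2)) le_rfl
    (fun z hz _ => hz) hlim (s := s) (by linarith [hs.1]) hs.2
  have e : 2 * Real.pi * ‖v‖ = ‖CI γ (fun z => φ z * q z ^ 2) s‖ := by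
    rw [hout]; simp [abs_of_pos Real.pi_pos]
  rw [e]
  refine (norm_sum_le _ _).trans (Finset.sum_le_sum fun j _ => ?_)
  have hq : Continuous fun t => q (par (γ j) t s) :=
    qc.comp_continuous ((D.sc j).par_cont' s) (fun t => hmem j t s ⟨hs.1, hs.2.le⟩)
  refine intervalIntegral.norm_integral_le_of_norm_le zero_le_one ?_
    (((hq.norm.pow 2).mul ((D.sc j).dpar_cont' s).norm).intervalIntegrable _ _)
  refine Eventually.of_forall fun t _ => ?_
  rw [norm_mul, norm_mul, norm_pow]
  have := φ1 _ (D.neg j t s hs.2 (by linarith [hs.1]))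
  exact mul_le_mul_of_nonneg_right (mul_le_of_le_one_left (by positivity) this) (norm_nonneg _)

lemma mob_le {a b : ℂ} (ha : ‖a‖ ≤ 1) (hb : ‖b‖ ≤ 1) : ‖a - b‖ ≤ ‖1 - (starRingEnd ℂ) b * a‖ := by
  apply le_of_sq_le_sq _ (norm_nonneg _)
  have ha' : Complex.normSq a ≤ 1 := by rw [Complex.normSq_eq_norm_sq]; nlinarith [norm_nonneg a]
  have hb' : Complex.normSq b ≤ 1 := by rw [Complex.normSq_eq_norm_sq]; nlinarith [norm_nonneg b]
  rw [← Complex.normSq_eq_norm_sq, ← Complex.normSq_eq_norm_sq]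
  have := mul_nonneg (sub_nonneg.2 ha') (sub_nonneg.2 hb')
  simp only [Complex.normSq_apply, Complex.sub_re, Complex.sub_im, Complex.mul_re, Complex.mul_im, Complex.conj_re,
    Complex.conj_im, Complex.one_re, Complex.one_im] at *
  nlinarith

lemma Dom.cap_le (D : Dom K γ s0 c) {q f : ℂ → ℂ} {l w : ℂ}
    (qc : ContinuousOn q (interior K)ᶜ) (qd : DifferentiableOn ℂ q Kᶜ)
    (q1 : Tendsto q (cobounded ℂ) (𝓝 1))
    (fd : DifferentiableOn ℂ f Kᶜ) (f1 : ∀ z ∈ Kᶜ, ‖f z‖ ≤ 1)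
    (hl : Tendsto f (cobounded ℂ) (𝓝 l))
    (hw : Tendsto (fun z => z * (f z - l)) (cobounded ℂ) (𝓝 w)) :
    2 * Real.pi * ‖w‖ ≤ arcIntegralOf γ (fun z => ‖q z‖ ^ 2) := by
  have hpi := Real.pi_pos
  have hl1 : ‖l‖ ≤ 1 := le_of_tendsto hl.norm (by
    filter_upwards [(isBounded_def.1 D.comp.isBounded : Kᶜ ∈ cobounded ℂ)] with z hz using f1 z hz)
  have key : ∀ r : ℝ, 0 < r → r < 1 → 2 * Real.pi * (r * ‖w‖) ≤ arcIntegralOf γ (fun z => ‖q z‖ ^ 2) := by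
    intro r hr0 hr1
    have hr2 : r ^ 2 < 1 := by nlinarith
    have hden : ∀ x : ℂ, ‖x‖ ≤ 1 → 1 - (starRingEnd ℂ) (r * l) * (r * x) ≠ 0 := by
      intro x hx e
      have e2 : ‖(starRingEnd ℂ) (r * l) * (r * x)‖ = 1 := by rw [← sub_eq_zero.1 e]; simp
      rw [norm_mul, RCLike.norm_conj, norm_mul, norm_mul, Complex.norm_real, Real.norm_of_nonneg hr0.le] at e2
      nlinarith [mul_le_one₀ hl1 (norm_nonneg x) hx, mul_nonneg (norm_nonneg l) (norm_nonneg x)]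
    have hnr : ∀ x : ℂ, ‖x‖ ≤ 1 → ‖(r : ℂ) * x‖ ≤ 1 := by
      intro x hx
      rw [norm_mul, Complex.norm_real, Real.norm_of_nonneg hr0.le]
      exact mul_le_one₀ hr1.le (norm_nonneg x) hx
    have hE : 0 < 1 - r ^ 2 * ‖l‖ ^ 2 := by nlinarith [norm_nonneg l, mul_le_one₀ hl1 (norm_nonneg l) hl1, sq_nonneg ‖l‖]
    have hEc : 1 - (starRingEnd ℂ) (r * l) * (r * l) = ((1 - r ^ 2 * ‖l‖ ^ 2 : ℝ) : ℂ) := by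
      have : (starRingEnd ℂ) l * l = ((‖l‖ ^ 2 : ℝ) : ℂ) := by
        rw [mul_comm, Complex.mul_conj, Complex.normSq_eq_norm_sq]
      rw [map_mul, Complex.conj_ofReal]; push_cast at this ⊢; linear_combination -(r:ℂ)^2 * this
    have := D.phi_le (φ := fun z => (r * f z - r * l) / (1 - (starRingEnd ℂ) (r * l) * (r * f z)))
      (v := r * w / (1 - (starRingEnd ℂ) (r * l) * (r * l))) qc qd q1
      (((fd.const_mul _).sub_const _).div (((fd.const_mul _).const_mul _).const_sub _) (fun z hz => hden _ (f1 z hz)))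
      (fun z hz => by
        rw [norm_div]
        exact div_le_one_of_le₀ (mob_le (hnr _ (f1 z hz)) (hnr _ hl1)) (norm_nonneg _))
      (by
        refine ((hw.const_mul (r:ℂ)).div (tendsto_const_nhds.sub ((hl.const_mul (r:ℂ)).const_mul _)) (hden l hl1)).congr ?_
        intro z
        simp only [Pi.div_apply]
        ring)
    refine le_trans ?_ this
    rw [hEc, norm_div, norm_mul, Complex.norm_real, Complex.norm_real, Real.norm_of_nonneg hr0.le, Real.norm_of_nonneg hE.le]
    refine mul_le_mul_of_nonneg_left ?_ (by positivity)
    rw [le_div_iff₀ hE]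
    have : 0 ≤ r * ‖w‖ := by positivity
    nlinarith [mul_nonneg this (by positivity : 0 ≤ r ^ 2 * ‖l‖ ^ 2)]
  have ht : Tendsto (fun r : ℝ => 2 * Real.pi * (r * ‖w‖)) (𝓝[<] 1) (𝓝 (2 * Real.pi * (1 * ‖w‖))) :=
    ((continuous_const.mul (continuous_id.mul continuous_const)).tendsto (1:ℝ)).mono_left nhdsWithin_le_nhds
  rw [one_mul] at ht
  refine le_of_tendsto ht ?_
  filter_upwards [Ioo_mem_nhdsLT (zero_lt_one (α := ℝ))] with r hr using key r hr.1 hr.2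
end fin2

/-- If `K ⊆ ℂ` is compact with `Ω = ℂ∞ ∖ K` a finitely connected domain with
`C^∞` boundary, then
`γ(K) = max { 2 Re h′(∞) − (1/2π) ∫_{∂Ω} |h(z)|² |dz| : h ∈ A(Ω), h(∞) = 0 }`,
the maximum being attained. -/
theorem analyticCapacity_eq_max (K : Set ℂ) (hK : IsCompact K)
    (hconn : IsConnected Kᶜ) (B : SmoothBoundary K) :
    IsGreatest { r : ℝ | ∃ (h : ℂ → ℂ) (w : ℂ), MemA K h 0 ∧
        Tendsto (fun z => z * h z) (cobounded ℂ ⊓ 𝓟 Kᶜ) (𝓝 w) ∧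
        r = 2 * w.re - 1 / (2 * Real.pi) * arcIntegralOf B.curve (fun z => ‖h z‖ ^ 2) }
      (analyticCapacity K) := by
  obtain ⟨s0, c, D⟩ := exists_dom hK hconn B
  obtain ⟨h, q, hc, hd, qc, qd, ⟨w, hw⟩, ⟨wq, hwq⟩, hb⟩ := D.exists_hq
  have hpi := Real.pi_pos
  have h0 : Tendsto h (cobounded ℂ) (𝓝 0) := tendsto_zero_of_mul le_rfl hw
  have q1 : Tendsto q (cobounded ℂ) (𝓝 1) := by
    have := (tendsto_zero_of_mul (f := fun z => q z - 1) le_rfl hwq).add_const 1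
    simpa using this
  have hlt := D.lt_of_hq hc hd qc qd h0 q1 hb
  set M : ℝ := 1 / (2 * Real.pi) * arcIntegralOf B.curve (fun z => ‖h z‖ ^ 2) with hM
  have hwM : w = (M : ℂ) := D.arc_eq hc hd qc qd q1 hb hw
  have harc : arcIntegralOf B.curve (fun z => ‖h z‖ ^ 2) = arcIntegralOf B.curve (fun z => ‖q z‖ ^ 2) := by
    unfold arcIntegralOf
    refine Finset.sum_congr rfl fun i _ => ?_
    congr 1; ext t
    simp only [hb i t, norm_mul, RCLike.norm_conj, (D.sc i).tg_norm, Complex.norm_I, one_mul]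
  have hM0 : 0 ≤ M := by
    apply mul_nonneg (by positivity)
    exact Finset.sum_nonneg fun i _ => intervalIntegral.integral_nonneg zero_le_one fun t _ => by positivity
  have hq0 : ∀ z ∈ Kᶜ, q z ≠ 0 := fun z hz e => by
    have := hlt z hz
    rw [e, norm_zero] at this
    exact absurd this (not_lt.2 (norm_nonneg _))
  have hcap : analyticCapacity K = M := by
    refine IsGreatest.csSup_eq ⟨?_, ?_⟩
    · refine ⟨fun z => h z / q z, 0, (M : ℂ), hd.div qd hq0, fun z hz => ?_, ⟨?_, ?_⟩, ?_⟩
      · rw [norm_div]; exact div_le_one_of_le₀ (hlt z hz).le (norm_nonneg _)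
      · rw [inf_compl hK]
        have := h0.div q1 one_ne_zero
        rw [div_one] at this
        exact this
      · rw [inf_compl hK]
        have := hw.div q1 one_ne_zero
        rw [hwM, div_one] at this
        refine this.congr fun z => ?_
        simp only [Pi.div_apply, sub_zero]; ring
      · rw [Complex.norm_real, Real.norm_of_nonneg hM0]
    · rintro r ⟨f, l, v, fd, f1, ⟨hl, hv⟩, rfl⟩
      rw [inf_compl hK] at hl hv
      have := D.cap_le qc qd q1 fd f1 hl hv
      rw [← harc] at this
      rw [hM, one_div, inv_mul_eq_div, le_div_iff₀ (by positivity), mul_comm]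
      exact this
  rw [hcap]
  refine ⟨⟨h, w, ⟨hc, hd, ?_⟩, ?_, ?_⟩, ?_⟩
  · rw [inf_compl hK]; exact h0
  · rw [inf_compl hK]; exact hw
  · rw [← hM, hwM, Complex.ofReal_re]; ring
  · rintro r ⟨g, v, ⟨gc, gd, -⟩, hv, rfl⟩
    rw [inf_compl hK] at hv
    exact D.le_max hc qc qd q1 hb gc gd hv
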